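/- Fix an integer k ≥ 1. There exists a constant C > 0 such that for all sufficiently large real x and every real δ > 0, the number of positive integers n ≤ x satisfying φ_k(n) ≥ δ·n is at most (6/((k-1)!·e^{(k-1)γ}·π²)) · x/(δ·(log log log x)^{k-1}) + C · x/(δ·(log log log x)^k·(log log x)·(log x)). -/

import Mathlib

open Real Finset

namespace IterTotient

/-- Primes reachable from `p` by `j` steps `r ↦ q` with `r ∣ q - 1`. -/
def chainSet (p : ℕ) : ℕ → Set ℕ
  | 0 => {p}
  | j + 1 => {q | q.Prime ∧ ∃ r ∈ chainSet p j, r ∣ q - 1}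

lemma prime_of_mem_chainSet {p : ℕ} (hp : p.Prime) {j q : ℕ} (hq : q ∈ chainSet p j) :
    q.Prime := by
  cases j with
  | zero => simp only [chainSet, Set.mem_singleton_iff] at hq; exact hq ▸ hp
  | succ j => exact hq.1

lemma dvd_iterate_totient {p : ℕ} {j : ℕ} : ∀ {q n : ℕ}, q ∈ chainSet p j → q ∣ n →
    p ∣ Nat.totient^[j] n := by
  induction j with
  | zero =>
    intro q n hq h
    simp only [chainSet, Set.mem_singleton_iff] at hq
    simpa [← hq] using h
  | succ j ih =>
    rintro q n ⟨hq, r, hr, hrq⟩ h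
    rw [Function.iterate_succ_apply]
    refine ih hr (hrq.trans ?_)
    rw [← Nat.totient_prime hq]
    exact Nat.totient_dvd_of_dvd h

lemma card_filter_dvd (N d : ℕ) : #{n ∈ Icc 1 N | d ∣ n} = N / d := by
  rw [← Nat.Ioc_filter_dvd_card_eq_div]
  rfl

lemma card_forall_not_dvd_mul_le (N : ℕ) (Q : Finset ℕ) (hQ : ∀ q ∈ Q, q.Prime ∧ q ≤ N) :
    (#{n ∈ Icc 1 N | ∀ q ∈ Q, ¬ q ∣ n} : ℝ) * ∑ q ∈ Q, (1 / q : ℝ) ≤ 3 * N := by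
  set S : ℝ := ∑ q ∈ Q, (1 / q : ℝ) with hS
  have hS0 : 0 ≤ S := sum_nonneg fun q _ => by positivity
  rcases hS0.eq_or_lt with h0 | hSpos
  · rw [← h0]; simp
  have hcardQ : (#Q : ℝ) ≤ N := by
    have : Q ⊆ Icc 1 N := fun q hq => mem_Icc.2 ⟨(hQ q hq).1.one_le, (hQ q hq).2⟩
    have := card_le_card this
    simp only [Nat.card_Icc, add_tsub_cancel_right] at this
    exact_mod_cast this
  set w : ℕ → ℝ := fun n => ∑ q ∈ Q, if q ∣ n then (1 : ℝ) else 0 with hw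
  have hcount (d : ℕ) : ∑ n ∈ Icc 1 N, (if d ∣ n then (1 : ℝ) else 0) = ((N / d : ℕ) : ℝ) := by
    rw [← card_filter_dvd N d, sum_boole]
  have hfirst : N * S - #Q ≤ ∑ n ∈ Icc 1 N, w n := by
    rw [hw, sum_comm, hS, mul_sum, card_eq_sum_ones, Nat.cast_sum, ← sum_sub_distrib]
    refine sum_le_sum fun q hq => ?_
    rw [hcount]
    have := Nat.lt_div_mul_add (a := N) (hQ q hq).1.pos
    have hq0 : (0 : ℝ) < q := by exact_mod_cast (hQ q hq).1.pos
    have h2 : (N : ℝ) < (N / q : ℕ) * q + q := by exact_mod_cast this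
    push_cast
    rw [sub_le_iff_le_add, mul_one_div, div_le_iff₀ hq0]
    linarith
  have hsecond : ∑ n ∈ Icc 1 N, w n ^ 2 ≤ N * S + N * S ^ 2 := by
    have h1 : ∀ n, w n ^ 2 = ∑ q ∈ Q, ∑ r ∈ Q, if q ∣ n ∧ r ∣ n then (1 : ℝ) else 0 := by
      intro n
      rw [hw, sq, sum_mul_sum]
      refine sum_congr rfl fun q _ => sum_congr rfl fun r _ => ?_
      by_cases h : q ∣ n <;> by_cases h' : r ∣ n <;> simp [h, h']
    simp_rw [h1]
    rw [sum_comm]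
    simp_rw [sum_comm (s := Icc 1 N)]
    have h2 : ∀ q ∈ Q, ∀ r ∈ Q, ∑ n ∈ Icc 1 N, (if q ∣ n ∧ r ∣ n then (1 : ℝ) else 0) ≤
        (if q = r then (N : ℝ) * (1 / q) else 0) + N * (1 / q * (1 / r)) := by
      intro q hq r hr
      split_ifs with h
      · subst h
        simp only [and_self]
        rw [hcount]
        have : ((N / q : ℕ) : ℝ) ≤ N / q := Nat.cast_div_le
        have h3 : (0 : ℝ) ≤ N * (1 / q * (1 / q)) := by positivity
        rw [mul_one_div]; linarith
      · have hc : Nat.Coprime q r := (Nat.coprime_primes (hQ q hq).1 (hQ r hr).1).2 h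
        have : ∀ n, (q ∣ n ∧ r ∣ n) ↔ q * r ∣ n := fun n =>
          ⟨fun h => hc.mul_dvd_of_dvd_of_dvd h.1 h.2,
            fun h => ⟨(dvd_mul_right _ _).trans h, (dvd_mul_left _ _).trans h⟩⟩
        simp_rw [this]
        rw [hcount]
        have : ((N / (q * r) : ℕ) : ℝ) ≤ N / (q * r : ℕ) := Nat.cast_div_le
        push_cast at this
        rw [zero_add, one_div_mul_one_div, mul_one_div]; exact this
    calc _ ≤ ∑ q ∈ Q, ∑ r ∈ Q, ((if q = r then (N : ℝ) * (1 / q) else 0) +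
            N * (1 / q * (1 / r))) := sum_le_sum fun q hq => sum_le_sum fun r hr => h2 q hq r hr
      _ = N * S + N * S ^ 2 := by
        simp_rw [sum_add_distrib, ← mul_sum]
        congr 1
        · rw [hS, mul_sum]
          refine sum_congr rfl fun q hq => ?_
          rw [sum_ite_eq]; simp [hq]
        · rw [← sum_mul, ← hS]; ring
  have hvar : ∑ n ∈ Icc 1 N, (w n - S) ^ 2 ≤ 3 * N * S := by
    have : ∑ n ∈ Icc 1 N, (w n - S) ^ 2 =
        ∑ n ∈ Icc 1 N, w n ^ 2 - 2 * S * ∑ n ∈ Icc 1 N, w n + N * S ^ 2 := by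
      simp_rw [sub_sq, sum_add_distrib, sum_sub_distrib]
      simp only [mul_sum, sum_const, Nat.card_Icc, add_tsub_cancel_right, nsmul_eq_mul]
      congr 2
      exact sum_congr rfl fun _ _ => by ring
    rw [this]
    nlinarith [mul_le_mul_of_nonneg_left hfirst hS0, mul_le_mul_of_nonneg_left hcardQ hS0]
  have hbad : (#{n ∈ Icc 1 N | ∀ q ∈ Q, ¬ q ∣ n} : ℝ) * S ^ 2 ≤
      ∑ n ∈ Icc 1 N, (w n - S) ^ 2 := by
    rw [← nsmul_eq_mul, ← sum_const]
    calc _ ≤ ∑ n ∈ Icc 1 N with ∀ q ∈ Q, ¬ q ∣ n, (w n - S) ^ 2 := by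
          refine sum_le_sum fun n hn => ?_
          have : w n = 0 := sum_eq_zero fun q hq => by simp [(mem_filter.1 hn).2 q hq]
          rw [this]; simp
      _ ≤ _ := sum_le_sum_of_subset_of_nonneg (filter_subset _ _) fun _ _ _ => sq_nonneg _
  have h3 := hbad.trans hvar
  rw [sq, ← mul_assoc] at h3
  exact le_of_mul_le_mul_right h3 hSpos

section

open ArithmeticFunction (vonMangoldt)

/-- The partial sums `∑_{n ≤ N} Λ(n) / n`. -/
noncomputable def mangoldtSum (N : ℕ) : ℝ := ∑ n ∈ Ioc 0 N, vonMangoldt n / n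

/-- The partial sums `∑_{n ≤ N} Λ(n) / (n log n)`. -/
noncomputable def mangoldtLogSum (N : ℕ) : ℝ := ∑ n ∈ Ioc 0 N, vonMangoldt n / (n * log n)

lemma log_factorial_eq (N : ℕ) :
    log (N.factorial : ℝ) = ∑ n ∈ Ioc 0 N, vonMangoldt n * ((N / n : ℕ) : ℝ) := by
  rw [← ArithmeticFunction.sum_Ioc_mul_zeta_eq_sum, ArithmeticFunction.vonMangoldt_mul_zeta]
  induction N with
  | zero => simp
  | succ N ih =>
    rw [Nat.factorial_succ, Nat.cast_mul, log_mul (by positivity) (by positivity), ih,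
      Finset.sum_Ioc_succ_top (Nat.zero_le N)]
    simp [add_comm]

lemma mangoldtSum_bounds {N : ℕ} (hN : 1 ≤ N) :
    |mangoldtSum N - log N| ≤ 8 := by
  have hN0 : (0 : ℝ) < N := by exact_mod_cast hN
  have hpsi : ∑ n ∈ Ioc 0 N, vonMangoldt n ≤ (log 4 + 4) * N := by
    have := Chebyshev.psi_le_const_mul_self (x := N) hN0.le
    simpa [Chebyshev.psi] using this
  have hl4 : log 4 ≤ 2 := by
    have : log 4 = 2 * log 2 := by
      rw [show (4 : ℝ) = 2 ^ 2 by norm_num, log_pow]; norm_num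
    linarith [log_two_lt_d9]
  have hf := log_factorial_eq N
  have h1 : log (N.factorial : ℝ) ≤ N * log N := by
    rw [← log_pow]
    exact log_le_log (by positivity) (by exact_mod_cast Nat.factorial_le_pow N)
  have h2 : N * log N - N ≤ log (N.factorial : ℝ) := by
    have := Real.pow_div_factorial_le_exp (x := N) hN0.le N
    have h := log_le_log (by positivity) this
    rw [log_exp, log_div (by positivity) (by positivity), log_pow] at h
    linarith
  have hup : ∑ n ∈ Ioc 0 N, vonMangoldt n * ((N / n : ℕ) : ℝ) ≤ N * mangoldtSum N := by
    rw [mangoldtSum, mul_sum]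
    refine sum_le_sum fun n hn => ?_
    have := @Nat.cast_div_le ℝ _ _ _ N n
    calc vonMangoldt n * ((N / n : ℕ) : ℝ) ≤ vonMangoldt n * ((N : ℝ) / n) :=
          mul_le_mul_of_nonneg_left this ArithmeticFunction.vonMangoldt_nonneg
      _ = _ := by ring
  have hlo : N * mangoldtSum N - ∑ n ∈ Ioc 0 N, vonMangoldt n ≤
      ∑ n ∈ Ioc 0 N, vonMangoldt n * ((N / n : ℕ) : ℝ) := by
    rw [mangoldtSum, mul_sum, ← sum_sub_distrib]
    refine sum_le_sum fun n hn => ?_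
    have hn0 : 0 < n := (mem_Ioc.1 hn).1
    have : (N : ℝ) / n - 1 ≤ ((N / n : ℕ) : ℝ) := by
      have := Nat.lt_floor_add_one ((N : ℝ) / n)
      rw [Nat.floor_div_eq_div] at this
      linarith
    calc _ = vonMangoldt n * ((N : ℝ) / n - 1) := by ring
      _ ≤ _ := mul_le_mul_of_nonneg_left this ArithmeticFunction.vonMangoldt_nonneg
  have hmul : (log 4 + 4) * (N : ℝ) ≤ 6 * N := by
    apply mul_le_mul_of_nonneg_right _ hN0.le; linarith
  rw [abs_le]
  constructor
  · have : (N : ℝ) * (log N - 8) ≤ N * mangoldtSum N := by nlinarith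
    linarith [le_of_mul_le_mul_left this hN0]
  · have : N * mangoldtSum N ≤ (N : ℝ) * (log N + 8) := by nlinarith
    linarith [le_of_mul_le_mul_left this hN0]

lemma mangoldtLogSum_sub_le {z : ℕ} (hz : 2 ≤ z) {x : ℕ} (hx : z ≤ x) :
    mangoldtLogSum x - mangoldtLogSum z ≤ log (log x) - log (log z) + 16 / log z := by
  have key : ∀ x : ℕ, z ≤ x → mangoldtLogSum x - mangoldtLogSum z ≤
      log (log x) - log (log z) + (mangoldtSum x - log x) / log x + 8 / log z +
        8 * (1 / log z - 1 / log x) := by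
    intro x hx
    induction x, hx using Nat.le_induction with
    | base =>
      have hlz : 0 < log (z : ℝ) := log_pos (by exact_mod_cast hz)
      have := (abs_le.1 (mangoldtSum_bounds (N := z) (by omega))).1
      have h2 : -8 / log (z : ℝ) ≤ (mangoldtSum z - log z) / log z :=
        div_le_div_of_nonneg_right this hlz.le
      have h3 : -8 / log (z : ℝ) = -(8 / log z) := by ring
      linarith
    | succ x hx ih =>
      have hx2 : 2 ≤ x := hz.trans hx
      have ha : 0 < log (x : ℝ) := log_pos (by exact_mod_cast hx2)
      have hab : log (x : ℝ) ≤ log ((x + 1 : ℕ) : ℝ) :=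
        log_le_log (by positivity) (by push_cast; linarith)
      have hb : 0 < log ((x + 1 : ℕ) : ℝ) := ha.trans_le hab
      have e1 : mangoldtSum (x + 1) = mangoldtSum x +
          vonMangoldt (x + 1) / ((x + 1 : ℕ) : ℝ) := by
        rw [mangoldtSum, mangoldtSum, Finset.sum_Ioc_succ_top (Nat.zero_le x)]
      have e2 : mangoldtLogSum (x + 1) = mangoldtLogSum x +
          vonMangoldt (x + 1) / ((x + 1 : ℕ) : ℝ) / log ((x + 1 : ℕ) : ℝ) := by
        rw [mangoldtLogSum, mangoldtLogSum, Finset.sum_Ioc_succ_top (Nat.zero_le x), div_div]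
      have hM := abs_le.1 (mangoldtSum_bounds (N := x) (by omega))
      generalize mangoldtSum x = M at *
      generalize vonMangoldt (x + 1) / ((x + 1 : ℕ) : ℝ) = w at *
      rw [e1, e2]
      generalize log ((x + 1 : ℕ) : ℝ) = b at *
      generalize log (x : ℝ) = a at *
      have h1 : 1 - a / b ≤ log b - log a := by
        have := Real.one_sub_inv_le_log_of_pos (x := b / a) (by positivity)
        rw [log_div hb.ne' ha.ne', inv_div] at this
        exact this
      have h2 : (M - a) * (1 / a - 1 / b) ≤ 8 * (1 / a - 1 / b) :=
        mul_le_mul_of_nonneg_right hM.2 (sub_nonneg.2 (one_div_le_one_div_of_le ha hab))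
      have h3 : (M + w - b) / b = M / b + w / b - 1 := by field_simp
      have h4 : (M - a) * (1 / a - 1 / b) = (M - a) / a - M / b + a / b := by field_simp; ring
      rw [h3]
      linarith
  have hx2 : 2 ≤ x := hz.trans hx
  have ha : 0 < log (x : ℝ) := log_pos (by exact_mod_cast hx2)
  have hM := (abs_le.1 (mangoldtSum_bounds (N := x) (by omega))).2
  have := key x hx
  have h2 : (mangoldtSum x - log x) / log x ≤ 8 / log x := by gcongr
  have h3 : 8 * (1 / log (z : ℝ) - 1 / log (x : ℝ)) = 8 / log z - 8 / log x := by ring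
  have h4 : 16 / log (z : ℝ) = 8 / log z + 8 / log z := by ring
  linarith

end

section

open ArithmeticFunction (vonMangoldt)

lemma mangoldtLogSum_mono {a b : ℕ} (h : a ≤ b) : mangoldtLogSum a ≤ mangoldtLogSum b :=
  sum_le_sum_of_subset_of_nonneg (Ioc_subset_Ioc_right h) fun n _ _ =>
    div_nonneg ArithmeticFunction.vonMangoldt_nonneg
      (mul_nonneg n.cast_nonneg (log_natCast_nonneg n))

lemma mangoldtLogSum_floor_exp_le {z : ℕ} (hz : 2 ≤ z) {u : ℝ} (hu : 0 < u) :
    mangoldtLogSum ⌊exp u⌋₊ ≤ mangoldtLogSum z - log (log z) + 16 / log z + log u +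
      2 * √(log z) / √u := by
  have hlz : 0 < log (z : ℝ) := log_pos (by exact_mod_cast hz)
  rcases le_or_gt z ⌊exp u⌋₊ with h | h
  · have h1 := mangoldtLogSum_sub_le hz h
    have h2 : log (⌊exp u⌋₊ : ℝ) ≤ u := by
      have := log_le_log (x := (⌊exp u⌋₊ : ℝ)) (by exact_mod_cast (by omega))
        (Nat.floor_le (exp_pos u).le)
      rwa [log_exp] at this
    have h3 : log (log (⌊exp u⌋₊ : ℝ)) ≤ log u :=
      log_le_log (log_pos (by exact_mod_cast (by omega))) h2
    have : 0 ≤ 2 * √(log z) / √u := by positivity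
    linarith
  · have h1 := mangoldtLogSum_mono h.le
    have h2 : log (log z) - log u ≤ 2 * √(log z) / √u := by
      have := Real.log_le_sub_one_of_pos (x := √(log z) / √u) (by positivity)
      rw [log_div (by positivity) (by positivity), log_sqrt hlz.le, log_sqrt hu.le] at this
      have e : 2 * √(log z) / √u = 2 * (√(log z) / √u) := by ring
      linarith
    have : 0 ≤ 16 / log (z : ℝ) := by positivity
    linarith

lemma sum_vonMangoldt_rpow_le {σ ε : ℝ} (hσ : 0 < σ) (hε : 0 < ε) {K D : ℝ}
    (h : ∀ u > 0, mangoldtLogSum ⌊exp u⌋₊ ≤ K + log u + D / √u) (s : Finset ℕ) :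
    ∑ n ∈ s, vonMangoldt n / ((n : ℝ) ^ (1 + σ) * log n) ≤
      (K - log σ - 1 / ε) + Gamma (1 + ε) / ε + D * √σ * Gamma (1 / 2) := by
  let a : ℕ → ℝ := fun n => vonMangoldt n / (n * log n)
  have ha : ∀ n, 0 ≤ a n := fun n => div_nonneg ArithmeticFunction.vonMangoldt_nonneg
      (mul_nonneg n.cast_nonneg (log_natCast_nonneg n))
  have hterm : ∀ n ∈ s, vonMangoldt n / ((n : ℝ) ^ (1 + σ) * log n) =
      ∫ v in Set.Ioi (0 : ℝ), (Set.Ioi (σ * log n)).indicator (fun v => a n * exp (-v)) v := by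
    intro n hn
    have h0 : 0 ≤ σ * log n := mul_nonneg hσ.le (log_natCast_nonneg n)
    rw [MeasureTheory.setIntegral_indicator measurableSet_Ioi, Set.Ioi_inter_Ioi,
      max_eq_right h0, MeasureTheory.integral_const_mul, integral_exp_neg_Ioi]
    rcases Nat.eq_zero_or_pos n with rfl | hn
    · simp [a]
    have hn' : (0 : ℝ) < n := by exact_mod_cast hn
    rw [rpow_add hn', rpow_one, rpow_def_of_pos hn', exp_neg, mul_comm σ]
    simp only [a]
    field_simp
  have hintegr_exp : MeasureTheory.IntegrableOn (fun v : ℝ => exp (-v)) (Set.Ioi 0) := by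
    simpa using Real.GammaIntegral_convergent one_pos
  have hintegr : ∀ n ∈ s, MeasureTheory.IntegrableOn
      ((Set.Ioi (σ * log n)).indicator (fun v => a n * exp (-v))) (Set.Ioi 0) := fun n _ =>
    (hintegr_exp.const_mul (a n)).indicator measurableSet_Ioi
  rw [sum_congr rfl hterm, ← MeasureTheory.integral_finsetSum s hintegr]
  have i1 := Real.GammaIntegral_convergent (s := 1 + ε) (by positivity)
  have i2 := Real.GammaIntegral_convergent (s := 1 / 2) (by norm_num)
  have hG1 := Real.Gamma_eq_integral (s := 1 + ε) (by positivity)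
  have hG2 := Real.Gamma_eq_integral (s := 1 / 2) (by norm_num)
  have hG0 : ∫ v in Set.Ioi (0 : ℝ), exp (-v) = 1 := by
    rw [integral_exp_neg_Ioi]; simp
  have i12 : MeasureTheory.IntegrableOn (fun v : ℝ => (K - log σ - 1 / ε) * exp (-v) +
      1 / ε * (exp (-v) * v ^ (1 + ε - 1))) (Set.Ioi 0) :=
    MeasureTheory.Integrable.add (hintegr_exp.const_mul _) (i1.const_mul _)
  have hR : ∫ v in Set.Ioi (0 : ℝ), ((K - log σ - 1 / ε) * exp (-v) +
      1 / ε * (exp (-v) * v ^ (1 + ε - 1)) +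
      D * √σ * (exp (-v) * v ^ ((1 : ℝ) / 2 - 1))) =
      (K - log σ - 1 / ε) + Gamma (1 + ε) / ε + D * √σ * Gamma (1 / 2) := by
    rw [MeasureTheory.integral_add i12 (i2.const_mul _),
      MeasureTheory.integral_add (hintegr_exp.const_mul _) (i1.const_mul _),
      MeasureTheory.integral_const_mul, MeasureTheory.integral_const_mul,
      MeasureTheory.integral_const_mul, hG0, ← hG1, ← hG2]
    ring
  rw [← hR]
  refine MeasureTheory.setIntegral_mono_on (MeasureTheory.integrable_finsetSum s hintegr)
    (MeasureTheory.Integrable.add i12 (i2.const_mul _)) measurableSet_Ioi ?_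
  intro v hv
  have hv : 0 < v := hv
  have hb : ∑ n ∈ s, (Set.Ioi (σ * log n)).indicator (fun v => a n * exp (-v)) v ≤
      exp (-v) * mangoldtLogSum ⌊exp (v / σ)⌋₊ := by
    have h1 : ∀ n ∈ s, (Set.Ioi (σ * log n)).indicator (fun v => a n * exp (-v)) v ≤
        if n ∈ Ioc 0 ⌊exp (v / σ)⌋₊ then exp (-v) * a n else 0 := by
      intro n _
      rcases Nat.eq_zero_or_pos n with rfl | hn
      · simp [Set.indicator, a]
      by_cases hc : σ * log n < v
      · rw [Set.indicator_of_mem (by exact hc), if_pos, mul_comm]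
        rw [mem_Ioc]
        refine ⟨hn, Nat.le_floor ?_⟩
        rw [← log_le_iff_le_exp (by exact_mod_cast hn), le_div_iff₀ hσ]
        linarith
      · rw [Set.indicator_of_notMem (by exact hc)]
        split_ifs
        · exact mul_nonneg (exp_pos _).le (ha n)
        · exact le_rfl
    refine (sum_le_sum h1).trans ?_
    rw [← sum_filter, mangoldtLogSum, mul_sum]
    refine sum_le_sum_of_subset_of_nonneg (fun n hn => (mem_filter.1 hn).2) ?_
    exact fun n _ _ => mul_nonneg (exp_pos _).le (ha n)
  refine hb.trans ?_
  have h1 := h (v / σ) (by positivity)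
  have h2 : log (v / σ) ≤ (v ^ ε - 1) / ε - log σ := by
    rw [log_div hv.ne' hσ.ne']
    have := Real.log_le_sub_one_of_pos (x := v ^ ε) (by positivity)
    rw [log_rpow hv] at this
    have : log v ≤ (v ^ ε - 1) / ε := by rw [le_div_iff₀ hε]; linarith
    linarith
  have h3 : D / √(v / σ) = D * √σ * v ^ ((1 : ℝ) / 2 - 1) := by
    rw [sqrt_div hv.le, show (1 : ℝ) / 2 - 1 = -(1 / 2) by norm_num, rpow_neg hv.le,
      ← sqrt_eq_rpow]
    field_simp
  have h4 : mangoldtLogSum ⌊exp (v / σ)⌋₊ ≤ K - log σ - 1 / ε + 1 / ε * v ^ ε +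
      D * √σ * v ^ ((1 : ℝ) / 2 - 1) := by
    rw [← h3]
    have : (v ^ ε - 1) / ε = 1 / ε * v ^ ε - 1 / ε := by ring
    linarith
  calc _ ≤ exp (-v) * _ := mul_le_mul_of_nonneg_left h4 (exp_pos _).le
    _ = _ := by rw [show (1 + ε - 1 : ℝ) = ε by ring]; ring

lemma eulerMascheroni_le_mangoldtLogSum {z : ℕ} (hz : 2 ≤ z) :
    eulerMascheroniConstant ≤ mangoldtLogSum z - log (log z) + 16 / log z := by
  set K := mangoldtLogSum z - log (log z) + 16 / log z with hK
  have hmain : ∀ ε > 0, ∀ σ > 0, log ((riemannZeta ((1 + σ : ℝ) : ℂ)).re) ≤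
      (K - log σ - 1 / ε) + Gamma (1 + ε) / ε + 2 * √(log z) * √σ * Gamma (1 / 2) := by
    intro ε hε σ hσ
    rw [log_riemannZeta_eq (by linarith)]
    refine Real.tsum_le_of_sum_le (fun n => ?_) fun s => ?_
    · exact div_nonneg ArithmeticFunction.vonMangoldt_nonneg
        (mul_nonneg (by positivity) (log_natCast_nonneg n))
    · exact sum_vonMangoldt_rpow_le hσ hε (fun u hu => mangoldtLogSum_floor_exp_le hz hu) s
  have hzeta : Filter.Tendsto (fun σ : ℝ => log (σ * (riemannZeta ((1 + σ : ℝ) : ℂ)).re))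
      (nhdsWithin 0 (Set.Ioi 0)) (nhds 0) := by
    have h1 := riemannZeta_residue_one
    have h2 : Filter.Tendsto (fun σ : ℝ => ((1 + σ : ℝ) : ℂ)) (nhdsWithin 0 (Set.Ioi 0))
        (nhdsWithin 1 {1}ᶜ) := by
      refine tendsto_nhdsWithin_iff.2 ⟨?_, ?_⟩
      · have : Continuous (fun σ : ℝ => ((1 + σ : ℝ) : ℂ)) := by fun_prop
        have := this.tendsto 0
        simp only [add_zero, Complex.ofReal_one] at this
        exact this.mono_left nhdsWithin_le_nhds
      · filter_upwards [self_mem_nhdsWithin] with σ hσ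
        have : σ ≠ 0 := (ne_of_gt hσ)
        simpa using this
    have h3 := (Complex.continuous_re.tendsto _).comp (h1.comp h2)
    have h4 := (continuousAt_log (x := 1) one_ne_zero).tendsto.comp h3
    rw [log_one] at h4
    refine h4.congr fun σ => ?_
    simp only [Function.comp]
    rw [show ((1 + σ : ℝ) : ℂ) - 1 = (σ : ℂ) by push_cast; ring, Complex.re_ofReal_mul]
  have hlim : ∀ ε > 0, 0 ≤ K + (Gamma (1 + ε) - 1) / ε := by
    intro ε hε
    have hr : Filter.Tendsto (fun σ : ℝ => (K - 1 / ε) + Gamma (1 + ε) / ε +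
        2 * √(log z) * √σ * Gamma (1 / 2)) (nhdsWithin 0 (Set.Ioi 0))
        (nhds ((K - 1 / ε) + Gamma (1 + ε) / ε + 2 * √(log z) * √0 * Gamma (1 / 2))) := by
      refine Filter.Tendsto.mono_left (Continuous.tendsto ?_ 0) nhdsWithin_le_nhds
      fun_prop
    have := le_of_tendsto_of_tendsto hzeta hr ?_
    · rw [sqrt_zero] at this
      have e : (Gamma (1 + ε) - 1) / ε = Gamma (1 + ε) / ε - 1 / ε := by ring
      linarith
    · have hpos : ∀ᶠ σ : ℝ in nhdsWithin 0 (Set.Ioi 0),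
          0 < (riemannZeta ((1 + σ : ℝ) : ℂ)).re := by
        filter_upwards [self_mem_nhdsWithin] with σ hσ
        have hσ : 0 < σ := hσ
        rw [zeta_eq_tsum_one_div_nat_cpow (by simpa using hσ)]
        have hs : Summable fun n : ℕ => 1 / (n : ℝ) ^ (1 + σ) :=
          Real.summable_one_div_nat_rpow.2 (by linarith)
        have : ∀ n : ℕ, (1 : ℂ) / (n : ℂ) ^ ((1 + σ : ℝ) : ℂ) =
            ((1 / (n : ℝ) ^ (1 + σ) : ℝ) : ℂ) := by
          intro n
          push_cast [Complex.ofReal_cpow n.cast_nonneg]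
          rfl
        simp_rw [this]
        rw [← Complex.ofReal_tsum, Complex.ofReal_re]
        exact hs.tsum_pos (fun n => by positivity) 1 (by norm_num)
      filter_upwards [self_mem_nhdsWithin, hpos] with σ hσ hp
      have hσ : 0 < σ := hσ
      rw [log_mul hσ.ne' hp.ne']
      linarith [hmain ε hε σ hσ]
  have hd : Filter.Tendsto (fun ε : ℝ => K + (Gamma (1 + ε) - 1) / ε)
      (nhdsWithin 0 (Set.Ioi 0)) (nhds (K + -eulerMascheroniConstant)) := by
    refine Filter.Tendsto.const_add _ ?_
    have := Real.hasDerivAt_Gamma_one.tendsto_slope_zero_right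
    refine this.congr fun ε => ?_
    simp [Gamma_one, smul_eq_mul, div_eq_inv_mul]
  have := ge_of_tendsto hd (by
    filter_upwards [self_mem_nhdsWithin] with ε hε using hlim ε hε)
  linarith

end

section

open ArithmeticFunction (vonMangoldt)

lemma mangoldtLogSum_le_sum_primes (N : ℕ) :
    mangoldtLogSum N ≤ ∑ p ∈ Ioc 0 N with p.Prime, -log (1 - 1 / (p : ℝ)) := by
  let f : ℕ → ℝ := fun n => vonMangoldt n / (n * log n)
  have hf : ∀ n, 0 ≤ f n := fun n => div_nonneg ArithmeticFunction.vonMangoldt_nonneg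
      (mul_nonneg n.cast_nonneg (log_natCast_nonneg n))
  have h1 : mangoldtLogSum N = ∑ n ∈ Ioc 0 N with IsPrimePow n, f n := by
    rw [mangoldtLogSum, sum_filter]
    refine sum_congr rfl fun n _ => ?_
    split_ifs with h
    · rfl
    · rw [ArithmeticFunction.vonMangoldt_eq_zero_iff.2 h, zero_div]
  have h2 := Chebyshev.sum_PrimePow_eq_sum_sum f (x := N) N.cast_nonneg
  rw [Nat.floor_natCast] at h2
  rw [h1, h2]
  set M := ⌊log N / log 2⌋₊
  have h3 : ∀ k ∈ Icc 1 M, ∑ p ∈ Ioc 0 ⌊(N : ℝ) ^ ((1 : ℝ) / k)⌋₊ with p.Prime, f (p ^ k) ≤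
      ∑ p ∈ Ioc 0 N with p.Prime, f (p ^ k) := by
    intro k hk
    refine sum_le_sum_of_subset_of_nonneg (filter_subset_filter _ (Ioc_subset_Ioc_right ?_))
      fun n _ _ => hf _
    rcases Nat.eq_zero_or_pos N with rfl | hN
    · have : (1 : ℝ) / k ≠ 0 := by
        have := (mem_Icc.1 hk).1
        positivity
      rw [Nat.cast_zero, zero_rpow this, Nat.floor_zero]
    · have : (N : ℝ) ^ ((1 : ℝ) / k) ≤ N := by
        have hN' : (1 : ℝ) ≤ N := by exact_mod_cast hN
        have hk' : (1 : ℝ) ≤ k := by exact_mod_cast (mem_Icc.1 hk).1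
        exact rpow_le_self_of_one_le hN' (by rw [div_le_one (by linarith)]; exact hk')
      exact (Nat.floor_le_floor this).trans_eq (Nat.floor_natCast N)
  refine (sum_le_sum h3).trans ?_
  rw [sum_comm]
  refine sum_le_sum fun p hp => ?_
  have hp := (mem_filter.1 hp).2
  have hp1 : (1 : ℝ) < p := by exact_mod_cast hp.one_lt
  have hs := hasSum_pow_div_log_of_abs_lt_one (x := 1 / (p : ℝ)) (by
    rw [abs_of_pos (by positivity), div_lt_one (by linarith)]; exact hp1)
  have h4 : ∑ k ∈ Icc 1 M, f (p ^ k) =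
      ∑ k ∈ range M, (1 / (p : ℝ)) ^ (k + 1) / (k + 1) := by
    have e := Finset.sum_Ico_add' (fun k => f (p ^ k)) 0 M 1
    rw [Nat.Ico_zero_eq_range, zero_add] at e
    rw [show Icc 1 M = Ico 1 (M + 1) by ext; simp, ← e]
    refine sum_congr rfl fun k _ => ?_
    have hl : 0 < log (p : ℝ) := log_pos hp1
    simp only [f]
    rw [ArithmeticFunction.vonMangoldt_apply_pow (by omega),
      ArithmeticFunction.vonMangoldt_apply_prime hp]
    push_cast
    rw [log_pow, one_div_pow]
    push_cast
    field_simp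
  rw [h4]
  exact sum_le_hasSum _ (fun k _ => by positivity) hs

lemma eventually_prod_one_sub_inv_le {θ : ℝ} (hθ : 1 < θ) :
    ∀ᶠ N : ℕ in Filter.atTop, ∏ p ∈ Ioc 0 N with p.Prime, (1 - 1 / (p : ℝ)) ≤
      θ * exp (-eulerMascheroniConstant) / log N := by
  have hlogN : Filter.Tendsto (fun N : ℕ => log (N : ℝ)) Filter.atTop Filter.atTop :=
    tendsto_log_atTop.comp tendsto_natCast_atTop_atTop
  filter_upwards [hlogN.eventually_ge_atTop (16 / log θ), hlogN.eventually_gt_atTop 0,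
    Filter.eventually_ge_atTop 2] with N h1 h2 h3
  have hlθ : 0 < log θ := log_pos hθ
  have h4 := eulerMascheroni_le_mangoldtLogSum h3
  have h5 := mangoldtLogSum_le_sum_primes N
  have h6 : 16 / log (N : ℝ) ≤ log θ := by
    rw [div_le_iff₀ h2]
    rw [div_le_iff₀ hlθ] at h1
    linarith
  have hpos : ∀ p ∈ {p ∈ Ioc 0 N | p.Prime}, 0 < 1 - 1 / (p : ℝ) := by
    intro p hp
    have : (1 : ℝ) < p := by exact_mod_cast (mem_filter.1 hp).2.one_lt
    rw [sub_pos, div_lt_one (by linarith)]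
    exact this
  have h7 : log (∏ p ∈ Ioc 0 N with p.Prime, (1 - 1 / (p : ℝ))) ≤
      log θ - eulerMascheroniConstant - log (log N) := by
    rw [log_prod (fun p hp => (hpos p hp).ne')]
    rw [sum_neg_distrib] at h5
    linarith
  rw [← exp_log (prod_pos hpos)]
  refine (exp_le_exp.2 h7).trans_eq ?_
  rw [exp_sub, exp_log h2, sub_eq_add_neg, exp_add, exp_log (by linarith)]

end

section Periodic

lemma injOn_natCast_Ico {m a b : ℕ} (h : b ≤ a + m) :
    Set.InjOn (fun n : ℕ => (n : ZMod m)) (Ico a b : Finset ℕ) := by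
  intro x hx y hy hxy
  rw [coe_Ico, Set.mem_Ico] at hx hy
  have := (ZMod.natCast_eq_natCast_iff x y m).1 hxy
  rcases le_total x y with hle | hle
  · have h2 := (Nat.modEq_iff_dvd' hle).1 this
    by_contra hne
    have := Nat.le_of_dvd (by omega) h2
    omega
  · have h2 := (Nat.modEq_iff_dvd' hle).1 this.symm
    by_contra hne
    have := Nat.le_of_dvd (by omega) h2
    omega

variable {m : ℕ} [NeZero m]

lemma sum_Ico_period (g : ZMod m → ℝ) (a : ℕ) :
    ∑ n ∈ Ico a (a + m), g (n : ZMod m) = ∑ x, g x := by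
  have hinj := injOn_natCast_Ico (m := m) (le_refl (a + m))
  have : image (fun n : ℕ => (n : ZMod m)) (Ico a (a + m)) = univ := by
    apply eq_univ_of_card
    rw [card_image_of_injOn hinj, Nat.card_Ico, ZMod.card]
    omega
  rw [← this, sum_image hinj]

lemma sum_Ico_short_le {g : ZMod m → ℝ} (hg : ∀ x, 0 ≤ g x) {a b : ℕ} (h : b ≤ a + m) :
    ∑ n ∈ Ico a b, g (n : ZMod m) ≤ ∑ x, g x := by
  rw [← sum_image (f := g) (injOn_natCast_Ico h)]
  exact sum_le_univ_sum_of_nonneg hg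

lemma sum_Ico_le_of_nonneg {g : ZMod m → ℝ} (hg : ∀ x, 0 ≤ g x) (a l : ℕ) :
    ∑ n ∈ Ico a (a + l), g (n : ZMod m) ≤ ((l : ℝ) / m + 1) * ∑ x, g x := by
  have hm : 0 < m := Nat.pos_of_ne_zero (NeZero.ne m)
  have hm' : (0 : ℝ) < m := by exact_mod_cast hm
  have hS : 0 ≤ ∑ x, g x := sum_nonneg fun x _ => hg x
  induction l using Nat.strong_induction_on generalizing a with
  | _ l ih =>
    rcases le_or_gt l m with h | h
    · refine (sum_Ico_short_le hg (by omega)).trans ?_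
      have : (0 : ℝ) ≤ (l : ℝ) / m := by positivity
      nlinarith
    · have h1 := ih (l - m) (by omega) (a + m)
      rw [show a + m + (l - m) = a + l by omega] at h1
      rw [← sum_Ico_consecutive _ (show a ≤ a + m by omega) (show a + m ≤ a + l by omega),
        sum_Ico_period]
      rw [Nat.cast_sub h.le, sub_div, div_self hm'.ne'] at h1
      linarith

lemma abs_sum_Ico_le {g : ZMod m → ℝ} (h0 : ∑ x, g x = 0) (a l : ℕ) :
    |∑ n ∈ Ico a (a + l), g (n : ZMod m)| ≤ ∑ x, |g x| := by
  have hm : 0 < m := Nat.pos_of_ne_zero (NeZero.ne m)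
  induction l using Nat.strong_induction_on generalizing a with
  | _ l ih =>
    rcases le_or_gt l m with h | h
    · exact (abs_sum_le_sum_abs _ _).trans
        (sum_Ico_short_le (g := fun x => |g x|) (fun x => abs_nonneg _) (by omega))
    · have h1 := ih (l - m) (by omega) (a + m)
      rw [show a + m + (l - m) = a + l by omega] at h1
      rwa [← sum_Ico_consecutive _ (show a ≤ a + m by omega) (show a + m ≤ a + l by omega),
        sum_Ico_period, h0, zero_add]

lemma abs_sum_Ioc_le {g : ZMod m → ℝ} (h0 : ∑ x, g x = 0) (a b : ℕ) :
    |∑ n ∈ Ioc a b, g (n : ZMod m)| ≤ ∑ x, |g x| := by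
  rcases le_total b a with h | h
  · rw [Ioc_eq_empty_of_le h, sum_empty, abs_zero]
    exact sum_nonneg fun _ _ => abs_nonneg _
  · have := abs_sum_Ico_le h0 (a + 1) (b - a)
    rwa [show a + 1 + (b - a) = b + 1 by omega,
      show Ico (a + 1) (b + 1) = Ioc a b by ext; simp] at this

end Periodic

open Classical in
/-- The probability density of the uniform measure on the units modulo `d`. -/
noncomputable def unitMean (d : ℕ) (x : ZMod d) : ℝ :=
  if IsUnit x then 1 / (Nat.totient d : ℝ) else 0

/-- The difference between the indicator of `x = 1` and its mean over the units modulo `d`. -/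
noncomputable def disc (d : ℕ) (x : ZMod d) : ℝ :=
  (if x = 1 then 1 else 0) - unitMean d x

lemma disc_of_not_isUnit {d : ℕ} {x : ZMod d} (h : ¬ IsUnit x) : disc d x = 0 := by
  have : x ≠ 1 := fun e => h (e ▸ isUnit_one)
  simp [disc, unitMean, h, this]

lemma sum_unitMean (d : ℕ) [NeZero d] : ∑ x : ZMod d, unitMean d x = 1 := by
  classical
  have hφ : (0 : ℝ) < Nat.totient d :=
    by exact_mod_cast Nat.totient_pos.2 (Nat.pos_of_ne_zero (NeZero.ne d))
  have hc : #{x : ZMod d | IsUnit x} = Nat.totient d := by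
    rw [← ZMod.card_units_eq_totient, ← card_univ,
      ← card_image_of_injective univ (Units.val_injective (α := ZMod d))]
    congr 1
    ext x
    rw [mem_filter, mem_image]
    simp [IsUnit]
  have hs : ∑ x : ZMod d, unitMean d x =
      ∑ x ∈ {x : ZMod d | IsUnit x}, 1 / (Nat.totient d : ℝ) := by
    rw [sum_filter]
    refine sum_congr rfl fun x _ => ?_
    unfold unitMean
    split_ifs <;> rfl
  rw [hs, sum_const, hc, nsmul_eq_mul]
  field_simp

lemma sum_disc (d : ℕ) [NeZero d] : ∑ x : ZMod d, disc d x = 0 := by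
  classical
  simp only [disc]
  rw [sum_sub_distrib, sum_unitMean, sum_ite_eq' univ (1 : ZMod d)]
  simp

lemma sum_abs_disc_le (d : ℕ) [NeZero d] : ∑ x : ZMod d, |disc d x| ≤ 2 := by
  classical
  have h : ∀ x : ZMod d, |disc d x| ≤ (if x = 1 then (1 : ℝ) else 0) +
      unitMean d x := by
    intro x
    refine (abs_sub _ _).trans (le_of_eq ?_)
    have h1 : (0 : ℝ) ≤ if x = 1 then 1 else 0 := by split_ifs <;> norm_num
    have h2 : (0 : ℝ) ≤ unitMean d x := by
      unfold unitMean; split_ifs <;> positivity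
    rw [abs_of_nonneg h1, abs_of_nonneg h2]
  refine (sum_le_sum fun x _ => h x).trans ?_
  rw [sum_add_distrib, sum_unitMean, sum_ite_eq' univ (1 : ZMod d)]
  simp; norm_num

lemma sum_unit_mul {d : ℕ} [NeZero d] {c : ZMod d} (hc : IsUnit c) (g : ZMod d → ℝ) :
    ∑ x, g (c * x) = ∑ x, g x := by
  obtain ⟨u, rfl⟩ := hc
  exact Equiv.sum_comp (Units.mulLeft u) g

lemma sum_disc_mul (d : ℕ) [NeZero d] (c : ZMod d) : ∑ x : ZMod d, disc d (c * x) = 0 := by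
  by_cases hc : IsUnit c
  · rw [sum_unit_mul hc, sum_disc]
  · exact sum_eq_zero fun x _ => disc_of_not_isUnit fun h => hc (isUnit_of_mul_isUnit_left h)

lemma sum_abs_disc_mul_le (d : ℕ) [NeZero d] (c : ZMod d) :
    ∑ x : ZMod d, |disc d (c * x)| ≤ 2 := by
  by_cases hc : IsUnit c
  · rw [sum_unit_mul hc (fun x => |disc d x|)]
    exact sum_abs_disc_le d
  · rw [sum_eq_zero fun x _ => by
      rw [disc_of_not_isUnit fun h => hc (isUnit_of_mul_isUnit_left h), abs_zero]]
    norm_num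

lemma abs_sum_disc_le {d : ℕ} (hd : d ≠ 0) (b a l : ℕ) :
    |∑ c ∈ Ioc a l, disc d ((b * c : ℕ) : ZMod d)| ≤ 2 := by
  have : NeZero d := ⟨hd⟩
  have := abs_sum_Ioc_le (sum_disc_mul d (b : ZMod d)) a l
  refine le_trans (le_of_eq ?_) (this.trans (sum_abs_disc_mul_le d b))
  simp

lemma sum_abs_disc_Ioc_le {d : ℕ} (hd : d ≠ 0) (k : ℕ) {M : ℕ} (hM : d ≤ M) (V : ℕ) :
    ∑ c ∈ Ioc V M, |disc d ((k * c : ℕ) : ZMod d)| ≤ 4 * M / Nat.totient d := by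
  have : NeZero d := ⟨hd⟩
  have h1 := sum_Ico_le_of_nonneg (g := fun x => |disc d ((k : ZMod d) * x)|)
    (fun x => abs_nonneg _) 1 M
  have hd' : (0 : ℝ) < d := by exact_mod_cast Nat.pos_of_ne_zero hd
  have hφ : (0 : ℝ) < Nat.totient d :=
    by exact_mod_cast Nat.totient_pos.2 (Nat.pos_of_ne_zero hd)
  have h2 : ∑ c ∈ Ioc V M, |disc d ((k * c : ℕ) : ZMod d)| ≤
      ∑ c ∈ Ico 1 (1 + M), |disc d ((k : ZMod d) * c)| := by
    simp only [Nat.cast_mul]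
    refine sum_le_sum_of_subset_of_nonneg (fun x hx => ?_) fun _ _ _ => abs_nonneg _
    rw [mem_Ioc] at hx
    rw [mem_Ico]
    omega
  have h3 : ((M : ℝ) / d + 1) ≤ 2 * (M / Nat.totient d) := by
    have e1 : (1 : ℝ) ≤ M / d := by
      rw [le_div_iff₀ hd', one_mul]; exact_mod_cast hM
    have e2 : (M : ℝ) / d ≤ M / Nat.totient d := by
      gcongr; exact Nat.totient_le d
    linarith
  calc _ ≤ _ := h2.trans h1
    _ ≤ ((M : ℝ) / d + 1) * 2 :=
        mul_le_mul_of_nonneg_left (sum_abs_disc_mul_le d k) (by positivity)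
    _ ≤ 2 * (M / Nat.totient d) * 2 := mul_le_mul_of_nonneg_right h3 (by norm_num)
    _ = _ := by ring

lemma abs_sum_disc_mul_disc_le {d e : ℕ} (hd : d ≠ 0) (he : e ≠ 0) (h : d.Coprime e)
    (b c u v : ℕ) :
    |∑ k ∈ Ioc u v, disc d ((k * b : ℕ) : ZMod d) * disc e ((k * c : ℕ) : ZMod e)| ≤ 4 := by
  have : NeZero d := ⟨hd⟩
  have : NeZero e := ⟨he⟩
  have : NeZero (d * e) := ⟨mul_ne_zero hd he⟩
  let E := ZMod.chineseRemainder h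
  have hE : ∀ (φ : ZMod d → ℝ) (ψ : ZMod e → ℝ),
      ∑ x : ZMod (d * e), φ (E x).1 * ψ (E x).2 = (∑ x, φ x) * ∑ y, ψ y := by
    intro φ ψ
    rw [sum_mul_sum, ← sum_product']
    exact Equiv.sum_comp E.toEquiv (fun z : ZMod d × ZMod e => φ z.1 * ψ z.2)
  have h0 := hE (fun x => disc d (b * x)) (fun y => disc e (c * y))
  rw [sum_disc_mul, zero_mul] at h0
  have h1 := abs_sum_Ioc_le h0 u v
  have h2 : ∑ x : ZMod (d * e), |disc d (b * (E x).1) * disc e (c * (E x).2)| ≤ 4 := by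
    simp only [abs_mul]
    rw [hE (fun x => |disc d (b * x)|) (fun y => |disc e (c * y)|)]
    have a1 := sum_abs_disc_mul_le d (b : ZMod d)
    have a2 := sum_abs_disc_mul_le e (c : ZMod e)
    have a3 : 0 ≤ ∑ x : ZMod d, |disc d (b * x)| := sum_nonneg fun _ _ => abs_nonneg _
    nlinarith
  refine le_trans (le_of_eq ?_) (h1.trans h2)
  congr 1
  refine sum_congr rfl fun k _ => ?_
  have e1 : E (k : ZMod (d * e)) = (k : ZMod d × ZMod e) := map_natCast E k
  simp [e1, mul_comm]

section

open ArithmeticFunction (vonMangoldt)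

lemma sum_Ioc_divisorsAntidiagonal (F : ℕ → ℕ → ℝ) (N : ℕ) :
    ∑ n ∈ Ioc 0 N, ∑ x ∈ n.divisorsAntidiagonal, F x.1 x.2 =
      ∑ a ∈ Ioc 0 N, ∑ b ∈ Ioc 0 (N / a), F a b := by
  have h1 : ∑ n ∈ Ioc 0 N, ∑ x ∈ n.divisorsAntidiagonal, F x.1 x.2 =
      ∑ x ∈ Ioc 0 N ×ˢ Ioc 0 N with x.1 * x.2 ≤ N, F x.1 x.2 := by
    trans ∑ n ∈ Ioc 0 N, ∑ x ∈ Ioc 0 N ×ˢ Ioc 0 N with x.1 * x.2 = n, F x.1 x.2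
    · refine sum_congr rfl fun n hn ↦ ?_
      simp only [mem_Ioc] at hn
      rw [Nat.divisorsAntidiagonal_eq_prod_filter_of_le hn.1.ne' hn.2]
    · simp_rw [sum_filter]
      rw [sum_comm]
      exact sum_congr rfl fun _ _ ↦ (by simp_all)
  rw [h1, sum_filter, sum_product]
  refine sum_congr rfl fun a ha => ?_
  rw [← sum_filter]
  refine sum_congr ?_ fun _ _ => rfl
  have ha' := (mem_Ioc.1 ha).1
  ext b
  rw [mem_filter, mem_Ioc, mem_Ioc, Nat.le_div_iff_mul_le ha', mul_comm b a]
  constructor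
  · exact fun h => ⟨h.1.1, h.2⟩
  · exact fun h => ⟨⟨h.1, (Nat.le_mul_of_pos_left b ha').trans h.2⟩, h.2⟩

lemma sum_inv_le_one_add_log (N : ℕ) :
    ∑ k ∈ Ioc 0 N, 1 / (k : ℝ) ≤ 1 + log N := by
  have := harmonic_le_one_add_log N
  rw [harmonic_eq_sum_Icc] at this
  push_cast at this
  rw [show Ioc 0 N = Icc 1 N from rfl]
  simpa [one_div] using this

lemma sum_card_divisors_div_le {N : ℕ} (g : ℕ → ℝ) (hg0 : ∀ k, 0 ≤ g k)
    (hg : ∀ a b, g (a * b) ≤ g a * g b) :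
    ∑ k ∈ Ioc 0 N, (#k.divisors : ℝ) * (g k / k) ≤ (∑ k ∈ Ioc 0 N, g k / k) ^ 2 := by
  have h1 : ∑ k ∈ Ioc 0 N, (#k.divisors : ℝ) * (g k / k) =
      ∑ k ∈ Ioc 0 N, ∑ x ∈ k.divisorsAntidiagonal, g (x.1 * x.2) / ((x.1 * x.2 : ℕ) : ℝ) := by
    refine sum_congr rfl fun k hk => ?_
    rw [sum_congr rfl (g := fun _ => g k / k)]
    · rw [sum_const, nsmul_eq_mul, ← Nat.map_div_right_divisors, card_map]
    · intro x hx
      rw [(Nat.mem_divisorsAntidiagonal.1 hx).1]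
  rw [h1, sum_Ioc_divisorsAntidiagonal (fun a b => g (a * b) / ((a * b : ℕ) : ℝ)), sq, sum_mul_sum]
  refine (sum_le_sum fun a _ => sum_le_sum_of_subset_of_nonneg
    (Ioc_subset_Ioc_right (Nat.div_le_self N a)) fun b _ _ =>
      div_nonneg (hg0 _) (Nat.cast_nonneg _)).trans ?_
  refine sum_le_sum fun a _ => sum_le_sum fun b _ => ?_
  rw [div_mul_div_comm, Nat.cast_mul]
  exact div_le_div_of_nonneg_right (hg a b) (by positivity)

lemma sum_card_divisors_sq_div_le (N : ℕ) :
    ∑ k ∈ Ioc 0 N, (#k.divisors : ℝ) ^ 2 / k ≤ (1 + log N) ^ 4 := by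
  have h1 := sum_card_divisors_div_le (N := N) (fun k => (#k.divisors : ℝ))
    (fun k => Nat.cast_nonneg _) (fun a b => by
      rw [Nat.divisors_mul]; exact_mod_cast card_mul_le)
  have h2 := sum_card_divisors_div_le (N := N) (fun _ => (1 : ℝ)) (fun k => zero_le_one)
    (fun a b => by norm_num)
  have h3 := sum_inv_le_one_add_log N
  have h4 : 0 ≤ ∑ k ∈ Ioc 0 N, 1 / (k : ℝ) := sum_nonneg fun _ _ => by positivity
  have e : ∀ k : ℕ, (#k.divisors : ℝ) * (1 / (k : ℝ)) = (#k.divisors : ℝ) / k := fun k => by ring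
  simp only [e] at h2
  have h5 : 0 ≤ ∑ k ∈ Ioc 0 N, (#k.divisors : ℝ) / (k : ℝ) := sum_nonneg fun _ _ => by positivity
  calc _ = ∑ k ∈ Ioc 0 N, (#k.divisors : ℝ) * ((#k.divisors : ℝ) / k) :=
        sum_congr rfl fun k _ => by ring
    _ ≤ _ := h1
    _ ≤ ((1 + log N) ^ 2) ^ 2 := by
        refine pow_le_pow_left₀ h5 (h2.trans (pow_le_pow_left₀ h4 h3 2)) 2
    _ = _ := by ring

lemma abs_sum_natCast_mul_le {h : ℕ → ℝ} {B : ℝ}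
    (hB : ∀ u v, |∑ k ∈ Ioc u v, h k| ≤ B) (u v : ℕ) :
    |∑ k ∈ Ioc u v, (k : ℝ) * h k| ≤ B * v := by
  have h1 : ∑ k ∈ Ioc u v, (k : ℝ) * h k = ∑ j ∈ range v, ∑ k ∈ Ioc (max u j) v, h k := by
    have h2 : ∀ k ∈ Ioc u v, (k : ℝ) * h k = ∑ j ∈ range v, if j < k then h k else 0 := by
      intro k hk
      rw [← sum_filter, sum_const, nsmul_eq_mul]
      congr 2
      rw [show {j ∈ range v | j < k} = range k by
        ext j; simp only [mem_filter, mem_range, mem_Ioc] at *; omega, card_range]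
    rw [sum_congr rfl h2, sum_comm]
    refine sum_congr rfl fun j _ => ?_
    rw [← sum_filter]
    refine sum_congr ?_ fun _ _ => rfl
    ext k
    simp only [mem_filter, mem_Ioc]
    omega
  rw [h1]
  refine (abs_sum_le_sum_abs _ _).trans ((sum_le_sum fun j _ => hB _ _).trans ?_)
  rw [sum_const, card_range, nsmul_eq_mul, mul_comm]

variable {ι : Type*}

/-- The total discrepancy of `n` with respect to the moduli `d i`. -/
noncomputable def discSum (I : Finset ι) (d : ι → ℕ) (n : ℕ) : ℝ :=
  ∑ i ∈ I, disc (d i) (n : ZMod (d i))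

/-- The part of the type II sum attached to one modulus. -/
noncomputable def discTwist (V N d k : ℕ) : ℝ :=
  ∑ c ∈ Ioc V (N / k), vonMangoldt c * disc d ((k * c : ℕ) : ZMod d)

lemma abs_discTwist_le {V N d k : ℕ} (hN : 1 ≤ N) (hd : d ≠ 0) (hdV : d ≤ V) (hk : 0 < k) :
    |discTwist V N d k| ≤ (1 + log N) * (4 * N / Nat.totient d) / k := by
  have hL : 0 ≤ log (N : ℝ) := log_natCast_nonneg N
  rcases le_or_gt V (N / k) with h | h
  · have h1 : |discTwist V N d k| ≤
        ∑ c ∈ Ioc V (N / k), (1 + log N) * |disc d ((k * c : ℕ) : ZMod d)| := by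
      refine (abs_sum_le_sum_abs _ _).trans (sum_le_sum fun c hc => ?_)
      rw [abs_mul, abs_of_nonneg ArithmeticFunction.vonMangoldt_nonneg]
      refine mul_le_mul_of_nonneg_right ?_ (abs_nonneg _)
      have hc := mem_Ioc.1 hc
      have : log (c : ℝ) ≤ log N := log_le_log (by exact_mod_cast (by omega))
        (by exact_mod_cast hc.2.trans (Nat.div_le_self _ _))
      linarith [ArithmeticFunction.vonMangoldt_le_log (n := c)]
    refine h1.trans ?_
    rw [← mul_sum, mul_div_assoc]
    refine mul_le_mul_of_nonneg_left ?_ (by linarith)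
    refine (sum_abs_disc_Ioc_le hd k (hdV.trans h) V).trans ?_
    have : ((N / k : ℕ) : ℝ) ≤ (N : ℝ) / k := Nat.cast_div_le
    calc _ = 4 / (Nat.totient d : ℝ) * ((N / k : ℕ) : ℝ) := by ring
      _ ≤ 4 / (Nat.totient d : ℝ) * ((N : ℝ) / k) := by gcongr
      _ = _ := by ring
  · rw [discTwist, Ioc_eq_empty_of_le h.le, sum_empty, abs_zero]
    positivity

lemma abs_sum_discTwist_mul_le {V N d e : ℕ} (hN : 1 ≤ N) (hd : d ≠ 0) (hdV : d ≤ V)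
    (he : e ≠ 0) (heV : e ≤ V) (U : ℕ) :
    |∑ k ∈ Ioc U N, (k : ℝ) * (discTwist V N d k * discTwist V N e k)| ≤
      16 * N ^ 2 * (1 + log N) ^ 3 * (1 / (Nat.totient d * Nat.totient e)) := by
  have hL : 0 ≤ log (N : ℝ) := log_natCast_nonneg N
  have h1 : ∀ k ∈ Ioc U N, |(k : ℝ) * (discTwist V N d k * discTwist V N e k)| ≤
      16 * N ^ 2 * (1 + log N) ^ 2 * (1 / (Nat.totient d * Nat.totient e)) * (1 / k) := by
    intro k hk
    have hk0 : 0 < k := by have := (mem_Ioc.1 hk).1; omega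
    have hk' : (0 : ℝ) < k := by exact_mod_cast hk0
    rw [abs_mul, abs_mul, abs_of_pos hk']
    calc _ ≤ (k : ℝ) * (((1 + log N) * (4 * N / Nat.totient d) / k) *
          ((1 + log N) * (4 * N / Nat.totient e) / k)) := by
          gcongr
          · exact abs_discTwist_le hN hd hdV hk0
          · exact abs_discTwist_le hN he heV hk0
      _ = _ := by field_simp; ring
  refine (abs_sum_le_sum_abs _ _).trans ((sum_le_sum h1).trans ?_)
  rw [← mul_sum]
  have h2 : ∑ k ∈ Ioc U N, 1 / (k : ℝ) ≤ 1 + log N :=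
    (sum_le_sum_of_subset_of_nonneg (Ioc_subset_Ioc_left (Nat.zero_le U))
      fun _ _ _ => by positivity).trans (sum_inv_le_one_add_log N)
  calc _ ≤ 16 * N ^ 2 * (1 + log N) ^ 2 * (1 / (Nat.totient d * Nat.totient e)) *
        (1 + log (N : ℝ)) := mul_le_mul_of_nonneg_left h2 (by positivity)
    _ = _ := by ring

lemma abs_sum_discTwist_mul_le_of_coprime {V N d e U : ℕ} (hN : 1 ≤ N) (hd : d ≠ 0)
    (he : e ≠ 0) (h : d.Coprime e) (hU : 1 ≤ U) :
    |∑ k ∈ Ioc U N, (k : ℝ) * (discTwist V N d k * discTwist V N e k)| ≤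
      N ^ 2 * (1 + log N) ^ 3 * (4 / U) := by
  have hL : 0 ≤ log (N : ℝ) := log_natCast_nonneg N
  have hU' : (0 : ℝ) < U := by exact_mod_cast hU
  set S := Ioc V (N / U)
  let g : ℕ → ℕ → ℕ → ℝ := fun c c' k =>
    disc d ((k * c : ℕ) : ZMod d) * disc e ((k * c' : ℕ) : ZMod e)
  have hexp : ∀ (q : ℕ), ∀ k ∈ Ioc U N, discTwist V N q k =
      ∑ c ∈ S, if c ≤ N / k then vonMangoldt c * disc q ((k * c : ℕ) : ZMod q) else 0 := by
    intro q k hk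
    rw [discTwist, ← sum_filter]
    refine sum_congr ?_ fun _ _ => rfl
    ext c
    have : N / k ≤ N / U := Nat.div_le_div_left (mem_Ioc.1 hk).1.le hU
    simp only [S, mem_filter, mem_Ioc]
    omega
  have hsum : ∑ k ∈ Ioc U N, (k : ℝ) * (discTwist V N d k * discTwist V N e k) =
      ∑ c ∈ S, ∑ c' ∈ S, vonMangoldt c * vonMangoldt c' *
        ∑ k ∈ Ioc U (min (N / c) (N / c')), (k : ℝ) * g c c' k := by
    have h1 : ∀ k ∈ Ioc U N, (k : ℝ) * (discTwist V N d k * discTwist V N e k) =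
        ∑ c ∈ S, ∑ c' ∈ S, if c ≤ N / k ∧ c' ≤ N / k then
          vonMangoldt c * vonMangoldt c' * ((k : ℝ) * g c c' k) else 0 := by
      intro k hk
      rw [hexp d k hk, hexp e k hk, sum_mul_sum, mul_sum]
      refine sum_congr rfl fun c _ => ?_
      rw [mul_sum]
      refine sum_congr rfl fun c' _ => ?_
      by_cases h1 : c ≤ N / k <;> by_cases h2 : c' ≤ N / k <;> simp [h1, h2, g]
      ring
    rw [sum_congr rfl h1, sum_comm]
    refine sum_congr rfl fun c hc => ?_
    rw [sum_comm]
    refine sum_congr rfl fun c' hc' => ?_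
    rw [← sum_filter, mul_sum]
    refine sum_congr ?_ fun _ _ => rfl
    ext k
    have hc0 : 0 < c := by have := (mem_Ioc.1 hc).1; omega
    have hc0' : 0 < c' := by have := (mem_Ioc.1 hc').1; omega
    rw [mem_filter, mem_Ioc, mem_Ioc, le_min_iff, Nat.le_div_iff_mul_le hc0,
      Nat.le_div_iff_mul_le hc0']
    constructor
    · rintro ⟨⟨h1, h2⟩, h3, h4⟩
      rw [Nat.le_div_iff_mul_le (by omega), mul_comm] at h3 h4
      exact ⟨h1, h3, h4⟩
    · rintro ⟨h1, h3, h4⟩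
      refine ⟨⟨h1, (Nat.le_mul_of_pos_right k hc0).trans h3⟩, ?_⟩
      rw [Nat.le_div_iff_mul_le (by omega), Nat.le_div_iff_mul_le (by omega), mul_comm c,
        mul_comm c']
      exact ⟨h3, h4⟩
  rw [hsum]
  have hΛ : ∀ c ∈ S, vonMangoldt c ≤ 1 + log N := by
    intro c hc
    have hc := mem_Ioc.1 hc
    have : log (c : ℝ) ≤ log N := log_le_log (by exact_mod_cast (by omega))
      (by exact_mod_cast hc.2.trans (Nat.div_le_self _ _))
    linarith [ArithmeticFunction.vonMangoldt_le_log (n := c)]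
  have hterm : ∀ c ∈ S, ∀ c' ∈ S, |vonMangoldt c * vonMangoldt c' *
        ∑ k ∈ Ioc U (min (N / c) (N / c')), (k : ℝ) * g c c' k| ≤
      (1 + log N) ^ 2 * (4 * (N * (1 / (c : ℝ)))) := by
    intro c hc c' hc'
    have h2 : |∑ k ∈ Ioc U (min (N / c) (N / c')), (k : ℝ) * g c c' k| ≤
        4 * ((min (N / c) (N / c') : ℕ) : ℝ) :=
      abs_sum_natCast_mul_le (fun u v => abs_sum_disc_mul_disc_le hd he h c c' u v) _ _
    have h3 : ((min (N / c) (N / c') : ℕ) : ℝ) ≤ N * (1 / (c : ℝ)) := by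
      rw [mul_one_div]
      exact le_trans (by exact_mod_cast min_le_left _ _) (Nat.cast_div_le (m := N) (n := c))
    rw [abs_mul, abs_mul, abs_of_nonneg ArithmeticFunction.vonMangoldt_nonneg,
      abs_of_nonneg ArithmeticFunction.vonMangoldt_nonneg, sq]
    have := hΛ c hc
    have := hΛ c' hc'
    have := ArithmeticFunction.vonMangoldt_nonneg (n := c)
    have := ArithmeticFunction.vonMangoldt_nonneg (n := c')
    gcongr
    exact h2.trans (by linarith)
  refine (abs_sum_le_sum_abs _ _).trans ((sum_le_sum fun c hc =>
    (abs_sum_le_sum_abs _ _).trans (sum_le_sum fun c' hc' => hterm c hc c' hc')).trans ?_)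
  have hcard : (#S : ℝ) ≤ N / U := by
    rw [Nat.card_Ioc]
    refine le_trans ?_ (Nat.cast_div_le (m := N) (n := U))
    exact_mod_cast Nat.sub_le _ _
  have hinv : ∑ c ∈ S, 1 / (c : ℝ) ≤ 1 + log N :=
    (sum_le_sum_of_subset_of_nonneg (Ioc_subset_Ioc (Nat.zero_le V) (Nat.div_le_self N U))
      fun _ _ _ => by positivity).trans (sum_inv_le_one_add_log N)
  simp only [sum_const, nsmul_eq_mul]
  rw [← mul_sum, ← mul_sum, ← mul_sum, ← mul_sum]
  calc _ ≤ (N / U : ℝ) * ((1 + log N) ^ 2 * (4 * (N * (1 + log (N : ℝ))))) := by gcongr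
    _ = _ := by ring

end

section

open ArithmeticFunction (vonMangoldt)

/-- The restriction of an arithmetic function to arguments at most `U`. -/
noncomputable def truncate (U : ℕ) (f : ArithmeticFunction ℝ) : ArithmeticFunction ℝ :=
  ⟨fun n => if n ≤ U then f n else 0, by simp⟩

lemma truncate_apply (U : ℕ) (f : ArithmeticFunction ℝ) (n : ℕ) :
    truncate U f n = if n ≤ U then f n else 0 := rfl

lemma sub_apply_eq (f g : ArithmeticFunction ℝ) (n : ℕ) : (f - g) n = f n - g n := by
  rw [sub_eq_add_neg, sub_eq_add_neg]
  rfl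

lemma sub_truncate_apply (U : ℕ) (f : ArithmeticFunction ℝ) (n : ℕ) :
    (f - truncate U f) n = if n ≤ U then 0 else f n := by
  rw [sub_apply_eq, truncate_apply]
  split_ifs <;> simp

open ArithmeticFunction hiding log in
lemma vaughan_identity (U : ℕ) :
    vonMangoldt = truncate U vonMangoldt
      + truncate U ((moebius : ArithmeticFunction ℤ) : ArithmeticFunction ℝ) * ArithmeticFunction.log
      - truncate U ((moebius : ArithmeticFunction ℤ) : ArithmeticFunction ℝ)
          * truncate U vonMangoldt * ((zeta : ArithmeticFunction ℕ) : ArithmeticFunction ℝ)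
      + ((((moebius : ArithmeticFunction ℤ) : ArithmeticFunction ℝ)
          - truncate U ((moebius : ArithmeticFunction ℤ) : ArithmeticFunction ℝ))
          * ((zeta : ArithmeticFunction ℕ) : ArithmeticFunction ℝ))
          * (vonMangoldt - truncate U vonMangoldt) := by
  have h1 := coe_zeta_mul_coe_moebius (R := ℝ)
  have h2 := vonMangoldt_mul_zeta
  set m : ArithmeticFunction ℝ := ((moebius : ArithmeticFunction ℤ) : ArithmeticFunction ℝ)
  set z : ArithmeticFunction ℝ := ((zeta : ArithmeticFunction ℕ) : ArithmeticFunction ℝ)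
  set g := truncate U m
  set f := truncate U vonMangoldt
  linear_combination (f - vonMangoldt) * h1 + g * h2

lemma sum_mul_apply_mul (F G : ArithmeticFunction ℝ) (w : ℕ → ℝ) (N : ℕ) :
    ∑ n ∈ Ioc 0 N, (F * G) n * w n =
      ∑ a ∈ Ioc 0 N, F a * ∑ b ∈ Ioc 0 (N / a), G b * w (a * b) := by
  have h := sum_Ioc_divisorsAntidiagonal (fun a b => F a * (G b * w (a * b))) N
  simp only [mul_sum]
  rw [← h]
  refine sum_congr rfl fun n _ => ?_
  rw [ArithmeticFunction.mul_apply, sum_mul]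
  refine sum_congr rfl fun x hx => ?_
  rw [(Nat.mem_divisorsAntidiagonal.1 hx).1, mul_assoc]

lemma abs_sum_log_mul_le {h : ℕ → ℝ} {B : ℝ}
    (hB : ∀ u v, |∑ k ∈ Ioc u v, h k| ≤ B) (Z : ℕ) :
    |∑ k ∈ Ioc 0 Z, log k * h k| ≤ B * log Z := by
  have hB0 : 0 ≤ B := (abs_nonneg _).trans (hB 0 0)
  rcases Nat.eq_zero_or_pos Z with rfl | hZ
  · simp
  have h1 : ∑ k ∈ Ioc 0 Z, log k * h k =
      ∑ j ∈ Ico 1 Z, (log ((j + 1 : ℕ) : ℝ) - log (j : ℝ)) * ∑ k ∈ Ioc j Z, h k := by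
    have h2 : ∀ k ∈ Ioc 0 Z, log k * h k = ∑ j ∈ Ico 1 Z,
        if j < k then (log ((j + 1 : ℕ) : ℝ) - log (j : ℝ)) * h k else 0 := by
      intro k hk
      have hk := mem_Ioc.1 hk
      rw [← sum_filter, ← sum_mul, show {j ∈ Ico 1 Z | j < k} = Ico 1 k by
        ext j; simp only [mem_filter, mem_Ico]; omega,
        Finset.sum_Ico_sub (fun j : ℕ => log (j : ℝ)) (by omega)]
      simp
    rw [sum_congr rfl h2, sum_comm]
    refine sum_congr rfl fun j _ => ?_
    rw [← sum_filter, mul_sum]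
    refine sum_congr ?_ fun _ _ => rfl
    ext k
    simp only [mem_filter, mem_Ioc]
    omega
  rw [h1]
  calc _ ≤ ∑ j ∈ Ico 1 Z, (log ((j + 1 : ℕ) : ℝ) - log (j : ℝ)) * B := by
        refine (abs_sum_le_sum_abs _ _).trans (sum_le_sum fun j hj => ?_)
        have : log (j : ℝ) ≤ log ((j + 1 : ℕ) : ℝ) :=
          log_le_log (by exact_mod_cast (mem_Ico.1 hj).1) (by push_cast; linarith)
        rw [abs_mul, abs_of_nonneg (by linarith)]
        exact mul_le_mul_of_nonneg_left (hB _ _) (by linarith)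
    _ = _ := by
        rw [← sum_mul, Finset.sum_Ico_sub (fun j : ℕ => log (j : ℝ)) hZ]
        simp [mul_comm]

variable {ι : Type*} {I : Finset ι} {d : ι → ℕ}

lemma abs_sum_discSum_le (hd : ∀ i ∈ I, d i ≠ 0) (b u v : ℕ) :
    |∑ c ∈ Ioc u v, discSum I d (b * c)| ≤ 2 * #I := by
  simp only [discSum]
  rw [sum_comm]
  refine (abs_sum_le_sum_abs _ _).trans ((sum_le_sum fun i hi =>
    abs_sum_disc_le (hd i hi) b u v).trans ?_)
  rw [sum_const, nsmul_eq_mul, mul_comm]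

lemma abs_discSum_le (hd : ∀ i ∈ I, d i ≠ 0) (n : ℕ) : |discSum I d n| ≤ 2 * #I := by
  rcases Nat.eq_zero_or_pos n with rfl | hn
  · have h := abs_sum_discSum_le hd 0 0 1
    simpa using h
  · have h := abs_sum_discSum_le hd 1 (n - 1) n
    have : Ioc (n - 1) n = {n} := by ext k; simp only [mem_Ioc, mem_singleton]; omega
    simpa [this] using h

/-- The contribution of pairs of moduli with a common factor. -/
noncomputable def commonFactorSum (I : Finset ι) (d : ι → ℕ) : ℝ :=
  ∑ i ∈ I, ∑ j ∈ I, if (d i).Coprime (d j) then 0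
    else 1 / ((Nat.totient (d i) : ℝ) * Nat.totient (d j))

lemma sum_sq_discTwist_le {U N : ℕ} (hN : 1 ≤ N) (hU : 1 ≤ U)
    (hd : ∀ i ∈ I, d i ≠ 0 ∧ d i ≤ U) :
    ∑ k ∈ Ioc U N, (k : ℝ) * (∑ i ∈ I, discTwist U N (d i) k) ^ 2 ≤
      N ^ 2 * (1 + log N) ^ 3 * (4 * #I ^ 2 / U + 16 * commonFactorSum I d) := by
  have hL : 0 ≤ log (N : ℝ) := log_natCast_nonneg N
  have h1 : ∑ k ∈ Ioc U N, (k : ℝ) * (∑ i ∈ I, discTwist U N (d i) k) ^ 2 =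
      ∑ i ∈ I, ∑ j ∈ I, ∑ k ∈ Ioc U N,
        (k : ℝ) * (discTwist U N (d i) k * discTwist U N (d j) k) := by
    have h0 : ∀ k : ℕ, (k : ℝ) * (∑ i ∈ I, discTwist U N (d i) k) ^ 2 = ∑ i ∈ I, ∑ j ∈ I,
        (k : ℝ) * (discTwist U N (d i) k * discTwist U N (d j) k) := fun k => by
      rw [sq, sum_mul_sum, mul_sum]
      simp only [mul_sum]
    simp only [h0]
    rw [sum_comm]
    exact sum_congr rfl fun i _ => sum_comm
  have h2 : ∀ i ∈ I, ∀ j ∈ I, ∑ k ∈ Ioc U N,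
        (k : ℝ) * (discTwist U N (d i) k * discTwist U N (d j) k) ≤
      N ^ 2 * (1 + log N) ^ 3 * (4 / U) + 16 * N ^ 2 * (1 + log N) ^ 3 *
        (if (d i).Coprime (d j) then 0
          else 1 / ((Nat.totient (d i) : ℝ) * Nat.totient (d j))) := by
    intro i hi j hj
    refine (le_abs_self _).trans ?_
    split_ifs with h
    · rw [mul_zero, add_zero]
      exact abs_sum_discTwist_mul_le_of_coprime hN (hd i hi).1 (hd j hj).1 h hU
    · refine (abs_sum_discTwist_mul_le hN (hd i hi).1 (hd i hi).2 (hd j hj).1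
        (hd j hj).2 U).trans (le_add_of_nonneg_left (by positivity))
  rw [h1]
  refine (sum_le_sum fun i hi => sum_le_sum fun j hj => h2 i hi j hj).trans (le_of_eq ?_)
  simp only [sum_add_distrib, sum_const, nsmul_eq_mul, ← mul_sum]
  rw [commonFactorSum]
  ring

lemma sq_sum_mul_discTwist_le {U N : ℕ} (hN : 1 ≤ N) (hU : 1 ≤ U)
    (hd : ∀ i ∈ I, d i ≠ 0 ∧ d i ≤ U) {a : ℕ → ℝ} (ha : ∀ k, |a k| ≤ #k.divisors) :
    (∑ k ∈ Ioc U N, a k * ∑ i ∈ I, discTwist U N (d i) k) ^ 2 ≤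
      N ^ 2 * (1 + log N) ^ 7 * (4 * #I ^ 2 / U + 16 * commonFactorSum I d) := by
  have hL : 0 ≤ log (N : ℝ) := log_natCast_nonneg N
  have h1 := sum_sq_le_sum_mul_sum_of_sq_le_mul (Ioc U N)
    (r := fun k => a k * ∑ i ∈ I, discTwist U N (d i) k)
    (f := fun k => a k ^ 2 / k) (g := fun k => (k : ℝ) * (∑ i ∈ I, discTwist U N (d i) k) ^ 2)
    (fun k _ => by positivity) (fun k _ => by positivity) (fun k hk => by
      have : (k : ℝ) ≠ 0 := by have := (mem_Ioc.1 hk).1; exact_mod_cast (by omega)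
      exact le_of_eq (by field_simp))
  have h2 : ∑ k ∈ Ioc U N, a k ^ 2 / k ≤ (1 + log N) ^ 4 := by
    refine le_trans ?_ (sum_card_divisors_sq_div_le _)
    refine (sum_le_sum_of_subset_of_nonneg (Ioc_subset_Ioc_left (Nat.zero_le U))
      fun _ _ _ => by positivity).trans (sum_le_sum fun k _ => ?_)
    refine div_le_div_of_nonneg_right ?_ (Nat.cast_nonneg _)
    exact sq_le_sq' (neg_le_of_abs_le (ha k)) (le_of_abs_le (ha k))
  refine h1.trans ((mul_le_mul h2 (sum_sq_discTwist_le hN hU hd)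
    (sum_nonneg fun _ _ => by positivity) (by positivity)).trans (le_of_eq ?_))
  ring

open ArithmeticFunction hiding log in
lemma abs_moebius_sub_truncate_mul_zeta_le (U k : ℕ) :
    |((((moebius : ArithmeticFunction ℤ) : ArithmeticFunction ℝ)
          - truncate U ((moebius : ArithmeticFunction ℤ) : ArithmeticFunction ℝ))
          * ((zeta : ArithmeticFunction ℕ) : ArithmeticFunction ℝ)) k| ≤
      if k ≤ U then 0 else (#k.divisors : ℝ) := by
  rw [coe_mul_zeta_apply]
  split_ifs with h
  · rw [sum_eq_zero, abs_zero]
    intro m hm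
    have : m ≤ U := (Nat.divisor_le hm).trans h
    rw [sub_truncate_apply, if_pos this]
  · refine (abs_sum_le_sum_abs _ _).trans ?_
    rw [card_eq_sum_ones, Nat.cast_sum]
    refine sum_le_sum fun m _ => ?_
    rw [sub_truncate_apply]
    split_ifs
    · simp
    · rw [intCoe_apply, Nat.cast_one]
      exact_mod_cast abs_moebius_le_one

open ArithmeticFunction hiding log in
lemma abs_truncate_moebius_mul_truncate_vonMangoldt_le (U k : ℕ) :
    |(truncate U ((moebius : ArithmeticFunction ℤ) : ArithmeticFunction ℝ)
      * truncate U vonMangoldt) k| ≤ if k ≤ U ^ 2 then log k else 0 := by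
  have key : ∀ x : ℕ × ℕ,
      |truncate U ((moebius : ArithmeticFunction ℤ) : ArithmeticFunction ℝ) x.1 *
        truncate U vonMangoldt x.2| ≤ vonMangoldt x.2 := by
    intro x
    have h0 := vonMangoldt_nonneg (n := x.2)
    rw [truncate_apply, truncate_apply, abs_mul]
    have h1 : |((moebius x.1 : ℤ) : ℝ)| ≤ 1 := by exact_mod_cast abs_moebius_le_one
    split_ifs <;> simp [abs_of_nonneg h0, h0]
    exact mul_le_of_le_one_left h0 h1
  rw [ArithmeticFunction.mul_apply]
  split_ifs with h
  · refine (abs_sum_le_sum_abs _ _).trans ((sum_le_sum fun x _ => key x).trans ?_)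
    rw [Nat.sum_divisorsAntidiagonal' (fun _ b => vonMangoldt b), vonMangoldt_sum]
  · rw [sum_eq_zero, abs_zero]
    intro x hx
    have hx := (Nat.mem_divisorsAntidiagonal.1 hx).1
    rw [truncate_apply, truncate_apply]
    by_cases h1 : x.1 ≤ U <;> by_cases h2 : x.2 ≤ U <;> simp [h1, h2]
    exact absurd (hx ▸ sq U ▸ Nat.mul_le_mul h1 h2) h

open ArithmeticFunction hiding log in
/-- A large sieve type estimate: the von Mangoldt function is equidistributed on average with
respect to a family of moduli most pairs of which are coprime. -/
theorem abs_sum_vonMangoldt_mul_discSum_le {U N : ℕ} (hU : 1 ≤ U) (hUN : U ≤ N)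
    (hd : ∀ i ∈ I, d i ≠ 0 ∧ d i ≤ U) :
    |∑ n ∈ Ioc 0 N, vonMangoldt n * discSum I d n| ≤
      N * (1 + log N) ^ 4 * √(4 * #I ^ 2 / U + 16 * commonFactorSum I d)
        + 6 * #I * U ^ 2 * (1 + log N) := by
  have hN : 1 ≤ N := hU.trans hUN
  have hL : 0 ≤ log (N : ℝ) := log_natCast_nonneg N
  have hd0 : ∀ i ∈ I, d i ≠ 0 := fun i hi => (hd i hi).1
  set w := discSum I d with hw
  set m : ArithmeticFunction ℝ := ((moebius : ArithmeticFunction ℤ) : ArithmeticFunction ℝ)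
  set z : ArithmeticFunction ℝ := ((zeta : ArithmeticFunction ℕ) : ArithmeticFunction ℝ) with hz
  have hlog : ∀ k ∈ Ioc 0 N, log (k : ℝ) ≤ 1 + log N := fun k hk => by
    have hk := mem_Ioc.1 hk
    have : log (k : ℝ) ≤ log N := log_le_log (by exact_mod_cast hk.1) (by exact_mod_cast hk.2)
    linarith
  have hdecomp : ∑ n ∈ Ioc 0 N, vonMangoldt n * w n =
      ∑ n ∈ Ioc 0 N, truncate U vonMangoldt n * w n
      + ∑ n ∈ Ioc 0 N, (truncate U m * ArithmeticFunction.log) n * w n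
      - ∑ n ∈ Ioc 0 N, (truncate U m * truncate U vonMangoldt * z) n * w n
      + ∑ n ∈ Ioc 0 N, ((m - truncate U m) * z * (vonMangoldt - truncate U vonMangoldt)) n
          * w n := by
    rw [← sum_add_distrib, ← sum_sub_distrib, ← sum_add_distrib]
    refine sum_congr rfl fun n _ => ?_
    conv_lhs => rw [vaughan_identity U]
    rw [ArithmeticFunction.add_apply, sub_apply_eq, ArithmeticFunction.add_apply]
    ring
  have hcardU : ∀ M : ℕ, (#{k ∈ Ioc 0 N | k ≤ M} : ℝ) ≤ M := fun M => by
    have : {k ∈ Ioc 0 N | k ≤ M} ⊆ Ioc 0 M := fun k hk => by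
      simp only [mem_filter, mem_Ioc] at *; omega
    have h := card_le_card this
    rw [Nat.card_Ioc] at h
    exact_mod_cast h
  have b1 : |∑ n ∈ Ioc 0 N, truncate U vonMangoldt n * w n| ≤ U * ((1 + log N) * (2 * #I)) := by
    refine (abs_sum_le_sum_abs _ _).trans ?_
    calc _ ≤ ∑ n ∈ Ioc 0 N, if n ≤ U then (1 + log (N : ℝ)) * (2 * #I) else 0 := by
          refine sum_le_sum fun n hn => ?_
          rw [truncate_apply, abs_mul]
          split_ifs
          · rw [abs_of_nonneg vonMangoldt_nonneg]
            exact mul_le_mul (vonMangoldt_le_log.trans (hlog n hn)) (abs_discSum_le hd0 n)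
              (abs_nonneg _) (by positivity)
          · simp
      _ ≤ _ := by
          rw [← sum_filter, sum_const, nsmul_eq_mul]
          exact mul_le_mul_of_nonneg_right (hcardU U) (by positivity)
  have b2 : |∑ n ∈ Ioc 0 N, (truncate U m * ArithmeticFunction.log) n * w n| ≤
      U * ((1 + log N) * (2 * #I)) := by
    rw [sum_mul_apply_mul]
    refine (abs_sum_le_sum_abs _ _).trans ?_
    calc _ ≤ ∑ n ∈ Ioc 0 N, if n ≤ U then (1 + log (N : ℝ)) * (2 * #I) else 0 := by
          refine sum_le_sum fun n hn => ?_
          rw [truncate_apply, abs_mul]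
          split_ifs
          · have h1 : |m n| ≤ 1 := by
              simp only [m, intCoe_apply]; exact_mod_cast abs_moebius_le_one
            have h2 := abs_sum_log_mul_le (h := fun b => w (n * b)) (B := 2 * #I)
              (fun u v => abs_sum_discSum_le hd0 n u v) (N / n)
            have h3 : log ((N / n : ℕ) : ℝ) ≤ 1 + log N := by
              rcases Nat.eq_zero_or_pos (N / n) with h | h
              · rw [h]; simp; linarith
              · exact hlog _ (mem_Ioc.2 ⟨h, Nat.div_le_self _ _⟩)
            simp only [log_apply]
            refine (mul_le_of_le_one_left (abs_nonneg _) h1).trans (h2.trans ?_)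
            rw [mul_comm]
            exact mul_le_mul_of_nonneg_right h3 (by positivity)
          · simp
      _ ≤ _ := by
          rw [← sum_filter, sum_const, nsmul_eq_mul]
          exact mul_le_mul_of_nonneg_right (hcardU U) (by positivity)
  have b3 : |∑ n ∈ Ioc 0 N, (truncate U m * truncate U vonMangoldt * z) n * w n| ≤
      (U ^ 2 : ℕ) * ((1 + log N) * (2 * #I)) := by
    rw [sum_mul_apply_mul]
    refine (abs_sum_le_sum_abs _ _).trans ?_
    calc _ ≤ ∑ n ∈ Ioc 0 N, if n ≤ U ^ 2 then (1 + log (N : ℝ)) * (2 * #I) else 0 := by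
          refine sum_le_sum fun n hn => ?_
          have h1 := abs_truncate_moebius_mul_truncate_vonMangoldt_le U n
          have h2 : |∑ b ∈ Ioc 0 (N / n), z b * w (n * b)| ≤ 2 * #I := by
            have := abs_sum_discSum_le hd0 n 0 (N / n)
            rwa [sum_congr rfl (g := fun b => w (n * b))]
            intro b hb
            have : b ≠ 0 := by have := (mem_Ioc.1 hb).1; omega
            rw [hz, natCoe_apply, zeta_apply, if_neg this, Nat.cast_one, one_mul]
          rw [abs_mul]
          split_ifs with h
          · rw [if_pos h] at h1
            exact mul_le_mul (h1.trans (hlog n hn)) h2 (abs_nonneg _) (by positivity)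
          · rw [if_neg h] at h1
            exact (mul_le_mul_of_nonneg_right h1 (abs_nonneg _)).trans (by simp)
      _ ≤ _ := by
          rw [← sum_filter, sum_const, nsmul_eq_mul]
          exact mul_le_mul_of_nonneg_right (hcardU _) (by positivity)
  have b4 : |∑ n ∈ Ioc 0 N, ((m - truncate U m) * z * (vonMangoldt - truncate U vonMangoldt)) n
      * w n| ≤ N * (1 + log N) ^ 4 * √(4 * #I ^ 2 / U + 16 * commonFactorSum I d) := by
    set a := (m - truncate U m) * z
    have ha := abs_moebius_sub_truncate_mul_zeta_le U
    have ha' : ∀ k, |a k| ≤ #k.divisors := fun k => (ha k).trans (by split_ifs <;> simp)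
    have h1 : ∑ n ∈ Ioc 0 N, (a * (vonMangoldt - truncate U vonMangoldt)) n * w n =
        ∑ k ∈ Ioc U N, a k * ∑ i ∈ I, discTwist U N (d i) k := by
      rw [sum_mul_apply_mul]
      symm
      refine sum_subset_zero_on_sdiff (Ioc_subset_Ioc_left (Nat.zero_le U)) ?_ ?_
      · intro k hk
        have : k ≤ U := by
          simp only [mem_sdiff, mem_Ioc] at hk; omega
        have h := ha k
        rw [if_pos this] at h
        rw [abs_nonpos_iff.1 h, zero_mul]
      · intro k _
        congr 1
        simp only [discTwist]
        rw [sum_comm]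
        refine sum_subset_zero_on_sdiff (Ioc_subset_Ioc_left (Nat.zero_le U)) ?_ ?_
        · intro c hc
          have : c ≤ U := by
            simp only [mem_sdiff, mem_Ioc] at hc; omega
          rw [sub_truncate_apply, if_pos this, zero_mul]
        · intro c hc
          have : ¬ c ≤ U := by have := (mem_Ioc.1 hc).1; omega
          rw [sub_truncate_apply, if_neg this, hw, discSum, mul_sum]
    rw [h1]
    have h2 := sq_sum_mul_discTwist_le hN hU hd ha'
    have hη : 0 ≤ 4 * (#I : ℝ) ^ 2 / U + 16 * commonFactorSum I d := by
      have : 0 ≤ commonFactorSum I d := sum_nonneg fun i _ => sum_nonneg fun j _ => by positivity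
      positivity
    refine abs_le_of_sq_le_sq (h2.trans ?_) (by positivity)
    rw [mul_pow, mul_pow, sq_sqrt hη, ← pow_mul]
    gcongr
    · linarith
    · norm_num
  have hUU : (U : ℝ) ≤ (U : ℝ) ^ 2 := le_self_pow₀ (by exact_mod_cast hU) two_ne_zero
  rw [hdecomp]
  refine (abs_add_le _ _).trans ?_
  refine (add_le_add ((abs_sub _ _).trans (add_le_add ((abs_add_le _ _).trans
    (add_le_add b1 b2)) b3)) b4).trans ?_
  push_cast
  have : (U : ℝ) * ((1 + log N) * (2 * #I)) ≤ U ^ 2 * ((1 + log N) * (2 * #I)) := by gcongr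
  linarith

end

section

open ArithmeticFunction (vonMangoldt)

lemma norm_sum_smul_le_of_antitone {a : ℕ → ℂ} {B : ℝ}
    (hB : ∀ u v, ‖∑ k ∈ Ioc u v, a k‖ ≤ B) {g : ℕ → ℝ} {u : ℕ}
    (hg0 : ∀ k, u < k → 0 ≤ g k) (hg : ∀ k, u < k → g (k + 1) ≤ g k) (v : ℕ) :
    ‖∑ k ∈ Ioc u v, (g k : ℂ) * a k‖ ≤ B * g (u + 1) := by
  have hB0 : 0 ≤ B := (norm_nonneg _).trans (hB 0 0)
  rcases le_or_gt v u with huv | huv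
  · rw [Ioc_eq_empty_of_le huv, sum_empty, norm_zero]
    exact mul_nonneg hB0 (hg0 _ (Nat.lt_succ_self u))
  have key : ∑ k ∈ Ioc u v, (g k : ℂ) * a k = (g v : ℂ) * ∑ k ∈ Ioc u v, a k +
      ∑ j ∈ Ico (u + 1) v, ((g j - g (j + 1) : ℝ) : ℂ) * ∑ k ∈ Ioc u j, a k := by
    induction v, huv using Nat.le_induction with
    | base => simp
    | succ v hv ih =>
      have hv : u < v := hv
      rw [sum_Ioc_succ_top hv.le, ih, sum_Ico_succ_top (by omega), sum_Ioc_succ_top hv.le]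
      push_cast
      ring
  rw [key]
  refine (norm_add_le _ _).trans ?_
  have h1 : ‖(g v : ℂ) * ∑ k ∈ Ioc u v, a k‖ ≤ g v * B := by
    rw [norm_mul, Complex.norm_of_nonneg (hg0 v huv)]
    exact mul_le_mul_of_nonneg_left (hB _ _) (hg0 v huv)
  have h2 : ‖∑ j ∈ Ico (u + 1) v, ((g j - g (j + 1) : ℝ) : ℂ) * ∑ k ∈ Ioc u j, a k‖ ≤
      ∑ j ∈ Ico (u + 1) v, (g j - g (j + 1)) * B := by
    refine norm_sum_le_of_le _ fun j hj => ?_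
    have := sub_nonneg.2 (hg j (by have := (mem_Ico.1 hj).1; omega))
    rw [norm_mul, Complex.norm_of_nonneg this]
    exact mul_le_mul_of_nonneg_left (hB _ _) this
  have h3 : ∑ j ∈ Ico (u + 1) v, (g j - g (j + 1)) = g (u + 1) - g v := by
    have := Finset.sum_Ico_sub (fun j => -g j) (show u + 1 ≤ v from huv)
    simp only [neg_sub_neg] at this
    exact this
  rw [← sum_mul, h3] at h2
  linarith

lemma norm_tsum_sub_sum_Ioc_le {F : ℕ → ℂ} (hF : Summable F) (h0 : F 0 = 0) {N : ℕ} {B : ℝ}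
    (hB : ∀ v, ‖∑ k ∈ Ioc N v, F k‖ ≤ B) : ‖∑' n, F n - ∑ n ∈ Ioc 0 N, F n‖ ≤ B := by
  have h1 : Filter.Tendsto (fun v => ∑ k ∈ Ioc 0 v, F k) Filter.atTop (nhds (∑' n, F n)) := by
    have := (hF.hasSum.tendsto_sum_nat).comp (Filter.tendsto_add_atTop_nat 1)
    refine this.congr fun v => ?_
    simp only [Function.comp]
    rw [range_eq_Ico, sum_eq_sum_Ico_succ_bot (Nat.succ_pos v), h0, zero_add]
    rfl
  refine le_of_tendsto (h1.sub_const (∑ n ∈ Ioc 0 N, F n)).norm ?_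
  filter_upwards [Filter.eventually_ge_atTop N] with v hv
  rw [← sum_Ioc_consecutive F (Nat.zero_le N) hv, add_sub_cancel_left]
  exact hB v

variable {q : ℕ} [NeZero q]

lemma norm_sum_dirichletCharacter_le {χ : DirichletCharacter ℂ q} (hχ : χ ≠ 1) (u v : ℕ) :
    ‖∑ k ∈ Ioc u v, χ k‖ ≤ 2 * q := by
  have h0 : ∑ x : ZMod q, χ x = 0 := MulChar.sum_eq_zero_of_ne_one hχ
  have hre : |∑ n ∈ Ioc u v, (χ (n : ZMod q)).re| ≤ q := by
    refine (abs_sum_Ioc_le (g := fun x => (χ x).re) ?_ u v).trans ?_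
    · rw [← Complex.re_sum, h0, Complex.zero_re]
    · calc _ ≤ ∑ _x : ZMod q, (1 : ℝ) :=
            sum_le_sum fun x _ => (Complex.abs_re_le_norm _).trans (χ.norm_le_one x)
        _ = q := by simp [ZMod.card]
  have him : |∑ n ∈ Ioc u v, (χ (n : ZMod q)).im| ≤ q := by
    refine (abs_sum_Ioc_le (g := fun x => (χ x).im) ?_ u v).trans ?_
    · rw [← Complex.im_sum, h0, Complex.zero_im]
    · calc _ ≤ ∑ _x : ZMod q, (1 : ℝ) :=
            sum_le_sum fun x _ => (Complex.abs_im_le_norm _).trans (χ.norm_le_one x)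
        _ = q := by simp [ZMod.card]
  refine (Complex.norm_le_abs_re_add_abs_im _).trans ?_
  rw [Complex.re_sum, Complex.im_sum]
  linarith

lemma term_ofReal_eq (f : ℕ → ℂ) (s : ℝ) {n : ℕ} (hn : n ≠ 0) :
    LSeries.term f s n = ((1 / (n : ℝ) ^ s : ℝ) : ℂ) * f n := by
  rw [LSeries.term_of_ne_zero hn, Complex.ofReal_div, Complex.ofReal_cpow (Nat.cast_nonneg n)]
  push_cast
  ring

lemma one_div_rpow_antitone {s : ℝ} (hs : 0 ≤ s) {k : ℕ} (hk : 0 < k) :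
    1 / ((k + 1 : ℕ) : ℝ) ^ s ≤ 1 / (k : ℝ) ^ s := by
  have : (0 : ℝ) < k := by exact_mod_cast hk
  exact one_div_le_one_div_of_le (by positivity)
    (rpow_le_rpow this.le (by push_cast; linarith) hs)

lemma norm_LFunction_sub_sum_le {χ : DirichletCharacter ℂ q} (hχ : χ ≠ 1) {s : ℝ} (hs : 1 < s)
    (N : ℕ) :
    ‖χ.LFunction s - ∑ n ∈ Ioc 0 N, ((1 / (n : ℝ) ^ s : ℝ) : ℂ) * χ n‖ ≤ 2 * q / (N + 1) := by
  have hs' : 1 < (s : ℂ).re := by simpa using hs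
  rw [χ.LFunction_eq_LSeries hs', LSeries]
  have hsum : LSeriesSummable (fun n : ℕ => χ n) s := ZMod.LSeriesSummable_of_one_lt_re χ hs'
  have hterm : ∀ u v, ∑ n ∈ Ioc u v, LSeries.term (fun n : ℕ => χ n) s n =
      ∑ n ∈ Ioc u v, ((1 / (n : ℝ) ^ s : ℝ) : ℂ) * χ n := fun u v =>
    sum_congr rfl fun n hn => term_ofReal_eq _ s (by have := (mem_Ioc.1 hn).1; omega)
  rw [← hterm 0 N]
  refine norm_tsum_sub_sum_Ioc_le hsum (LSeries.term_zero _ _) fun v => ?_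
  rw [hterm N v]
  refine (norm_sum_smul_le_of_antitone (g := fun n : ℕ => 1 / (n : ℝ) ^ s)
    (norm_sum_dirichletCharacter_le hχ) (fun k _ => by positivity)
    (fun k hk => one_div_rpow_antitone (by linarith) (by omega)) v).trans ?_
  rw [mul_one_div]
  refine div_le_div_of_nonneg_left (by positivity) (by positivity) ?_
  push_cast
  exact self_le_rpow_of_one_le (by linarith [(Nat.cast_nonneg N : (0 : ℝ) ≤ N)]) hs.le

lemma norm_LFunction_le {χ : DirichletCharacter ℂ q} (hχ : χ ≠ 1) {s : ℝ} (hs : 1 < s) :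
    ‖χ.LFunction s‖ ≤ 2 * q := by
  simpa using norm_LFunction_sub_sum_le hχ hs 0

lemma norm_deriv_LFunction_le {χ : DirichletCharacter ℂ q} (hχ : χ ≠ 1) {s : ℝ} (hs : 1 < s) :
    ‖deriv χ.LFunction s‖ ≤ 3 * q := by
  have hs' : 1 < (s : ℂ).re := by simpa using hs
  have habs : LSeries.abscissaOfAbsConv (fun n : ℕ => χ n) < (s : ℂ).re :=
    lt_of_le_of_lt (LSeries.abscissaOfAbsConv_le_of_forall_lt_LSeriesSummable fun y hy =>
      ZMod.LSeriesSummable_of_one_lt_re χ (by simpa using hy)) (by exact_mod_cast hs')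
  rw [χ.deriv_LFunction_eq_deriv_LSeries hs', LSeries_deriv habs, norm_neg, LSeries]
  have hsum := LSeriesSummable_logMul_of_lt_re habs
  have hq : (1 : ℝ) ≤ q := by exact_mod_cast Nat.one_le_iff_ne_zero.2 (NeZero.ne q)
  have hterm : ∀ n : ℕ, 0 < n → LSeries.term (LSeries.logMul fun n : ℕ => χ n) s n =
      ((log n / (n : ℝ) ^ s : ℝ) : ℂ) * χ n := fun n hn => by
    rw [term_ofReal_eq _ s hn.ne', LSeries.logMul, ← Complex.natCast_log]
    push_cast
    ring
  have hanti : ∀ k : ℕ, 2 < k →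
      log ((k + 1 : ℕ) : ℝ) / ((k + 1 : ℕ) : ℝ) ^ s ≤ log (k : ℝ) / (k : ℝ) ^ s := by
    intro k hk
    have h3 : (3 : ℝ) ≤ k := by exact_mod_cast hk
    have he : exp s⁻¹ ≤ 3 := by
      refine (exp_le_exp.2 (inv_le_one_of_one_le₀ hs.le)).trans ?_
      linarith [exp_one_lt_d9]
    refine log_div_self_rpow_antitoneOn (by linarith) ?_ ?_ ?_
    · exact Set.mem_Ici.2 (he.trans h3)
    · exact Set.mem_Ici.2 (he.trans (by push_cast; linarith))
    · push_cast; linarith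
  have h1 := norm_tsum_sub_sum_Ioc_le hsum (LSeries.term_zero _ _) (N := 2) (B := 2 * q * 1)
    fun v => by
      rw [sum_congr rfl fun n hn => hterm n (by have := (mem_Ioc.1 hn).1; omega)]
      refine (norm_sum_smul_le_of_antitone (g := fun n : ℕ => log n / (n : ℝ) ^ s)
        (norm_sum_dirichletCharacter_le hχ)
        (fun k _ => div_nonneg (log_natCast_nonneg k) (by positivity)) hanti v).trans ?_
      refine mul_le_mul_of_nonneg_left ?_ (by positivity)
      rw [div_le_one (by positivity)]
      have h4 : log ((2 + 1 : ℕ) : ℝ) ≤ ((2 + 1 : ℕ) : ℝ) - 1 := log_le_sub_one_of_pos (by norm_num)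
      have h5 : ((2 + 1 : ℕ) : ℝ) ≤ ((2 + 1 : ℕ) : ℝ) ^ s :=
        self_le_rpow_of_one_le (by norm_num) hs.le
      linarith
  have h2 : ‖∑ n ∈ Ioc 0 2, LSeries.term (LSeries.logMul fun n : ℕ => χ n) s n‖ ≤ 1 := by
    rw [show Ioc 0 2 = {1, 2} from rfl, sum_pair (by norm_num), hterm 1 one_pos, hterm 2 two_pos]
    simp only [Nat.cast_one, log_one, zero_div, Complex.ofReal_zero, zero_mul, zero_add]
    rw [norm_mul]
    refine mul_le_one₀ ?_ (norm_nonneg _) (χ.norm_le_one _)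
    rw [Complex.norm_of_nonneg (by positivity), div_le_one (by positivity)]
    have h4 : log ((2 : ℕ) : ℝ) ≤ ((2 : ℕ) : ℝ) - 1 := log_le_sub_one_of_pos (by norm_num)
    have h5 : ((2 : ℕ) : ℝ) ≤ ((2 : ℕ) : ℝ) ^ s := self_le_rpow_of_one_le (by norm_num) hs.le
    push_cast at *
    linarith
  have h3 := norm_add_le (∑' n, LSeries.term (LSeries.logMul fun n : ℕ => χ n) s n -
    ∑ n ∈ Ioc 0 2, LSeries.term (LSeries.logMul fun n : ℕ => χ n) s n)
    (∑ n ∈ Ioc 0 2, LSeries.term (LSeries.logMul fun n : ℕ => χ n) s n)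
  rw [sub_add_cancel] at h3
  linarith

lemma norm_LFunction_sub_le {χ : DirichletCharacter ℂ q} (hχ : χ ≠ 1) {s t : ℝ} (hs : 1 ≤ s)
    (hst : s ≤ t) : ‖χ.LFunction t - χ.LFunction s‖ ≤ 3 * q * (t - s) := by
  have hd := DirichletCharacter.differentiable_LFunction hχ
  have key : ∀ s : ℝ, 1 < s → s ≤ t → ‖χ.LFunction t - χ.LFunction s‖ ≤ 3 * q * (t - s) := by
    intro s hs hst
    have hder : ∀ x ∈ Set.Icc s t, HasDerivWithinAt (fun y : ℝ => χ.LFunction (y : ℂ))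
        (deriv χ.LFunction x) (Set.Icc s t) x := fun x _ =>
      ((hd x).hasDerivAt.comp_ofReal).hasDerivWithinAt
    exact norm_image_sub_le_of_norm_deriv_le_segment' hder
      (fun x hx => norm_deriv_LFunction_le hχ (hs.trans_le hx.1)) t ⟨hst, le_rfl⟩
  rcases hs.lt_or_eq with h | rfl
  · exact key s h hst
  rcases hst.lt_or_eq with h | rfl
  · have hc : Continuous fun y : ℝ => ‖χ.LFunction t - χ.LFunction (y : ℂ)‖ :=
      (continuous_const.sub (hd.continuous.comp Complex.continuous_ofReal)).norm
    have hc' : Continuous fun y : ℝ => 3 * (q : ℝ) * (t - y) := by fun_prop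
    refine le_of_tendsto_of_tendsto (hc.tendsto 1 |>.mono_left nhdsWithin_le_nhds)
      (hc'.tendsto 1 |>.mono_left (nhdsWithin_le_nhds (s := Set.Ioi 1))) ?_
    filter_upwards [Ioc_mem_nhdsGT h] with y hy using key y hy.1 hy.2
  · simp

end

section

open ArithmeticFunction (vonMangoldt)

lemma exists_norm_LFunction_one_le : ∃ x₁ > 0, ∀ (q : ℕ) [NeZero q] (s : ℝ), 1 < s → s ≤ 1 + x₁ →
    ‖(1 : DirichletCharacter ℂ q).LFunction s‖ ≤ 2 / (s - 1) := by
  have h := tendsto_sub_mul_tsum_nat_rpow.eventually (gt_mem_nhds (show (1 : ℝ) < 2 by norm_num))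
  rw [eventually_nhdsWithin_iff, Metric.eventually_nhds_iff] at h
  obtain ⟨ε, hε, h⟩ := h
  refine ⟨ε / 2, by positivity, fun q _ s hs hs1 => ?_⟩
  have h2 := h (y := s) (by rw [Real.dist_eq, abs_of_pos (by linarith)]; linarith) hs
  have hs' : 1 < (s : ℂ).re := by simpa using hs
  rw [DirichletCharacter.LFunction_eq_LSeries _ hs', LSeries, le_div_iff₀ (by linarith), mul_comm]
  refine le_trans (mul_le_mul_of_nonneg_left ?_ (by linarith)) h2.le
  refine tsum_of_norm_bounded ((Real.summable_one_div_nat_rpow.2 hs).hasSum) fun n => ?_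
  rcases Nat.eq_zero_or_pos n with rfl | hn
  · rw [LSeries.term_zero, norm_zero]; positivity
  · rw [term_ofReal_eq _ s hn.ne', norm_mul, Complex.norm_of_nonneg (by positivity)]
    exact mul_le_of_le_one_right (by positivity) (DirichletCharacter.norm_le_one _ _)

lemma exists_norm_LFunction_ge_of_sq_ne_one : ∃ c > 0, ∀ (q : ℕ) [NeZero q]
    (χ : DirichletCharacter ℂ q), χ ≠ 1 → χ ^ 2 ≠ 1 → ∀ s : ℝ, 1 < s → s ≤ 1 + c / q ^ 5 →
      c / q ^ 4 ≤ ‖χ.LFunction s‖ := by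
  obtain ⟨x₁, hx₁, H⟩ := exists_norm_LFunction_one_le
  refine ⟨min (1 / 30000) x₁, by positivity, fun q _ χ hχ hχ2 s hs hsc => ?_⟩
  set c := min (1 / 30000) x₁ with hc
  have hc0 : 0 < c := by positivity
  have hc1 : c ≤ 1 / 30000 := min_le_left _ _
  have hc2 : c ≤ x₁ := min_le_right _ _
  have hq : (1 : ℝ) ≤ q := by exact_mod_cast Nat.one_le_iff_ne_zero.2 (NeZero.ne q)
  have hq0 : (0 : ℝ) < q := by linarith
  set x := c / (q : ℝ) ^ 5 with hx
  have hx0 : 0 < x := by positivity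
  have hxc : x ≤ c := div_le_self hc0.le (one_le_pow₀ hq)
  set l := ‖χ.LFunction (1 + x : ℝ)‖ with hl
  have hprod := DirichletCharacter.norm_LFunction_product_ge_one χ hx0 0
  have e : (1 + x : ℂ) = ((1 + x : ℝ) : ℂ) := by push_cast; ring
  simp only [Complex.ofReal_zero, mul_zero, add_zero] at hprod
  rw [e, norm_mul, norm_mul, norm_pow, norm_pow, ← hl] at hprod
  have h1 : ‖(1 : DirichletCharacter ℂ q).LFunction (1 + x : ℝ)‖ ≤ 2 / x := by
    have := H q (1 + x) (by linarith) (by linarith)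
    rwa [add_sub_cancel_left] at this
  have h2 : ‖(χ ^ 2).LFunction (1 + x : ℝ)‖ ≤ 2 * q := norm_LFunction_le hχ2 (by linarith)
  have hlow : 6 * q * x ≤ l := by
    by_contra! hcon
    have h3 : 1 ≤ (2 / x) ^ 3 * (6 * q * x) ^ 4 * (2 * q) := by
      refine hprod.trans ?_
      have : ‖DirichletCharacter.LFunctionTrivChar q ((1 + x : ℝ) : ℂ)‖ ≤ 2 / x := h1
      gcongr
    have h4 : (2 / x) ^ 3 * (6 * q * x) ^ 4 * (2 * q) = 20736 * c := by
      rw [hx]; field_simp; ring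
    rw [h4] at h3
    linarith
  have h5 := norm_LFunction_sub_le hχ hs.le hsc
  have h6 := norm_sub_norm_le (χ.LFunction (1 + x : ℝ)) (χ.LFunction s)
  have h7 : c / q ^ 4 = q * x := by rw [hx]; field_simp
  have h8 : 3 * (q : ℝ) * (1 + x - s) ≤ 3 * q * x := by gcongr; linarith
  rw [h7]
  nlinarith [mul_pos hq0 hx0]

lemma one_le_zetaMul_sq {q : ℕ} {χ : DirichletCharacter ℂ q} (hχ : χ ^ 2 = 1) {m : ℕ}
    (hm : m ≠ 0) : 1 ≤ (χ.zetaMul (m ^ 2)).re := by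
  have hpp : ∀ p k : ℕ, p.Prime → ∃ r : ℝ, 1 ≤ r ∧ χ.zetaMul (p ^ (2 * k)) = r := by
    intro p k hp
    have hsum : χ.zetaMul (p ^ (2 * k)) = ∑ i ∈ range (2 * k + 1), χ p ^ i := by
      rw [DirichletCharacter.zetaMul, ArithmeticFunction.coe_zeta_mul_apply,
        Nat.sum_divisors_prime_pow hp]
      refine sum_congr rfl fun i _ => ?_
      rw [← χ.apply_eq_toArithmeticFunction_apply (pow_ne_zero i hp.ne_zero)]
      simp
    rw [hsum]
    rcases MulChar.isQuadratic_iff_sq_eq_one.mpr hχ p with h | h | h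
    · refine ⟨1, le_rfl, ?_⟩
      rw [h, zero_geom_sum]
      simp
    · refine ⟨2 * k + 1, by linarith [(Nat.cast_nonneg k : (0 : ℝ) ≤ k)], ?_⟩
      simp [h]
    · refine ⟨1, le_rfl, ?_⟩
      rw [h, neg_one_geom_sum, if_neg (by simp)]
      simp
  have hfac := χ.isMultiplicative_zetaMul.multiplicative_factorization _ (pow_ne_zero 2 hm)
  have key : ∃ r : ℝ, 1 ≤ r ∧ χ.zetaMul (m ^ 2) = r := by
    choose f hf1 hf2 using hpp
    refine ⟨∏ p ∈ (m ^ 2).primeFactors, if hp : p.Prime then f p (m.factorization p) hp else 1,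
      ?_, ?_⟩
    · refine Finset.one_le_prod fun p _ => ?_
      split_ifs
      · exact hf1 _ _ _
      · exact le_rfl
    · rw [hfac, Finsupp.prod, Nat.support_factorization, Complex.ofReal_prod]
      refine prod_congr rfl fun p hp => ?_
      have hp := Nat.prime_of_mem_primeFactors hp
      rw [dif_pos hp, ← hf2, Nat.factorization_pow]
      simp
  obtain ⟨r, hr, h⟩ := key
  rw [h, Complex.ofReal_re]
  exact hr

lemma zetaMul_re_nonneg {q : ℕ} {χ : DirichletCharacter ℂ q} (hχ : χ ^ 2 = 1) (n : ℕ) :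
    0 ≤ (χ.zetaMul n).re := by
  have := DirichletCharacter.zetaMul_nonneg hχ n
  exact (Complex.le_def.1 this).1

end

section

open ArithmeticFunction (vonMangoldt)

lemma natCast_mul_pow_le_geomSum (z : ℝ) (n : ℕ) :
    ((n + 1 : ℕ) : ℝ) * z ^ n ≤ ∑ i ∈ range (n + 1), (z ^ 2) ^ i := by
  induction n using Nat.twoStepInduction with
  | zero => simp
  | one => simp [sum_range_succ]; nlinarith [sq_nonneg (z - 1)]
  | more n ih _ =>
    rw [sum_range_succ, sum_range_succ']
    have h : ∑ i ∈ range (n + 1), (z ^ 2) ^ (i + 1) = z ^ 2 * ∑ i ∈ range (n + 1), (z ^ 2) ^ i := by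
      rw [mul_sum]; exact sum_congr rfl fun i _ => by ring
    rw [h]
    have h1 := mul_le_mul_of_nonneg_left ih (sq_nonneg z)
    have h2 := sq_nonneg (z ^ (n + 2) - 1)
    have h3 : z ^ 2 * (((n + 1 : ℕ) : ℝ) * z ^ n) = ((n + 1 : ℕ) : ℝ) * z ^ (n + 2) := by ring
    have h4 : (z ^ 2) ^ (n + 2) = (z ^ (n + 2)) ^ 2 := by ring
    rw [h3] at h1
    rw [pow_zero, h4]
    push_cast at h1 ⊢
    nlinarith

/-- The weight comparing `1 / (n (1 - x))` with the Lambert kernel `x ^ n / (1 - x ^ n)`. -/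
noncomputable def lambertGap (x : ℝ) (n : ℕ) : ℝ := 1 / (n * (1 - x)) - x ^ n / (1 - x ^ n)

lemma lambertGap_eq {x : ℝ} (hx1 : x < 1) (n : ℕ) :
    lambertGap x n = (1 / n - x ^ n / ∑ i ∈ range n, x ^ i) / (1 - x) := by
  have h : 1 - x ≠ 0 := by linarith
  have hs : 1 - x ^ n = (∑ i ∈ range n, x ^ i) * (1 - x) := (geom_sum_mul_neg x n).symm
  rw [lambertGap, hs, sub_div, div_div, div_div]

lemma lambertGap_nonneg {x : ℝ} (hx0 : 0 < x) (hx1 : x < 1) {n : ℕ} (hn : 0 < n) :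
    0 ≤ lambertGap x n := by
  rw [lambertGap_eq hx1]
  refine div_nonneg ?_ (by linarith)
  have h : (n : ℝ) * x ^ n ≤ ∑ i ∈ range n, x ^ i := by
    have := card_nsmul_le_sum (range n) (fun i => x ^ i) (x ^ n) fun i hi =>
      pow_le_pow_of_le_one hx0.le hx1.le (mem_range.1 hi).le
    simpa using this
  have hn' : (0 : ℝ) < n := by exact_mod_cast hn
  have h0 : 0 < ∑ i ∈ range n, x ^ i := lt_of_lt_of_le (by positivity) h
  rw [sub_nonneg, div_le_div_iff₀ h0 hn']
  linarith

lemma lambertGap_succ_le {z : ℝ} (hz0 : 0 < z) (hz1 : z < 1) {n : ℕ} (hn : 0 < n) :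
    lambertGap (z ^ 2) (n + 1) ≤ lambertGap (z ^ 2) n := by
  have hx1 : z ^ 2 < 1 := pow_lt_one₀ hz0.le hz1 two_ne_zero
  rw [lambertGap_eq hx1, lambertGap_eq hx1]
  refine div_le_div_of_nonneg_right ?_ (by linarith)
  obtain ⟨m, rfl⟩ : ∃ m, n = m + 1 := ⟨n - 1, by omega⟩
  set S := ∑ i ∈ range (m + 1), (z ^ 2) ^ i with hS
  have h1 := natCast_mul_pow_le_geomSum z m
  have h2 := natCast_mul_pow_le_geomSum z (m + 1)
  have h3 : ∑ i ∈ range (m + 1 + 1), (z ^ 2) ^ i = 1 + z ^ 2 * S := by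
    rw [sum_range_succ', hS, mul_sum, add_comm, pow_zero]
    congr 1
    exact sum_congr rfl fun i _ => by ring
  rw [← hS] at h1
  rw [h3] at h2 ⊢
  have hS0 : 0 < S := lt_of_lt_of_le (by positivity) h1
  have hprod : ((m + 1 : ℕ) : ℝ) * ((m + 1 + 1 : ℕ) : ℝ) * (z ^ 2) ^ (m + 1) ≤
      S * (1 + z ^ 2 * S) := by
    calc _ ≤ (((m + 1 : ℕ) : ℝ) * z ^ m) * (((m + 1 + 1 : ℕ) : ℝ) * z ^ (m + 1)) := by
          have : (z ^ 2) ^ (m + 1) ≤ z ^ m * z ^ (m + 1) := by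
            rw [← pow_mul, ← pow_add]
            exact pow_le_pow_of_le_one hz0.le hz1.le (by omega)
          calc _ ≤ ((m + 1 : ℕ) : ℝ) * ((m + 1 + 1 : ℕ) : ℝ) * (z ^ m * z ^ (m + 1)) := by gcongr
            _ = _ := by ring
      _ ≤ _ := by gcongr
  have e1 : (z ^ 2) ^ (m + 1) / S - (z ^ 2) ^ (m + 1 + 1) / (1 + z ^ 2 * S) =
      (z ^ 2) ^ (m + 1) / (S * (1 + z ^ 2 * S)) := by
    field_simp; ring
  have e2 : (1 : ℝ) / ((m + 1 : ℕ) : ℝ) - 1 / ((m + 1 + 1 : ℕ) : ℝ) =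
      1 / (((m + 1 : ℕ) : ℝ) * ((m + 1 + 1 : ℕ) : ℝ)) := by
    push_cast; field_simp; ring
  have : (z ^ 2) ^ (m + 1) / (S * (1 + z ^ 2 * S)) ≤
      1 / (((m + 1 : ℕ) : ℝ) * ((m + 1 + 1 : ℕ) : ℝ)) := by
    rw [div_le_div_iff₀ (by positivity) (by positivity)]
    linarith
  linarith

section
variable {q : ℕ} [NeZero q]

lemma norm_LFunction_one_sub_sum_le {χ : DirichletCharacter ℂ q} (hχ : χ ≠ 1) (N : ℕ) :
    ‖χ.LFunction 1 - ∑ n ∈ Ioc 0 N, (1 / (n : ℂ)) * χ n‖ ≤ 2 * q / (N + 1) := by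
  have hc : Continuous fun s : ℝ =>
      ‖χ.LFunction s - ∑ n ∈ Ioc 0 N, ((1 / (n : ℝ) ^ s : ℝ) : ℂ) * χ n‖ := by
    refine ((((DirichletCharacter.differentiable_LFunction hχ).continuous.comp
      Complex.continuous_ofReal)).sub (continuous_finsetSum _ fun n hn => ?_)).norm
    refine Continuous.mul (Complex.continuous_ofReal.comp ?_) continuous_const
    have hn : (0 : ℝ) < n := by exact_mod_cast (mem_Ioc.1 hn).1
    exact continuous_const.div (Real.continuous_const_rpow hn.ne') fun s => by positivity
  have h1 : Filter.Tendsto _ (nhdsWithin (1 : ℝ) (Set.Ioi 1)) _ :=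
    (hc.tendsto 1).mono_left nhdsWithin_le_nhds
  have h2 := le_of_tendsto h1 (Filter.eventually_of_mem self_mem_nhdsWithin
    fun s hs => norm_LFunction_sub_sum_le hχ hs N)
  simpa using h2

lemma sum_Ioc_pow_mul_le {x : ℝ} (hx0 : 0 < x) (hx1 : x < 1) {a N : ℕ} (ha : 0 < a) :
    |∑ b ∈ Ioc 0 (N / a), x ^ (a * b) - x ^ a / (1 - x ^ a)| ≤ x ^ N / (1 - x) := by
  have hxa : x ^ a ≤ x := by simpa using pow_le_pow_of_le_one hx0.le hx1.le ha
  have h : ∑ b ∈ Ioc 0 (N / a), x ^ (a * b) =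
      x ^ a / (1 - x ^ a) - x ^ (a * (N / a + 1)) / (1 - x ^ a) := by
    have h1 : ∑ b ∈ Ioc 0 (N / a), x ^ (a * b) = ∑ b ∈ Ico 1 (N / a + 1), (x ^ a) ^ b :=
      sum_congr rfl fun b _ => pow_mul _ _ _
    rw [h1, geom_sum_Ico' (by linarith) (Nat.le_add_left 1 _), pow_one, ← pow_mul]
    ring
  rw [h, sub_sub_cancel_left, abs_neg, abs_of_nonneg (div_nonneg (by positivity) (by linarith))]
  have h2 : x ^ (a * (N / a + 1)) ≤ x ^ N :=
    pow_le_pow_of_le_one hx0.le hx1.le (Nat.lt_mul_div_succ N ha).le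
  exact div_le_div₀ (by positivity) h2 (by linarith) (by linarith)

lemma sum_pow_sq_le_aux {χ : DirichletCharacter ℂ q} (hχ : χ ≠ 1) (hχ2 : χ ^ 2 = 1) {z : ℝ}
    (hz0 : 0 < z) (hz1 : z < 1) {M N : ℕ} (hMN : M ^ 2 ≤ N) :
    ∑ m ∈ Ioc 0 M, (z ^ 2) ^ (m ^ 2) ≤ ((χ.LFunction 1).re + 2 * q / (N + 1)) / (1 - z ^ 2) +
      2 * q + N * ((z ^ 2) ^ N / (1 - z ^ 2)) := by
  set x := z ^ 2 with hx
  have hx1 : x < 1 := pow_lt_one₀ hz0.le hz1 two_ne_zero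
  have hx0 : 0 < x := by positivity
  have hx1' : 0 < 1 - x := by linarith
  set a : ℕ → ℝ := fun d => (χ d).re with ha
  have ha1 : ∀ d, |a d| ≤ 1 := fun d =>
    (Complex.abs_re_le_norm _).trans (DirichletCharacter.norm_le_one _ _)
  have hz : ∀ n : ℕ, (χ.zetaMul n).re = ∑ y ∈ n.divisorsAntidiagonal, a y.1 := by
    intro n
    rw [DirichletCharacter.zetaMul, ArithmeticFunction.coe_zeta_mul_apply, Complex.re_sum,
      Nat.sum_divisorsAntidiagonal (fun d _ => a d)]
    refine sum_congr rfl fun d hd => ?_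
    rw [← χ.apply_eq_toArithmeticFunction_apply (Nat.pos_of_mem_divisors hd).ne']
  have h1 : ∑ m ∈ Ioc 0 M, x ^ (m ^ 2) ≤ ∑ n ∈ Ioc 0 N, (χ.zetaMul n).re * x ^ n := by
    calc _ ≤ ∑ m ∈ Ioc 0 M, (χ.zetaMul (m ^ 2)).re * x ^ (m ^ 2) := by
          refine sum_le_sum fun m hm => ?_
          exact le_mul_of_one_le_left (by positivity)
            (one_le_zetaMul_sq hχ2 (mem_Ioc.1 hm).1.ne')
      _ = ∑ n ∈ (Ioc 0 M).image (· ^ 2), (χ.zetaMul n).re * x ^ n := by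
          rw [sum_image]
          exact fun i _ j _ hij => Nat.pow_left_injective two_ne_zero hij
      _ ≤ _ := by
          refine sum_le_sum_of_subset_of_nonneg ?_ fun n _ _ =>
            mul_nonneg (zetaMul_re_nonneg hχ2 n) (by positivity)
          intro n hn
          obtain ⟨m, hm, rfl⟩ := mem_image.1 hn
          have hm := mem_Ioc.1 hm
          exact mem_Ioc.2 ⟨pow_pos hm.1 2, (Nat.pow_le_pow_left hm.2 2).trans hMN⟩
  have h2 : ∑ n ∈ Ioc 0 N, (χ.zetaMul n).re * x ^ n =
      ∑ d ∈ Ioc 0 N, a d * ∑ b ∈ Ioc 0 (N / d), x ^ (d * b) := by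
    have := sum_Ioc_divisorsAntidiagonal (fun d b => a d * x ^ (d * b)) N
    simp only [← mul_sum] at this
    rw [← this]
    refine sum_congr rfl fun n _ => ?_
    rw [hz, sum_mul]
    refine sum_congr rfl fun y hy => ?_
    rw [(Nat.mem_divisorsAntidiagonal.1 hy).1]
  have h3 : ∑ d ∈ Ioc 0 N, a d * ∑ b ∈ Ioc 0 (N / d), x ^ (d * b) ≤
      ∑ d ∈ Ioc 0 N, a d * (x ^ d / (1 - x ^ d)) + N * (x ^ N / (1 - x)) := by
    have : (N : ℝ) * (x ^ N / (1 - x)) = ∑ d ∈ Ioc 0 N, x ^ N / (1 - x) := by simp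
    rw [this, ← sum_add_distrib]
    refine sum_le_sum fun d hd => ?_
    have h := sum_Ioc_pow_mul_le hx0 hx1 (N := N) (mem_Ioc.1 hd).1
    set u := ∑ b ∈ Ioc 0 (N / d), x ^ (d * b)
    have h' : a d * (u - x ^ d / (1 - x ^ d)) ≤ x ^ N / (1 - x) := by
      refine (le_abs_self _).trans ?_
      rw [abs_mul]
      exact (mul_le_of_le_one_left (abs_nonneg _) (ha1 d)).trans h
    linarith [mul_sub (a d) u (x ^ d / (1 - x ^ d))]
  have h4 : ∑ d ∈ Ioc 0 N, a d * (x ^ d / (1 - x ^ d)) =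
      (∑ d ∈ Ioc 0 N, 1 / (d : ℂ) * χ d).re / (1 - x) -
        (∑ d ∈ Ioc 0 N, (lambertGap x d : ℂ) * χ d).re := by
    rw [Complex.re_sum, Complex.re_sum, sum_div, ← sum_sub_distrib]
    refine sum_congr rfl fun d hd => ?_
    have e : (1 / (d : ℂ)) = ((1 / (d : ℝ) : ℝ) : ℂ) := by push_cast; rfl
    rw [e, Complex.re_ofReal_mul, Complex.re_ofReal_mul, lambertGap]
    simp only [ha]
    rw [← div_div]
    ring
  have h5 : (∑ d ∈ Ioc 0 N, 1 / (d : ℂ) * χ d).re ≤ (χ.LFunction 1).re + 2 * q / (N + 1) := by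
    have := (Complex.abs_re_le_norm _).trans (norm_LFunction_one_sub_sum_le hχ N)
    rw [Complex.sub_re] at this
    linarith [(abs_le.1 this).1]
  have h6 : -(∑ d ∈ Ioc 0 N, (lambertGap x d : ℂ) * χ d).re ≤ 2 * q := by
    have h := norm_sum_smul_le_of_antitone (norm_sum_dirichletCharacter_le hχ)
      (g := lambertGap x) (u := 0) (fun k hk => lambertGap_nonneg hx0 hx1 hk)
      (fun k hk => lambertGap_succ_le hz0 hz1 hk) N
    have h1 : lambertGap x (0 + 1) = 1 := by
      rw [lambertGap]; norm_num; field_simp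
    rw [h1, mul_one] at h
    linarith [(abs_le.1 ((Complex.abs_re_le_norm _).trans h)).1]
  have h7 := div_le_div_of_nonneg_right h5 hx1'.le
  linarith

lemma sum_pow_sq_le {χ : DirichletCharacter ℂ q} (hχ : χ ≠ 1) (hχ2 : χ ^ 2 = 1) {z : ℝ}
    (hz0 : 0 < z) (hz1 : z < 1) (M : ℕ) :
    ∑ m ∈ Ioc 0 M, (z ^ 2) ^ (m ^ 2) ≤ (χ.LFunction 1).re / (1 - z ^ 2) + 2 * q := by
  have hx1 : z ^ 2 < 1 := pow_lt_one₀ hz0.le hz1 two_ne_zero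
  have t1 : Filter.Tendsto (fun N : ℕ => 2 * (q : ℝ) / (N + 1)) Filter.atTop (nhds 0) :=
    tendsto_const_nhds.div_atTop
      (Filter.tendsto_atTop_add_const_right _ _ tendsto_natCast_atTop_atTop)
  have t2 : Filter.Tendsto (fun N : ℕ => (N : ℝ) * ((z ^ 2) ^ N / (1 - z ^ 2))) Filter.atTop
      (nhds 0) := by
    have := (tendsto_self_mul_const_pow_of_lt_one (sq_nonneg z) hx1).div_const (1 - z ^ 2)
    rw [zero_div] at this
    exact this.congr fun N => by ring
  have t3 := (((t1.const_add (χ.LFunction 1).re).div_const (1 - z ^ 2)).add_const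
    (2 * (q : ℝ))).add t2
  rw [add_zero, add_zero] at t3
  refine ge_of_tendsto t3 ?_
  filter_upwards [Filter.eventually_ge_atTop (M ^ 2)] with N hN
  exact sum_pow_sq_le_aux hχ hχ2 hz0 hz1 hN

lemma one_div_le_LFunction_one_re {χ : DirichletCharacter ℂ q} (hχ : χ ≠ 1) (hχ2 : χ ^ 2 = 1) :
    1 / (64 * q) ≤ (χ.LFunction 1).re := by
  have hq : (1 : ℝ) ≤ q := by exact_mod_cast Nat.one_le_iff_ne_zero.2 (NeZero.ne q)
  set M := 8 * q with hM
  have hMr : (M : ℝ) = 8 * q := by rw [hM]; push_cast; ring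
  set x : ℝ := 1 - 1 / (2 * (M : ℝ) ^ 2) with hx
  have hM2 : (1 : ℝ) ≤ (M : ℝ) ^ 2 := one_le_pow₀ (by rw [hMr]; linarith)
  have h0 : 1 / (2 * (M : ℝ) ^ 2) ≤ 1 / 2 := by
    apply one_div_le_one_div_of_le <;> linarith
  have h00 : 0 < 1 / (2 * (M : ℝ) ^ 2) := by positivity
  have hx0 : 0 < x := by linarith
  have hx1 : x < 1 := by linarith
  have h := sum_pow_sq_le hχ hχ2 (z := √x) (Real.sqrt_pos.2 hx0)
    (by rw [Real.sqrt_lt' one_pos]; linarith) M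
  rw [Real.sq_sqrt hx0.le] at h
  have h1 : (M : ℝ) * (1 / 2) ≤ ∑ m ∈ Ioc 0 M, x ^ (m ^ 2) := by
    have : (M : ℝ) * (1 / 2) = ∑ m ∈ Ioc 0 M, (1 / 2 : ℝ) := by simp
    rw [this]
    refine sum_le_sum fun m hm => ?_
    have hb := one_add_mul_le_pow (a := x - 1) (by linarith) (m ^ 2)
    rw [add_sub_cancel] at hb
    refine le_trans ?_ hb
    have hm2 : ((m ^ 2 : ℕ) : ℝ) ≤ (M : ℝ) ^ 2 := by
      exact_mod_cast Nat.pow_le_pow_left (mem_Ioc.1 hm).2 2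
    have : ((m ^ 2 : ℕ) : ℝ) * (1 / (2 * (M : ℝ) ^ 2)) ≤ 1 / 2 := by
      calc _ ≤ (M : ℝ) ^ 2 * (1 / (2 * (M : ℝ) ^ 2)) := by gcongr
        _ = 1 / 2 := by
          have : (M : ℝ) ≠ 0 := by rw [hMr]; positivity
          field_simp
    have e : x - 1 = -(1 / (2 * (M : ℝ) ^ 2)) := by rw [hx]; ring
    rw [e]
    linarith
  have h2 : (χ.LFunction 1).re / (1 - x) = (χ.LFunction 1).re * (128 * (q : ℝ) ^ 2) := by
    rw [hx, sub_sub_cancel, hMr]; field_simp; ring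
  rw [h2] at h
  rw [div_le_iff₀ (by positivity)]
  have h3 : (M : ℝ) * (1 / 2) = 4 * q := by rw [hMr]; ring
  have h4 : 2 * (q : ℝ) ≤ (χ.LFunction 1).re * (128 * (q : ℝ) ^ 2) := by linarith
  have h5 : (χ.LFunction 1).re * (128 * (q : ℝ) ^ 2) =
      (2 * q) * ((χ.LFunction 1).re * (64 * q)) := by ring
  rw [h5] at h4
  exact le_of_mul_le_mul_left (by linarith) (show (0 : ℝ) < 2 * q by linarith)

end

lemma exists_norm_deriv_div_LFunction_le : ∃ A > 0, ∀ (q : ℕ) [NeZero q]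
    (χ : DirichletCharacter ℂ q), χ ≠ 1 → ∀ s : ℝ, 1 < s → s ≤ 1 + 1 / (A * q ^ 5) →
      ‖deriv χ.LFunction s / χ.LFunction s‖ ≤ A * q ^ 5 := by
  obtain ⟨c, hc, H⟩ := exists_norm_LFunction_ge_of_sq_ne_one
  set c' := min c (1 / 1000) with hc'
  have hc'0 : 0 < c' := by positivity
  refine ⟨3 / c', by positivity, fun q _ χ hχ s hs hsc => ?_⟩
  have hq : (1 : ℝ) ≤ q := by exact_mod_cast Nat.one_le_iff_ne_zero.2 (NeZero.ne q)
  have hq0 : (0 : ℝ) < q := by linarith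
  have hsc' : s ≤ 1 + c' / q ^ 5 := by
    refine hsc.trans ?_
    have : 1 / (3 / c' * (q : ℝ) ^ 5) = (c' / q ^ 5) / 3 := by field_simp
    rw [this]
    have : 0 < c' / (q : ℝ) ^ 5 := by positivity
    linarith
  have key : c' / q ^ 4 ≤ ‖χ.LFunction s‖ := by
    by_cases h2 : χ ^ 2 = 1
    · have h1 := one_div_le_LFunction_one_re hχ h2
      have h3 := norm_LFunction_sub_le hχ le_rfl hs.le
      have h4 := (Complex.re_le_norm (χ.LFunction 1)).trans
        (norm_le_norm_add_norm_sub (χ.LFunction (s : ℂ)) (χ.LFunction 1))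
      rw [Complex.ofReal_one] at h3
      have h5 : c' / (q : ℝ) ^ 5 ≤ (1 / 1000) / q ^ 2 := by
        apply div_le_div₀ (by norm_num) (min_le_right _ _) (by positivity)
        exact pow_le_pow_right₀ hq (by norm_num)
      have h6 : 3 * (q : ℝ) * (s - 1) ≤ 3 * q * ((1 / 1000) / q ^ 2) := by
        gcongr; linarith
      have h7 : 3 * (q : ℝ) * ((1 / 1000) / q ^ 2) = (3 / 1000) * (1 / q) := by
        field_simp
      have h8 : c' / (q : ℝ) ^ 4 ≤ (1 / 1000) * (1 / q) := by
        rw [mul_one_div]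
        apply div_le_div₀ (by norm_num) (min_le_right _ _) (by positivity)
        simpa using pow_le_pow_right₀ hq (show 1 ≤ 4 by norm_num)
      have h9 : 1 / (64 * (q : ℝ)) = (1 / 64) * (1 / q) := by field_simp
      have h10 : 0 < 1 / (q : ℝ) := by positivity
      linarith
    · refine le_trans ?_ (H q χ hχ h2 s hs (hsc'.trans ?_))
      · gcongr; exact min_le_left _ _
      · gcongr; exact min_le_left _ _
  rw [norm_div]
  have h0 : 0 < c' / (q : ℝ) ^ 4 := by positivity
  calc _ ≤ 3 * q / (c' / (q : ℝ) ^ 4) :=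
        div_le_div₀ (by positivity) (norm_deriv_LFunction_le hχ hs) h0 key
    _ = _ := by field_simp

end

section

open ArithmeticFunction (vonMangoldt)

open DirichletCharacter in
lemma exists_norm_logDeriv_zeta_add_le : ∃ B > 0, ∀ s : ℝ, 1 < s → s ≤ 2 →
    ‖deriv (LFunctionTrivChar 1) s / LFunctionTrivChar 1 s + 1 / (s - 1 : ℂ)‖ ≤ B := by
  have hc : ContinuousOn
      (fun x : ℝ => -deriv (LFunctionTrivChar₁ 1) x / LFunctionTrivChar₁ 1 x) (Set.Icc 1 2) := by
    refine (continuousOn_neg_logDeriv_LFunctionTrivChar₁ 1).comp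
      Complex.continuous_ofReal.continuousOn fun x hx => ?_
    rcases eq_or_ne x 1 with rfl | h
    · left; simp
    · right
      refine LFunction_ne_zero_of_one_le_re 1 (.inr (by exact_mod_cast h)) (by simpa using hx.1)
  obtain ⟨B, hB⟩ := isCompact_Icc.exists_bound_of_continuousOn hc
  refine ⟨max B 1, by positivity, fun s hs hs2 => ?_⟩
  refine le_trans (le_of_eq ?_) ((hB s ⟨hs.le, hs2⟩).trans (le_max_left _ _))
  have hs₁ : (s : ℂ) ≠ 1 := by exact_mod_cast hs.ne'
  have h1 : (s : ℂ) - 1 ≠ 0 := sub_ne_zero_of_ne hs₁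
  have h2 : LFunctionTrivChar 1 (s : ℂ) ≠ 0 :=
    LFunction_ne_zero_of_one_le_re 1 (.inr hs₁) (by simpa using hs.le)
  rw [← norm_neg, deriv_LFunctionTrivChar₁_apply_of_ne_one _ hs₁, LFunctionTrivChar₁,
    Function.update_of_ne hs₁]
  congr 1
  field_simp

open DirichletCharacter in
lemma norm_logDeriv_trivChar_sub_le {q : ℕ} (hq : q.Prime) [NeZero q] {s : ℝ} (hs : 1 < s) :
    ‖deriv (LFunctionTrivChar q) s / LFunctionTrivChar q s -
      deriv (LFunctionTrivChar 1) s / LFunctionTrivChar 1 s‖ ≤ 1 := by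
  have hs₁ : (s : ℂ) ≠ 1 := by exact_mod_cast hs.ne'
  have hfac : ∀ w : ℂ, w ≠ 1 →
      LFunctionTrivChar q w = (1 - (q : ℂ) ^ (-w)) * LFunctionTrivChar 1 w := by
    intro w hw
    rw [LFunctionTrivChar_eq_mul_riemannZeta hw, LFunctionTrivChar_eq_mul_riemannZeta hw,
      hq.primeFactors]
    simp
  have hz : LFunctionTrivChar 1 (s : ℂ) ≠ 0 :=
    LFunction_ne_zero_of_one_le_re 1 (.inr hs₁) (by simpa using hs.le)
  have hq0 : (q : ℂ) ≠ 0 := by exact_mod_cast hq.ne_zero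
  have hder : HasDerivAt (fun w : ℂ => (1 - (q : ℂ) ^ (-w)) * LFunctionTrivChar 1 w)
      (((q : ℂ) ^ (-(s : ℂ)) * Complex.log q) * LFunctionTrivChar 1 s +
        (1 - (q : ℂ) ^ (-(s : ℂ))) * deriv (LFunctionTrivChar 1) s) (s : ℂ) := by
    refine HasDerivAt.mul ?_
      (differentiableAt_LFunction (1 : DirichletCharacter ℂ 1) _ (.inl hs₁)).hasDerivAt
    have := ((hasDerivAt_neg (s : ℂ)).const_cpow (c := (q : ℂ)) (.inl hq0)).const_sub 1
    convert! this using 1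
    ring
  have hd : deriv (LFunctionTrivChar q) s =
      ((q : ℂ) ^ (-(s : ℂ)) * Complex.log q) * LFunctionTrivChar 1 s +
        (1 - (q : ℂ) ^ (-(s : ℂ))) * deriv (LFunctionTrivChar 1) s := by
    rw [← hder.deriv]
    refine Filter.EventuallyEq.deriv_eq ?_
    filter_upwards [isOpen_ne.mem_nhds hs₁] with w hw
    exact hfac w hw
  have hq2 : (2 : ℝ) ≤ q := by exact_mod_cast hq.two_le
  set t : ℝ := (q : ℝ) ^ (-s) with ht
  have htc : (q : ℂ) ^ (-(s : ℂ)) = (t : ℂ) := by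
    rw [ht, Complex.ofReal_cpow (by positivity)]; simp
  have ht0 : 0 < t := by positivity
  have htq : t ≤ 1 / q := by
    rw [ht, one_div, ← Real.rpow_neg_one]
    exact Real.rpow_le_rpow_of_exponent_le (by linarith) (by linarith)
  have htq' : t * q ≤ 1 := by rwa [le_div_iff₀ (by linarith)] at htq
  have ht1 : t < 1 := by nlinarith
  have h1t : (1 - (t : ℂ)) ≠ 0 := by
    have : ((1 - t : ℝ) : ℂ) ≠ 0 := by exact_mod_cast (show (1 - t) ≠ 0 by linarith)
    simpa using this
  have e : deriv (LFunctionTrivChar q) s / LFunctionTrivChar q s -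
      deriv (LFunctionTrivChar 1) s / LFunctionTrivChar 1 s =
        ((t * Real.log q / (1 - t) : ℝ) : ℂ) := by
    rw [hd, hfac _ hs₁, htc]
    push_cast
    field_simp
    ring
  have hlog : 0 ≤ Real.log q := Real.log_nonneg (by linarith)
  rw [e, Complex.norm_real, Real.norm_of_nonneg (div_nonneg (by positivity) (by linarith)),
    div_le_one (by linarith)]
  have := Real.log_le_sub_one_of_pos (show (0 : ℝ) < q by linarith)
  nlinarith

/-- The Dirichlet series of the von Mangoldt function over `n ≡ 1 (mod q)`, at a real point. -/
noncomputable def residueSeries (q : ℕ) (s : ℝ) : ℝ :=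
  ∑' n : ℕ, vonMangoldt.residueClass (1 : ZMod q) n / (n : ℝ) ^ s

lemma summable_residueSeries (q : ℕ) {s : ℝ} (hs : 1 < s) :
    Summable fun n : ℕ => vonMangoldt.residueClass (1 : ZMod q) n / (n : ℝ) ^ s :=
  LSeries.summable_real_of_abscissaOfAbsConv_lt <|
    (vonMangoldt.abscissaOfAbsConv_residueClass_le_one (1 : ZMod q)).trans_lt <| mod_cast hs

lemma residueSeries_eq (q : ℕ) (s : ℝ) :
    (residueSeries q s : ℂ) =
      LSeries (fun n : ℕ => ((vonMangoldt.residueClass (1 : ZMod q) n : ℝ) : ℂ)) s := by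
  rw [residueSeries, Complex.ofReal_tsum, LSeries]
  refine tsum_congr fun n => ?_
  rcases eq_or_ne n 0 with rfl | hn
  · simp [vonMangoldt.residueClass_apply_zero]
  · rw [LSeries.term_of_ne_zero hn, Complex.ofReal_div, Complex.ofReal_cpow (Nat.cast_nonneg _),
      Complex.ofReal_natCast]

open DirichletCharacter in
lemma exists_abs_residueSeries_sub_le : ∃ A > 0, ∀ q : ℕ, q.Prime → ∀ s : ℝ, 1 < s →
    s ≤ 1 + 1 / (A * q ^ 5) → |residueSeries q s - 1 / ((q - 1) * (s - 1))| ≤ A * q ^ 5 := by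
  classical
  obtain ⟨A, hA, H⟩ := exists_norm_deriv_div_LFunction_le
  obtain ⟨B, hB, HB⟩ := exists_norm_logDeriv_zeta_add_le
  refine ⟨A + B + 1, by positivity, fun q hq s hs hsA => ?_⟩
  have : NeZero q := ⟨hq.ne_zero⟩
  have hq2 : (2 : ℝ) ≤ q := by exact_mod_cast hq.two_le
  have hq5 : (1 : ℝ) ≤ (q : ℝ) ^ 5 := one_le_pow₀ (by linarith)
  have hs2 : s ≤ 2 := by
    refine hsA.trans ?_
    have : 1 / ((A + B + 1) * (q : ℝ) ^ 5) ≤ 1 := by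
      rw [div_le_one (by positivity)]
      nlinarith
    linarith
  have hsA' : s ≤ 1 + 1 / (A * q ^ 5) := by
    refine hsA.trans ?_
    gcongr
    linarith
  have ha : IsUnit (1 : ZMod q) := isUnit_one
  have h1 := vonMangoldt.LSeries_residueClass_eq ha (s := s) (by simpa using hs)
  rw [← residueSeries_eq q s, Fintype.sum_eq_add_sum_compl 1, ZMod.inv_one] at h1
  simp only [map_one, one_mul] at h1
  set T := deriv (LFunction (1 : DirichletCharacter ℂ q)) s / LFunction (1 : DirichletCharacter ℂ q) s
    with hT
  set W := ∑ χ ∈ ({1}ᶜ : Finset (DirichletCharacter ℂ q)), deriv (LFunction χ) s / LFunction χ s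
    with hW
  have hφ : ((q.totient : ℕ) : ℂ) = (q : ℂ) - 1 := by
    rw [Nat.totient_prime hq, Nat.cast_sub hq.one_le, Nat.cast_one]
  have hq1 : (0 : ℝ) < q - 1 := by linarith
  have hTn : ‖T + 1 / (s - 1 : ℂ)‖ ≤ B + 1 := by
    have h2 := norm_logDeriv_trivChar_sub_le hq hs
    have h3 := HB s hs hs2
    have := norm_add_le (T - deriv (LFunctionTrivChar 1) s / LFunctionTrivChar 1 s)
      (deriv (LFunctionTrivChar 1) s / LFunctionTrivChar 1 s + 1 / (s - 1 : ℂ))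
    rw [← add_assoc, sub_add_cancel] at this
    have h2' : ‖T - deriv (LFunctionTrivChar 1) s / LFunctionTrivChar 1 s‖ ≤ 1 := h2
    linarith
  have hcard : ((#({1}ᶜ : Finset (DirichletCharacter ℂ q)) : ℕ) : ℝ) ≤ q - 1 := by
    rw [card_compl, card_singleton, ← Nat.card_eq_fintype_card,
      DirichletCharacter.card_eq_totient_of_hasEnoughRootsOfUnity ℂ q, Nat.totient_prime hq]
    have : ((q - 1 : ℕ) : ℝ) = q - 1 := by rw [Nat.cast_sub hq.one_le, Nat.cast_one]
    rw [← this]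
    exact_mod_cast Nat.sub_le _ _
  have hWn : ‖W‖ ≤ (q - 1) * (A * q ^ 5) := by
    calc ‖W‖ ≤ ∑ χ ∈ ({1}ᶜ : Finset (DirichletCharacter ℂ q)), A * (q : ℝ) ^ 5 := by
          refine norm_sum_le_of_le _ fun χ hχ => ?_
          exact H q χ (by simpa using hχ) s hs hsA'
      _ ≤ _ := by
          rw [sum_const, nsmul_eq_mul]
          gcongr
  have hs1 : (s : ℂ) - 1 ≠ 0 := sub_ne_zero_of_ne (by exact_mod_cast hs.ne')
  have hq1c : (q : ℂ) - 1 ≠ 0 := by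
    have : ((q - 1 : ℝ) : ℂ) ≠ 0 := by exact_mod_cast hq1.ne'
    simpa using this
  have e : ((residueSeries q s - 1 / ((q - 1) * (s - 1)) : ℝ) : ℂ) =
      -((q : ℂ) - 1)⁻¹ * ((T + 1 / (s - 1 : ℂ)) + W) := by
    push_cast
    rw [h1, hφ]
    field_simp
    ring
  rw [← Real.norm_eq_abs, ← Complex.norm_real, e, norm_mul, norm_neg, norm_inv]
  have hn : ‖(q : ℂ) - 1‖ = q - 1 := by
    have : (q : ℂ) - 1 = ((q - 1 : ℝ) : ℂ) := by push_cast; rfl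
    rw [this, Complex.norm_real, Real.norm_of_nonneg hq1.le]
  rw [hn, inv_mul_le_iff₀ hq1]
  refine (norm_add_le _ _).trans ((add_le_add hTn hWn).trans ?_)
  have : (B + 1) * 1 ≤ (B + 1) * ((q - 1) * (q : ℝ) ^ 5) := by
    refine mul_le_mul_of_nonneg_left ?_ (by positivity)
    nlinarith
  linarith

end

section

open ArithmeticFunction (vonMangoldt)

lemma residueSeries_window (q : ℕ) {l : ℝ} (hl : 0 < l) :
    residueSeries q (1 + 1 / (10 * l)) ≤ exp 1 * residueSeries q (1 + 1 / l) +
      exp (-5) * residueSeries q (1 + 1 / (20 * l)) +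
      ∑ n ∈ Ioc ⌊exp l⌋₊ ⌊exp (100 * l)⌋₊,
        vonMangoldt.residueClass (1 : ZMod q) n / (n : ℝ) := by
  set r := vonMangoldt.residueClass (1 : ZMod q) with hr
  have hr0 : ∀ n, 0 ≤ r n := vonMangoldt.residueClass_nonneg _
  set J := Ioc ⌊exp l⌋₊ ⌊exp (100 * l)⌋₊ with hJ
  have hs : ∀ u : ℝ, 0 < u → Summable fun n : ℕ => r n / (n : ℝ) ^ (1 + u) := fun u hu =>
    summable_residueSeries q (by linarith)
  have h1 := hs (1 / (10 * l)) (by positivity)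
  have h2 := (hs (1 / l) (by positivity)).mul_left (exp 1)
  have h3 := (hs (1 / (20 * l)) (by positivity)).mul_left (exp (-5))
  have h4 : Summable fun n : ℕ => if n ∈ J then r n / (n : ℝ) else 0 :=
    summable_of_ne_finset_zero (s := J) fun n hn => if_neg hn
  have h5 : ∑' n : ℕ, (if n ∈ J then r n / (n : ℝ) else 0) = ∑ n ∈ J, r n / (n : ℝ) := by
    rw [tsum_eq_sum (s := J) fun n hn => if_neg hn]
    exact sum_congr rfl fun n hn => if_pos hn
  rw [← h5]
  unfold residueSeries
  rw [← tsum_mul_left, ← tsum_mul_left, ← h2.tsum_add h3, ← (h2.add h3).tsum_add h4]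
  refine h1.tsum_le_tsum (fun n => ?_) ((h2.add h3).add h4)
  rcases Nat.eq_zero_or_pos n with rfl | hn
  · simp [hr, vonMangoldt.residueClass_apply_zero]
  have hn0 : (0 : ℝ) < n := by exact_mod_cast hn
  have hn1 : (1 : ℝ) ≤ n := by exact_mod_cast hn
  have hlog : 0 ≤ log n := log_nonneg hn1
  have e : ∀ u : ℝ, r n / (n : ℝ) ^ (1 + u) = r n / n * exp (-(u * log n)) := by
    intro u
    rw [rpow_add hn0, rpow_one, rpow_def_of_pos hn0, exp_neg, ← div_div, mul_comm u, div_eq_mul_inv]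
  have hrn : 0 ≤ r n / n := div_nonneg (hr0 n) hn0.le
  have hite : 0 ≤ if n ∈ J then r n / (n : ℝ) else 0 := by split_ifs <;> [exact hrn; exact le_rfl]
  rw [e, e, e]
  have hL : exp (-(1 / (10 * l) * log n)) ≤ 1 := by
    rw [exp_le_one_iff, neg_nonpos]; positivity
  have hA : 0 ≤ exp 1 * (r n / n * exp (-(1 / l * log n))) := by positivity
  have hB : 0 ≤ exp (-5) * (r n / n * exp (-(1 / (20 * l) * log n))) := by positivity
  have hmain : r n / n * exp (-(1 / (10 * l) * log n)) ≤ r n / n :=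
    mul_le_of_le_one_right hrn hL
  by_cases hn2 : n ≤ ⌊exp l⌋₊
  · have h6 : log n ≤ l := by
      rw [log_le_iff_le_exp hn0]
      exact (Nat.le_floor_iff (exp_pos _).le).1 hn2
    have h7 : r n / n ≤ exp 1 * (r n / n * exp (-(1 / l * log n))) := by
      rw [mul_left_comm, ← exp_add]
      refine le_mul_of_one_le_right hrn (one_le_exp ?_)
      have : 1 / l * log n ≤ 1 := by rw [one_div_mul_eq_div, div_le_one hl]; exact h6
      linarith
    linarith
  by_cases hn3 : n ≤ ⌊exp (100 * l)⌋₊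
  · have : n ∈ J := mem_Ioc.2 ⟨not_le.1 hn2, hn3⟩
    rw [if_pos this]
    linarith
  · have h6 : 100 * l ≤ log n := by
      rw [le_log_iff_exp_le hn0]
      exact (Nat.lt_of_floor_lt (not_le.1 hn3)).le
    have h7 : r n / n * exp (-(1 / (10 * l) * log n)) ≤
        exp (-5) * (r n / n * exp (-(1 / (20 * l) * log n))) := by
      rw [mul_left_comm, ← exp_add]
      refine mul_le_mul_of_nonneg_left (exp_le_exp.2 ?_) hrn
      have h8 : 5 ≤ 1 / (20 * l) * log n := by
        rw [one_div_mul_eq_div, le_div_iff₀ (by positivity)]; linarith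
      have h9 : 1 / (10 * l) * log n = 2 * (1 / (20 * l) * log n) := by field_simp; ring
      linarith
    linarith

open scoped Classical in
/-- The reciprocal sum of `chainSet p j` over `(exp l, exp (100 l)]`. -/
noncomputable def chainWindow (p j : ℕ) (l : ℝ) : ℝ :=
  ∑ q ∈ Ioc ⌊exp l⌋₊ ⌊exp (100 * l)⌋₊ with q ∈ chainSet p j, 1 / (q : ℝ)

/-- The lower bound on the reciprocal sums of `chainSet p (j + 1)` proved by induction on `j`. -/
def ChainBound (j : ℕ) : Prop :=
  ∃ c > 0, ∃ A : ℕ, ∃ l₀ : ℝ, ∀ p : ℕ, p.Prime → ∀ l : ℝ, l₀ ≤ l → (p : ℝ) ^ A ≤ l →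
    c * min 1 (log l ^ j / p) ≤ chainWindow p (j + 1) l

lemma exists_residueClass_window_ge : ∃ A > 0, ∀ p : ℕ, p.Prime → ∀ l : ℝ, A * p ^ 5 ≤ l →
    7 * l / p - A * p ^ 5 ≤ ∑ n ∈ Ioc ⌊exp l⌋₊ ⌊exp (100 * l)⌋₊,
      vonMangoldt.residueClass (1 : ZMod p) n / (n : ℝ) := by
  obtain ⟨A, hA, H⟩ := exists_abs_residueSeries_sub_le
  refine ⟨4 * A, by positivity, fun p hp l hl => ?_⟩
  have hp2 : (2 : ℝ) ≤ p := by exact_mod_cast hp.two_le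
  have hp1 : (0 : ℝ) < p - 1 := by linarith
  have hP : 0 < A * (p : ℝ) ^ 5 := by positivity
  have hl0 : 0 < l := by nlinarith
  have key : ∀ u : ℝ, A * p ^ 5 ≤ u * l → 0 < u →
      |residueSeries p (1 + 1 / (u * l)) - u * (l / (p - 1))| ≤ A * p ^ 5 := by
    intro u hu hu0
    have := H p hp (1 + 1 / (u * l)) (by simp only [lt_add_iff_pos_right]; positivity)
      (by gcongr)
    rw [add_sub_cancel_left] at this
    convert! this using 3
    field_simp
  have h1 := key 10 (by linarith) (by norm_num)
  have h2 := key 1 (by linarith) (by norm_num)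
  have h3 := key 20 (by linarith) (by norm_num)
  have h4 := residueSeries_window p hl0
  rw [one_mul] at h2
  set W := ∑ n ∈ Ioc ⌊exp l⌋₊ ⌊exp (100 * l)⌋₊, vonMangoldt.residueClass (1 : ZMod p) n / (n : ℝ)
  have he1 := exp_one_lt_d9
  have he5 : exp (-5) ≤ 1 / 130 := by
    rw [exp_neg, ← one_div]
    apply one_div_le_one_div_of_le (by norm_num)
    have h : exp 5 = exp 1 ^ 5 := by rw [← exp_nat_mul]; norm_num
    have := exp_one_gt_d9
    have h7 : (2.71 : ℝ) ^ 5 ≤ exp 1 ^ 5 := pow_le_pow_left₀ (by norm_num) (by linarith) 5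
    rw [h]
    norm_num at h7 ⊢
    linarith
  rw [abs_le] at h1 h2 h3
  set D := l / ((p : ℝ) - 1) with hD
  have hDp : l / p ≤ D := div_le_div_of_nonneg_left hl0.le hp1 (by linarith)
  have hD0 : 0 < D := by positivity
  have h5 : exp 1 * residueSeries p (1 + 1 / l) ≤ 2.72 * (D + A * p ^ 5) := by
    apply mul_le_mul (by linarith) (by linarith) ?_ (by norm_num)
    exact tsum_nonneg fun n => div_nonneg (vonMangoldt.residueClass_nonneg _ _) (by positivity)
  have h6 : exp (-5) * residueSeries p (1 + 1 / (20 * l)) ≤ 1 / 130 * (20 * D + A * p ^ 5) := by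
    apply mul_le_mul he5 (by linarith) ?_ (by norm_num)
    exact tsum_nonneg fun n => div_nonneg (vonMangoldt.residueClass_nonneg _ _) (by positivity)
  rw [mul_div_assoc]
  linarith

theorem chainBound_zero : ChainBound 0 := by
  classical
  obtain ⟨A, hA, H⟩ := exists_residueClass_window_ge
  have hsum := vonMangoldt.summable_residueClass_non_primes_div (a := (1 : ZMod 1))
  set F : ℕ → ℝ := fun n => (if n.Prime then 0 else vonMangoldt.residueClass (1 : ZMod 1) n) / n
    with hF
  have hF0 : ∀ n, 0 ≤ F n := fun n => by
    rw [hF]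
    dsimp only
    split_ifs
    · simp
    · exact div_nonneg (vonMangoldt.residueClass_nonneg _ _) (by positivity)
  set C := ∑' n, F n with hC
  have hC0 : 0 ≤ C := tsum_nonneg hF0
  refine ⟨1 / 100, by norm_num, 12, (A + C) ^ 2 + 1, fun p hp l hl hpl => ?_⟩
  have hp2 : (2 : ℝ) ≤ p := by exact_mod_cast hp.two_le
  have hl1 : 1 ≤ l := by nlinarith [sq_nonneg (A + C)]
  have hl0 : 0 < l := by linarith
  have hAC : (A + C) * p ^ 6 ≤ l := by
    refine le_of_sq_le_sq ?_ hl0.le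
    calc ((A + C) * (p : ℝ) ^ 6) ^ 2 = (A + C) ^ 2 * (p : ℝ) ^ 12 := by ring
      _ ≤ l * l := by gcongr; linarith
      _ = l ^ 2 := by ring
  have hp5 : (1 : ℝ) ≤ (p : ℝ) ^ 5 := one_le_pow₀ (by linarith)
  have hAl : A * (p : ℝ) ^ 5 + C ≤ l / p := by
    rw [le_div_iff₀ (by linarith)]
    refine le_trans ?_ hAC
    have : C * p ≤ C * (p : ℝ) ^ 6 := by
      refine mul_le_mul_of_nonneg_left ?_ hC0
      simpa using pow_le_pow_right₀ (show (1 : ℝ) ≤ p by linarith) (show 1 ≤ 6 by norm_num)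
    linarith [show A * (p : ℝ) ^ 5 * p = A * p ^ 6 by ring]
  have hlp : l / p ≤ l := div_le_self hl0.le (by linarith)
  have h1 := H p hp l (by linarith)
  have h2 : ∑ n ∈ Ioc ⌊exp l⌋₊ ⌊exp (100 * l)⌋₊,
      vonMangoldt.residueClass (1 : ZMod p) n / (n : ℝ) ≤
        ∑ n ∈ Ioc ⌊exp l⌋₊ ⌊exp (100 * l)⌋₊,
          (F n + if n ∈ chainSet p 1 then 100 * l * (1 / n) else 0) := by
    refine sum_le_sum fun n hn => ?_
    have hn := mem_Ioc.1 hn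
    have hn0 : (0 : ℝ) < n := by exact_mod_cast (Nat.zero_le _).trans_lt hn.1
    have hn1 : (1 : ℝ) ≤ n := by exact_mod_cast Nat.succ_le_of_lt ((Nat.zero_le _).trans_lt hn.1)
    have hlogn : log n ≤ 100 * l := by
      rw [log_le_iff_le_exp hn0]
      exact (Nat.le_floor_iff (exp_pos _).le).1 hn.2
    have hite : (0 : ℝ) ≤ if n ∈ chainSet p 1 then 100 * l * (1 / n) else 0 := by
      split_ifs <;> positivity
    by_cases hnp : n.Prime
    · by_cases h : (n : ZMod p) = 1
      · have hmem : n ∈ chainSet p 1 := by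
          refine ⟨hnp, p, rfl, ?_⟩
          rw [← Nat.cast_one] at h
          exact (Nat.modEq_iff_dvd' hnp.one_le).1 ((ZMod.natCast_eq_natCast_iff _ _ _).1 h).symm
        rw [if_pos hmem]
        have h3 : vonMangoldt.residueClass (1 : ZMod p) n ≤ log n :=
          (vonMangoldt.residueClass_le _ n).trans (by
            rw [ArithmeticFunction.vonMangoldt_apply_prime hnp])
        have h4 := div_le_div_of_nonneg_right (h3.trans hlogn) hn0.le
        have := hF0 n
        rw [mul_one_div]
        linarith
      · have : vonMangoldt.residueClass (1 : ZMod p) n = 0 := by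
          rw [vonMangoldt.residueClass, Set.indicator_of_notMem]
          exact h
        rw [this, zero_div]
        exact add_nonneg (hF0 n) hite
    · have : vonMangoldt.residueClass (1 : ZMod p) n / n ≤ F n := by
        rw [hF]
        dsimp only
        rw [if_neg hnp]
        refine div_le_div_of_nonneg_right ((vonMangoldt.residueClass_le _ n).trans ?_) hn0.le
        rw [vonMangoldt.residueClass, Set.indicator_of_mem]
        exact Subsingleton.elim _ _
      linarith
  rw [sum_add_distrib, ← sum_filter, ← mul_sum] at h2
  have h3 : ∑ n ∈ Ioc ⌊exp l⌋₊ ⌊exp (100 * l)⌋₊, F n ≤ C :=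
    hsum.sum_le_tsum _ fun n _ => hF0 n
  have h4 : 7 * l / p - A * p ^ 5 ≤ C + 100 * l * chainWindow p 1 l := by
    refine h1.trans (h2.trans (add_le_add h3 ?_))
    exact le_of_eq (by rw [chainWindow])
  have h5 : l / p ≤ 100 * l * chainWindow p 1 l := by
    rw [mul_div_assoc] at h4
    have : 0 ≤ l / p := by positivity
    linarith
  have h6 : 1 / (p : ℝ) ≤ 100 * chainWindow p 1 l := by
    have : l * (1 / (p : ℝ)) ≤ l * (100 * chainWindow p 1 l) := by
      rw [mul_one_div]; linarith
    exact le_of_mul_le_mul_left this hl0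
  have h7 : min 1 (log l ^ 0 / (p : ℝ)) ≤ 1 / p := by
    rw [pow_zero]; exact min_le_right _ _
  rw [zero_add]
  linarith

end

section

open ArithmeticFunction (vonMangoldt)

section PrimeBlock

variable {κ : Type*} {I : Finset κ} {d : κ → ℕ}

lemma abs_sum_prime_log_mul_discSum_le {U N : ℕ} (hU : 1 ≤ U) (hUN : U ≤ N)
    (hd : ∀ i ∈ I, d i ≠ 0 ∧ d i ≤ U) :
    |∑ q ∈ Ioc N (4 * N) with q.Prime, log q * discSum I d q| ≤
      8 * N * (1 + log (4 * N)) ^ 4 * √(4 * (#I : ℝ) ^ 2 / U + 16 * commonFactorSum I d) +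
        12 * #I * U ^ 2 * (1 + log (4 * N)) + 8 * #I * (√N * log (4 * N)) := by
  have hN1 : 1 ≤ N := hU.trans hUN
  have hNr : (1 : ℝ) ≤ N := by exact_mod_cast hN1
  set s := √(4 * (#I : ℝ) ^ 2 / U + 16 * commonFactorSum I d) with hs
  have hs0 : 0 ≤ s := sqrt_nonneg _
  have h4 := abs_sum_vonMangoldt_mul_discSum_le hU (hUN.trans (by omega : N ≤ 4 * N)) hd
  have h1 := abs_sum_vonMangoldt_mul_discSum_le hU hUN hd
  rw [← hs] at h1 h4
  push_cast at h4
  have hl0 : 0 ≤ log (N : ℝ) := log_nonneg hNr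
  have hl : log (N : ℝ) ≤ log (4 * N) := log_le_log (by linarith) (by linarith)
  have hE : N * (1 + log N) ^ 4 * s + 6 * #I * U ^ 2 * (1 + log N) ≤
      4 * N * (1 + log (4 * N)) ^ 4 * s + 6 * #I * U ^ 2 * (1 + log (4 * N)) := by
    gcongr
    linarith
  have hsplit : ∑ n ∈ Ioc 0 (4 * N), vonMangoldt n * discSum I d n =
      ∑ n ∈ Ioc 0 N, vonMangoldt n * discSum I d n +
        ∑ n ∈ Ioc N (4 * N), vonMangoldt n * discSum I d n := by
    rw [sum_Ioc_consecutive _ (Nat.zero_le _) (by omega)]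
  have hfilter : ∑ n ∈ Ioc N (4 * N), vonMangoldt n * discSum I d n =
      ∑ q ∈ Ioc N (4 * N) with q.Prime, log q * discSum I d q +
        ∑ n ∈ Ioc N (4 * N) with ¬ n.Prime, vonMangoldt n * discSum I d n := by
    rw [← sum_filter_add_sum_filter_not _ (fun q : ℕ => q.Prime)]
    congr 1
    refine sum_congr rfl fun q hq => ?_
    rw [ArithmeticFunction.vonMangoldt_apply_prime (mem_filter.1 hq).2]
  have hrest : |∑ n ∈ Ioc N (4 * N) with ¬ n.Prime, vonMangoldt n * discSum I d n| ≤
      8 * #I * (√N * log (4 * N)) := by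
    have hψ := Chebyshev.psi_sub_theta_le (x := ((4 * N : ℕ) : ℝ)) (by push_cast; linarith)
    rw [Chebyshev.psi_sub_theta_eq_sum_not_prime, Nat.floor_natCast] at hψ
    calc _ ≤ ∑ n ∈ Ioc N (4 * N) with ¬ n.Prime, |vonMangoldt n * discSum I d n| :=
          abs_sum_le_sum_abs _ _
      _ ≤ ∑ n ∈ Ioc N (4 * N) with ¬ n.Prime, vonMangoldt n * (2 * #I) := by
          refine sum_le_sum fun n _ => ?_
          rw [abs_mul, abs_of_nonneg ArithmeticFunction.vonMangoldt_nonneg]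
          exact mul_le_mul_of_nonneg_left (abs_discSum_le (fun i hi => (hd i hi).1) n)
            ArithmeticFunction.vonMangoldt_nonneg
      _ = (∑ n ∈ Ioc N (4 * N) with ¬ n.Prime, vonMangoldt n) * (2 * #I) := by rw [sum_mul]
      _ ≤ (∑ n ∈ Ioc 0 (4 * N) with ¬ n.Prime, vonMangoldt n) * (2 * #I) := by
          refine mul_le_mul_of_nonneg_right ?_ (by positivity)
          refine sum_le_sum_of_subset_of_nonneg
            (filter_subset_filter _ (Ioc_subset_Ioc_left (Nat.zero_le _)))
            fun n _ _ => ArithmeticFunction.vonMangoldt_nonneg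
      _ ≤ (2 * √((4 * N : ℕ) : ℝ) * log ((4 * N : ℕ) : ℝ)) * (2 * #I) :=
          mul_le_mul_of_nonneg_right hψ (by positivity)
      _ = 8 * #I * (√N * log (4 * N)) := by
          push_cast
          rw [sqrt_mul (by norm_num), show √(4 : ℝ) = 2 by
            rw [show (4 : ℝ) = 2 ^ 2 by norm_num]; exact sqrt_sq (by norm_num)]
          ring
  rw [abs_le] at h1 h4 hrest ⊢
  constructor <;> nlinarith

end PrimeBlock

section CommonFactor

variable {R : Finset ℕ} {a : ℕ}

lemma sum_inv_pred_sq_le (ha : 1 ≤ a) (hR : ∀ r ∈ R, r.Prime ∧ a < r) {σ : ℝ}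
    (hσ : ∑ r ∈ R, 1 / (r.totient : ℝ) = σ) :
    ∑ r ∈ R, (1 / (r.totient : ℝ)) ^ 2 ≤ σ / a := by
  rw [← hσ, sum_div]
  refine sum_le_sum fun r hr => ?_
  have h1 : a ≤ r.totient := by
    rw [Nat.totient_prime (hR r hr).1]
    have := (hR r hr).2
    omega
  have h2 : (a : ℝ) ≤ r.totient := by exact_mod_cast h1
  have h3 : (1 : ℝ) ≤ a := by exact_mod_cast ha
  rw [sq, div_eq_mul_one_div _ (a : ℝ)]
  refine mul_le_mul_of_nonneg_left ?_ (by positivity)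
  exact one_div_le_one_div_of_le (by linarith) h2

lemma commonFactorSum_primes_le (ha : 1 ≤ a) (hR : ∀ r ∈ R, r.Prime ∧ a < r)
    (hσ : ∑ r ∈ R, 1 / (r.totient : ℝ) ≤ 1) :
    commonFactorSum R (fun r => r) ≤ 4 / a := by
  have h0 : (0 : ℝ) < a := by exact_mod_cast ha
  calc commonFactorSum R (fun r => r) ≤ ∑ r ∈ R, (1 / (r.totient : ℝ)) ^ 2 := by
        rw [commonFactorSum]
        refine sum_le_sum fun r hr => ?_
        calc _ ≤ ∑ s ∈ R, if s = r then (1 / (r.totient : ℝ)) ^ 2 else 0 := by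
              refine sum_le_sum fun s hs => ?_
              by_cases h : s = r
              · subst h
                rw [if_pos rfl]
                split_ifs
                · positivity
                · apply le_of_eq; ring
              · rw [if_neg h, if_pos ((Nat.coprime_primes (hR r hr).1 (hR s hs).1).2 (Ne.symm h))]
          _ = _ := by rw [sum_ite_eq' R r, if_pos hr]
    _ ≤ 1 / a := (sum_inv_pred_sq_le ha hR rfl).trans (by gcongr)
    _ ≤ 4 / a := by gcongr; norm_num

lemma commonFactorSum_offDiag_le (ha : 1 ≤ a) (hR : ∀ r ∈ R, r.Prime ∧ a < r)
    (hσ : ∑ r ∈ R, 1 / (r.totient : ℝ) ≤ 1) :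
    commonFactorSum R.offDiag (fun i => i.1 * i.2) ≤ 4 / a := by
  have h0 : (0 : ℝ) < a := by exact_mod_cast ha
  set f : ℕ → ℝ := fun r => 1 / (r.totient : ℝ) with hf
  have hf0 : ∀ r, 0 ≤ f r := fun r => by positivity
  set σ := ∑ r ∈ R, f r with hσd
  have hσ0 : 0 ≤ σ := sum_nonneg fun r _ => hf0 r
  set g : ℕ → ℕ → ℝ := fun r s => if r = s then f r * f s else 0 with hg
  have hg0 : ∀ r s, 0 ≤ g r s := fun r s => by
    simp only [hg]; split_ifs; exacts [mul_nonneg (hf0 _) (hf0 _), le_rfl]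
  have hgs : ∑ r ∈ R, ∑ s ∈ R, g r s ≤ 1 / a := by
    refine le_trans (le_of_eq ?_) ((sum_inv_pred_sq_le ha hR rfl).trans
      (show σ / a ≤ 1 / a by gcongr))
    refine sum_congr rfl fun r hr => ?_
    simp only [hg]
    rw [sum_ite_eq R r, if_pos hr]
    ring
  have hterm : ∀ i ∈ R.offDiag, ∀ j ∈ R.offDiag,
      (if (i.1 * i.2).Coprime (j.1 * j.2) then (0 : ℝ)
        else 1 / (((i.1 * i.2).totient : ℝ) * ((j.1 * j.2).totient : ℝ))) ≤
      g i.1 j.1 * (f i.2 * f j.2) + g i.1 j.2 * (f i.2 * f j.1) +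
        g i.2 j.1 * (f i.1 * f j.2) + g i.2 j.2 * (f i.1 * f j.1) := by
    rintro ⟨r, s⟩ hi ⟨t, u⟩ hj
    obtain ⟨hr, hs, hrs⟩ := mem_offDiag.1 hi
    obtain ⟨ht, hu, htu⟩ := mem_offDiag.1 hj
    simp only at *
    have hn : ∀ x y z w, 0 ≤ g x y * (f z * f w) := fun x y z w =>
      mul_nonneg (hg0 _ _) (mul_nonneg (hf0 _) (hf0 _))
    have n1 := hn r t s u
    have n2 := hn r u s t
    have n3 := hn s t r u
    have n4 := hn s u r t
    split_ifs with h
    · linarith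
    · have hc : ∀ {x y : ℕ}, x ∈ R → y ∈ R → x ≠ y → x.Coprime y := fun hx hy hxy =>
        (Nat.coprime_primes (hR _ hx).1 (hR _ hy).1).2 hxy
      have hv : 1 / (((r * s).totient : ℝ) * ((t * u).totient : ℝ)) =
          f r * f s * (f t * f u) := by
        rw [Nat.totient_mul (hc hr hs hrs), Nat.totient_mul (hc ht hu htu)]
        simp only [hf]
        push_cast
        simp only [one_div, mul_inv]
      rw [hv]
      by_cases h1 : r = t
      · have e : g r t * (f s * f u) = f r * f s * (f t * f u) := by
          simp only [hg]; rw [if_pos h1]; ring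
        linarith
      by_cases h2 : r = u
      · have e : g r u * (f s * f t) = f r * f s * (f t * f u) := by
          simp only [hg]; rw [if_pos h2]; ring
        linarith
      by_cases h3 : s = t
      · have e : g s t * (f r * f u) = f r * f s * (f t * f u) := by
          simp only [hg]; rw [if_pos h3]; ring
        linarith
      by_cases h4 : s = u
      · have e : g s u * (f r * f t) = f r * f s * (f t * f u) := by
          simp only [hg]; rw [if_pos h4]; ring
        linarith
      exact absurd (((hc hr ht h1).mul_right (hc hr hu h2)).mul_left
        ((hc hs ht h3).mul_right (hc hs hu h4))) h
  have hexp : ∀ F : ℕ × ℕ → ℕ × ℕ → ℝ, (∀ i j, 0 ≤ F i j) →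
      ∑ i ∈ R.offDiag, ∑ j ∈ R.offDiag, F i j ≤ ∑ i ∈ R ×ˢ R, ∑ j ∈ R ×ˢ R, F i j := by
    intro F hF
    have hsub : R.offDiag ⊆ R ×ˢ R := fun i hi => by
      obtain ⟨h1, h2, _⟩ := mem_offDiag.1 hi
      exact mem_product.2 ⟨h1, h2⟩
    refine (sum_le_sum fun i _ => sum_le_sum_of_subset_of_nonneg hsub fun j _ _ => hF i j).trans ?_
    exact sum_le_sum_of_subset_of_nonneg hsub fun i _ _ => sum_nonneg fun j _ => hF i j
  have hbase : (∑ r ∈ R, ∑ s ∈ R, g r s) * (σ * σ) ≤ 1 / a := by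
    calc _ ≤ 1 / (a : ℝ) * (1 * 1) := by gcongr
      _ = 1 / a := by ring
  rw [commonFactorSum]
  refine (sum_le_sum fun i hi => sum_le_sum fun j hj => hterm i hi j hj).trans ?_
  refine (hexp _ fun i j => ?_).trans ?_
  · have hn : ∀ x y z w, 0 ≤ g x y * (f z * f w) := fun x y z w =>
      mul_nonneg (hg0 _ _) (mul_nonneg (hf0 _) (hf0 _))
    have n1 := hn i.1 j.1 i.2 j.2
    have n2 := hn i.1 j.2 i.2 j.1
    have n3 := hn i.2 j.1 i.1 j.2
    have n4 := hn i.2 j.2 i.1 j.1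
    linarith
  simp only [sum_add_distrib, sum_product]
  have hfac : (∑ r ∈ R, ∑ s ∈ R, g r s) * (σ * σ) =
      ∑ r ∈ R, ∑ s ∈ R, ∑ t ∈ R, ∑ u ∈ R, g r t * (f s * f u) := by
    simp only [← mul_sum, ← sum_mul, hσd]
  have e2 : ∑ r ∈ R, ∑ s ∈ R, ∑ t ∈ R, ∑ u ∈ R, g r u * (f s * f t) =
      ∑ r ∈ R, ∑ s ∈ R, ∑ t ∈ R, ∑ u ∈ R, g r t * (f s * f u) :=
    sum_congr rfl fun r _ => sum_congr rfl fun s _ => sum_comm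
  have e3 : ∑ r ∈ R, ∑ s ∈ R, ∑ t ∈ R, ∑ u ∈ R, g s t * (f r * f u) =
      ∑ r ∈ R, ∑ s ∈ R, ∑ t ∈ R, ∑ u ∈ R, g r t * (f s * f u) := sum_comm
  have e4 : ∑ r ∈ R, ∑ s ∈ R, ∑ t ∈ R, ∑ u ∈ R, g s u * (f r * f t) =
      ∑ r ∈ R, ∑ s ∈ R, ∑ t ∈ R, ∑ u ∈ R, g r t * (f s * f u) := by
    rw [sum_comm, ← e2]
  rw [e2, e3, e4, ← hfac]
  calc _ ≤ 1 / (a : ℝ) + 1 / a + 1 / a + 1 / a := by gcongr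
    _ = 4 / a := by ring

end CommonFactor

end

/-- The error made when counting primes in `(N, 4N]` congruent to `1` modulo some prime in
`(a, b]`. -/
noncomputable def blockError (a b U N : ℕ) : ℝ :=
  16 * N * (1 + log (4 * N)) ^ 4 * √(4 * (b : ℝ) ^ 4 / U + 64 / a) +
    24 * b ^ 2 * U ^ 2 * (1 + log (4 * N)) + 16 * b ^ 2 * (√N * log (4 * N))

lemma disc_natCast_of_coprime {d q : ℕ} (hq : 1 ≤ q) (h : q.Coprime d) :
    disc d (q : ZMod d) = (if d ∣ q - 1 then 1 else 0) - 1 / (d.totient : ℝ) := by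
  have h1 : (q : ZMod d) = 1 ↔ d ∣ q - 1 := by
    rw [← ZMod.natCast_eq_zero_iff, Nat.cast_sub hq, Nat.cast_one, sub_eq_zero]
  have h2 : unitMean d (q : ZMod d) = 1 / (d.totient : ℝ) := by
    rw [unitMean, if_pos ((ZMod.isUnit_iff_coprime q d).2 h)]
  rw [disc, h2]
  by_cases h : d ∣ q - 1
  · rw [if_pos h, if_pos (h1.2 h)]
  · rw [if_neg h, if_neg fun e => h (h1.1 e)]

theorem sum_log_primes_ge {R : Finset ℕ} {a b U N : ℕ} (ha : 1 ≤ a)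
    (hR : ∀ r ∈ R, r.Prime ∧ a < r ∧ r ≤ b) (hb : b ^ 2 ≤ U) (hU : 1 ≤ U) (hUN : U ≤ N)
    (hs : ∑ r ∈ R, 1 / (r : ℝ) ≤ 1 / 2) :
    (∑ r ∈ R, 1 / (r : ℝ)) / 2 * (∑ q ∈ Ioc N (4 * N) with q.Prime, log q) -
        blockError a b U N ≤
      ∑ q ∈ Ioc N (4 * N) with q.Prime ∧ ∃ r ∈ R, r ∣ q - 1, log q := by
  have h0a : (0 : ℝ) < a := by exact_mod_cast ha
  have h0U : (0 : ℝ) < U := by exact_mod_cast hU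
  have hR' : ∀ r ∈ R, r.Prime ∧ a < r := fun r hr => ⟨(hR r hr).1, (hR r hr).2.1⟩
  have hφ : ∀ r ∈ R, 1 / (r : ℝ) ≤ 1 / (r.totient : ℝ) ∧ 1 / (r.totient : ℝ) ≤ 2 * (1 / (r : ℝ)) := by
    intro r hr
    have h2 := (hR r hr).1.two_le
    rw [Nat.totient_prime (hR r hr).1, Nat.cast_sub (by omega), Nat.cast_one]
    have h2' : (2 : ℝ) ≤ r := by exact_mod_cast h2
    constructor
    · exact one_div_le_one_div_of_le (by linarith) (by linarith)
    · rw [mul_one_div, div_le_div_iff₀ (by linarith) (by linarith)]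
      linarith
  set s := ∑ r ∈ R, 1 / (r : ℝ) with hsd
  set σ := ∑ r ∈ R, 1 / (r.totient : ℝ) with hσd
  have hs0 : 0 ≤ s := sum_nonneg fun r _ => by positivity
  have hsσ : s ≤ σ := sum_le_sum fun r hr => (hφ r hr).1
  have hσ1 : σ ≤ 1 := by
    have : σ ≤ ∑ r ∈ R, 2 * (1 / (r : ℝ)) := sum_le_sum fun r hr => (hφ r hr).2
    rw [← mul_sum] at this
    linarith
  set P := {q ∈ Ioc N (4 * N) | q.Prime} with hP
  have hcardR : #R ≤ b := by
    have : R ⊆ Icc 1 b := fun r hr => mem_Icc.2 ⟨(hR r hr).1.one_le, (hR r hr).2.2⟩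
    simpa using card_le_card this
  have hcardR2 : #R ≤ b ^ 2 := hcardR.trans (Nat.le_self_pow (by norm_num) b)
  have hcardO : #R.offDiag ≤ b ^ 2 := by
    rw [offDiag_card, sq]
    exact (Nat.sub_le _ _).trans (Nat.mul_le_mul hcardR hcardR)
  have hd1 : ∀ r ∈ R, r ≠ 0 ∧ r ≤ U := fun r hr =>
    ⟨(hR r hr).1.ne_zero, (hR r hr).2.2.trans ((Nat.le_self_pow (by norm_num) b).trans hb)⟩
  have hd2 : ∀ i ∈ R.offDiag, i.1 * i.2 ≠ 0 ∧ i.1 * i.2 ≤ U := fun i hi => by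
    obtain ⟨h1, h2, _⟩ := mem_offDiag.1 hi
    refine ⟨mul_ne_zero (hd1 _ h1).1 (hd1 _ h2).1, le_trans ?_ hb⟩
    rw [sq]
    exact Nat.mul_le_mul (hR _ h1).2.2 (hR _ h2).2.2
  have hlN : 0 ≤ log (4 * (N : ℝ)) := by
    have := log_natCast_nonneg (4 * N)
    push_cast at this
    exact this
  have hgen : ∀ {c : ℕ} {η : ℝ}, c ≤ b ^ 2 → η ≤ 4 / a →
      8 * N * (1 + log (4 * N)) ^ 4 * √(4 * (c : ℝ) ^ 2 / U + 16 * η) +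
        12 * c * U ^ 2 * (1 + log (4 * N)) + 8 * c * (√N * log (4 * N)) ≤
      blockError a b U N / 2 := by
    intro c η hc hη
    have hc' : (c : ℝ) ≤ (b : ℝ) ^ 2 := by exact_mod_cast hc
    calc _ ≤ 8 * N * (1 + log (4 * N)) ^ 4 * √(4 * ((b : ℝ) ^ 2) ^ 2 / U + 16 * (4 / a)) +
        12 * (b : ℝ) ^ 2 * U ^ 2 * (1 + log (4 * N)) + 8 * (b : ℝ) ^ 2 * (√N * log (4 * N)) := by
          gcongr
      _ = blockError a b U N / 2 := by
          rw [blockError, show 4 * ((b : ℝ) ^ 2) ^ 2 / U + 16 * (4 / a) = 4 * (b : ℝ) ^ 4 / U + 64 / a by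
            ring]
          ring
  have hD1 := (abs_sum_prime_log_mul_discSum_le hU hUN hd1).trans
    (hgen hcardR2 (commonFactorSum_primes_le ha hR' hσ1))
  have hD2 := (abs_sum_prime_log_mul_discSum_le hU hUN hd2).trans
    (hgen hcardO (commonFactorSum_offDiag_le ha hR' hσ1))
  rw [← hP] at hD1 hD2
  have hpoint : ∀ q ∈ P, s / 2 + discSum R (fun r => r) q -
      discSum R.offDiag (fun i => i.1 * i.2) q / 2 ≤ if ∃ r ∈ R, r ∣ q - 1 then 1 else 0 := by
    intro q hq
    obtain ⟨hq1, hqp⟩ := mem_filter.1 hq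
    have hqN := (mem_Ioc.1 hq1).1
    have hco : ∀ r ∈ R, q.Coprime r := fun r hr => by
      refine (Nat.coprime_primes hqp (hR r hr).1).2 fun e => ?_
      have := (hd1 r hr).2
      omega
    set X := {r ∈ R | r ∣ q - 1} with hX
    have e1 : discSum R (fun r => r) q = #X - σ := by
      rw [discSum, hσd, hX, card_filter, Nat.cast_sum, ← sum_sub_distrib]
      refine sum_congr rfl fun r hr => ?_
      rw [disc_natCast_of_coprime hqp.one_le (hco r hr)]
      push_cast
      rfl
    have hXo : {i ∈ R.offDiag | i.1 * i.2 ∣ q - 1} = X.offDiag := by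
      ext ⟨r, t⟩
      simp only [mem_filter, mem_offDiag, hX]
      constructor
      · rintro ⟨⟨h1, h2, h3⟩, h4⟩
        exact ⟨⟨h1, (Dvd.intro _ rfl).trans h4⟩, ⟨h2, (Dvd.intro_left _ rfl).trans h4⟩, h3⟩
      · rintro ⟨⟨h1, h1'⟩, ⟨h2, h2'⟩, h3⟩
        exact ⟨⟨h1, h2, h3⟩, ((Nat.coprime_primes (hR r h1).1 (hR t h2).1).2 h3).mul_dvd_of_dvd_of_dvd
          h1' h2'⟩
    have e2 : (#X : ℝ) * #X - #X - σ ^ 2 ≤ discSum R.offDiag (fun i => i.1 * i.2) q := by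
      have h1 : discSum R.offDiag (fun i => i.1 * i.2) q = #X.offDiag -
          ∑ i ∈ R.offDiag, 1 / (((i.1 * i.2).totient : ℕ) : ℝ) := by
        rw [discSum, ← hXo, card_filter, Nat.cast_sum, ← sum_sub_distrib]
        refine sum_congr rfl fun i hi => ?_
        obtain ⟨h1, h2, _⟩ := mem_offDiag.1 hi
        rw [disc_natCast_of_coprime hqp.one_le ((hco _ h1).mul_right (hco _ h2))]
        push_cast
        rfl
      have h2 : ∑ i ∈ R.offDiag, 1 / (((i.1 * i.2).totient : ℕ) : ℝ) ≤ σ ^ 2 := by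
        rw [sq, hσd, sum_mul_sum, ← sum_product']
        calc _ = ∑ i ∈ R.offDiag, 1 / (i.1.totient : ℝ) * (1 / (i.2.totient : ℝ)) := by
              refine sum_congr rfl fun i hi => ?_
              obtain ⟨h1, h2, h3⟩ := mem_offDiag.1 hi
              rw [Nat.totient_mul ((Nat.coprime_primes (hR _ h1).1 (hR _ h2).1).2 h3)]
              push_cast
              rw [one_div_mul_one_div]
          _ ≤ _ := sum_le_sum_of_subset_of_nonneg (fun i hi => by
              obtain ⟨h1, h2, _⟩ := mem_offDiag.1 hi
              exact mem_product.2 ⟨h1, h2⟩) fun i _ _ => by positivity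
      rw [h1, offDiag_card, Nat.cast_sub (Nat.le_mul_self _)]
      push_cast
      linarith
    have e3 : ((if ∃ r ∈ R, r ∣ q - 1 then 1 else 0 : ℕ) : ℝ) = if 1 ≤ #X then 1 else 0 := by
      have : (∃ r ∈ R, r ∣ q - 1) ↔ 1 ≤ #X := by
        rw [Nat.one_le_iff_ne_zero, Ne, card_eq_zero, ← Ne, ← nonempty_iff_ne_empty,
          filter_nonempty_iff]
      simp [this]
    have e4 : (#X : ℝ) - (#X * #X - #X) / 2 ≤ if 1 ≤ #X then 1 else 0 := by
      generalize #X = m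
      rcases m with _ | _ | m
      · simp
      · simp
      · rw [if_pos (by omega)]
        push_cast
        have : (0 : ℝ) ≤ m := Nat.cast_nonneg m
        nlinarith
    push_cast at e3
    rw [e3, e1]
    refine le_trans ?_ e4
    nlinarith
  have hsum := sum_le_sum fun q hq => mul_le_mul_of_nonneg_left (hpoint q hq)
    (log_natCast_nonneg q)
  have hright : ∑ q ∈ P, log q * (if ∃ r ∈ R, r ∣ q - 1 then (1 : ℝ) else 0) =
      ∑ q ∈ Ioc N (4 * N) with q.Prime ∧ ∃ r ∈ R, r ∣ q - 1, log q := by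
    rw [← filter_filter, ← hP]
    refine Eq.trans ?_ (sum_filter (s := P) _ _).symm
    simp only [mul_ite, mul_one, mul_zero]
  have hleft : ∑ q ∈ P, log q * (s / 2 + discSum R (fun r => r) q -
      discSum R.offDiag (fun i => i.1 * i.2) q / 2) = s / 2 * ∑ q ∈ P, log (q : ℝ) +
        ∑ q ∈ P, log q * discSum R (fun r => r) q -
        (∑ q ∈ P, log q * discSum R.offDiag (fun i => i.1 * i.2) q) / 2 := by
    clear_value s
    rw [mul_sum, sum_div _ _ (2 : ℝ), ← sum_add_distrib, ← sum_sub_distrib]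
    exact sum_congr rfl fun q _ => by ring
  rw [hright, hleft] at hsum
  rw [abs_le] at hD1 hD2
  have hB : 0 ≤ blockError a b U N := by rw [blockError]; positivity
  linarith [hD1.1, hD2.2]

lemma exists_pow_mul_exp_neg_le {K ε : ℝ} (hε : 0 < ε) :
    ∃ v₀ : ℝ, ∀ v : ℝ, v₀ ≤ v → K * v ^ 20 * exp (-(v / 2)) ≤ ε := by
  have h1 := (tendsto_pow_mul_exp_neg_atTop_nhds_zero 20).comp
    (Filter.tendsto_id.atTop_div_const (show (0 : ℝ) < 2 by norm_num))
  have h2 := h1.const_mul (K * 2 ^ 20)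
  rw [mul_zero] at h2
  obtain ⟨v₀, h⟩ := Filter.eventually_atTop.1 (h2.eventually_le_const hε)
  refine ⟨v₀, fun v hv => le_trans (le_of_eq ?_) (h v hv)⟩
  simp only [Function.comp, id, div_pow]
  ring

lemma block_estimates {v : ℝ} (hv : 5 ≤ v) {N : ℕ} (h1 : exp (v ^ 4) ≤ N)
    (h2 : 4 * (N : ℝ) ≤ exp (100 * v ^ 4)) :
    √(N : ℝ) ≤ N * exp (-(v ^ 4 / 2)) ∧ 1 ≤ √(N : ℝ) ∧ 1 + log (4 * N) ≤ 101 * v ^ 4 ∧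
      2 * v ^ 2 - v ^ 4 / 2 ≤ -(v / 2) ∧ 4 * v ^ 2 - v ^ 4 / 4 ≤ -v := by
  have hN0 : (0 : ℝ) < N := (exp_pos _).trans_le h1
  have hv4 : 25 * v ^ 2 ≤ v ^ 4 := by
    calc 25 * v ^ 2 ≤ v ^ 2 * v ^ 2 := by gcongr; nlinarith
      _ = v ^ 4 := by ring
  have hs : exp (v ^ 4 / 2) ≤ √(N : ℝ) := by
    apply le_sqrt_of_sq_le
    rw [← exp_nat_mul]
    refine le_trans (le_of_eq ?_) h1
    congr 1; push_cast; ring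
  refine ⟨?_, ?_, ?_, by nlinarith, by nlinarith⟩
  · have h3 : √(N : ℝ) * exp (v ^ 4 / 2) ≤ N := by
      calc _ ≤ √(N : ℝ) * √(N : ℝ) := by gcongr
        _ = N := mul_self_sqrt hN0.le
    rw [exp_neg, ← div_eq_mul_inv, le_div_iff₀ (exp_pos _)]
    exact h3
  · exact (one_le_exp (by positivity)).trans hs
  · have : log (4 * (N : ℝ)) ≤ 100 * v ^ 4 := by
      rw [log_le_iff_le_exp (by linarith)]; exact h2
    nlinarith

lemma exists_blockError_le {ε : ℝ} (hε : 0 < ε) :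
    ∃ v₀ : ℝ, ∀ v : ℝ, v₀ ≤ v → ∀ N : ℕ, exp (v ^ 4) ≤ N → 4 * (N : ℝ) ≤ exp (100 * v ^ 4) →
      blockError ⌊exp v⌋₊ ⌊exp (v ^ 2)⌋₊ ⌊exp (v ^ 4 / 4)⌋₊ N ≤ ε * N / v ^ 4 := by
  set K : ℝ := 16 * 101 ^ 4 * 12 + 24 * 101 + 1616 with hK
  obtain ⟨v₀, hv₀⟩ := exists_pow_mul_exp_neg_le (K := K) hε
  refine ⟨max v₀ 5, fun v hv N h1 h2 => ?_⟩
  have hv5 : 5 ≤ v := (le_max_right _ _).trans hv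
  obtain ⟨e1, e2, e3, e4, e5⟩ := block_estimates hv5 h1 h2
  have hN0 : (0 : ℝ) < N := (exp_pos _).trans_le h1
  have hfl : ∀ x : ℝ, 0 ≤ x → exp x / 2 ≤ (⌊exp x⌋₊ : ℝ) := fun x hx => by
    have h := Nat.lt_floor_add_one (exp x)
    have h' : (1 : ℝ) ≤ ⌊exp x⌋₊ := by
      exact_mod_cast Nat.one_le_floor_iff _ |>.2 (one_le_exp hx)
    linarith
  set a := ⌊exp v⌋₊
  set b := ⌊exp (v ^ 2)⌋₊
  set U := ⌊exp (v ^ 4 / 4)⌋₊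
  have ha := hfl v (by linarith)
  have hU := hfl (v ^ 4 / 4) (by positivity)
  have hb : (b : ℝ) ≤ exp (v ^ 2) := Nat.floor_le (exp_pos _).le
  have hU' : (U : ℝ) ≤ exp (v ^ 4 / 4) := Nat.floor_le (exp_pos _).le
  set E := exp (-(v / 2)) with hE
  have hE0 : 0 < E := exp_pos _
  have hEE : exp (-v) = E ^ 2 := by rw [hE, ← exp_nat_mul]; congr 1; push_cast; ring
  have hL0 : 0 ≤ log (4 * (N : ℝ)) := by
    have := log_natCast_nonneg (4 * N)
    push_cast at this
    exact this
  have hsq : √(4 * (b : ℝ) ^ 4 / U + 64 / a) ≤ 12 * E := by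
    rw [sqrt_le_left (by positivity), mul_pow]
    have h3 : 64 / (a : ℝ) ≤ 128 * E ^ 2 := by
      calc 64 / (a : ℝ) ≤ 64 / (exp v / 2) := by gcongr
        _ = 128 * E ^ 2 := by rw [← hEE, exp_neg]; field_simp; norm_num
    have h4 : 4 * (b : ℝ) ^ 4 / U ≤ 8 * E ^ 2 := by
      calc 4 * (b : ℝ) ^ 4 / U ≤ 4 * exp (v ^ 2) ^ 4 / (exp (v ^ 4 / 4) / 2) := by gcongr
        _ = 8 * exp (4 * v ^ 2 - v ^ 4 / 4) := by
            rw [exp_sub, ← exp_nat_mul]; push_cast; field_simp; norm_num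
        _ ≤ 8 * exp (-v) := by gcongr
        _ = 8 * E ^ 2 := by rw [hEE]
    nlinarith [sq_nonneg E]
  have hlog : log (4 * (N : ℝ)) ≤ 101 * v ^ 4 := by linarith
  have hmid : exp (v ^ 2) ^ 2 * (N * exp (-(v ^ 4 / 2))) ≤ N * E := by
    calc _ = N * exp (2 * v ^ 2 - v ^ 4 / 2) := by
          rw [sub_eq_add_neg, exp_add, ← exp_nat_mul]; push_cast; ring
      _ ≤ N * E := by rw [hE]; gcongr
  have hNexp : exp (v ^ 4 / 4) ^ 2 ≤ N * exp (-(v ^ 4 / 2)) := by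
    calc exp (v ^ 4 / 4) ^ 2 = exp (v ^ 4) * exp (-(v ^ 4 / 2)) := by
          rw [← exp_nat_mul, ← exp_add]; congr 1; push_cast; ring
      _ ≤ _ := by gcongr
  have hv416 : v ^ 4 ≤ v ^ 16 := pow_le_pow_right₀ (by linarith) (by norm_num)
  have hmain : blockError a b U N ≤ K * v ^ 16 * E * N := by
    rw [blockError]
    calc _ ≤ 16 * N * (101 * v ^ 4) ^ 4 * (12 * E) +
          24 * exp (v ^ 2) ^ 2 * (N * exp (-(v ^ 4 / 2))) * (101 * v ^ 4) +
          16 * exp (v ^ 2) ^ 2 * ((N * exp (-(v ^ 4 / 2))) * (101 * v ^ 4)) := by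
            have : (U : ℝ) ^ 2 ≤ N * exp (-(v ^ 4 / 2)) :=
              (pow_le_pow_left₀ (by positivity) hU' 2).trans hNexp
            gcongr
      _ = 16 * 101 ^ 4 * 12 * v ^ 16 * E * N + (exp (v ^ 2) ^ 2 * (N * exp (-(v ^ 4 / 2)))) *
          ((24 * 101 + 1616) * v ^ 4) := by ring
      _ ≤ 16 * 101 ^ 4 * 12 * v ^ 16 * E * N + (N * E) * ((24 * 101 + 1616) * v ^ 16) := by gcongr
      _ = K * v ^ 16 * E * N := by rw [hK]; ring
  rw [le_div_iff₀ (by positivity)]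
  have h5 := hv₀ v ((le_max_left _ _).trans hv)
  calc _ ≤ K * v ^ 16 * E * N * v ^ 4 := by gcongr
    _ = (K * v ^ 20 * E) * N := by ring
    _ ≤ ε * N := by gcongr

lemma exists_le_sum_log_primes :
    ∃ v₀ : ℝ, ∀ v : ℝ, v₀ ≤ v → ∀ N : ℕ, exp (v ^ 4) ≤ N → 4 * (N : ℝ) ≤ exp (100 * v ^ 4) →
      (N : ℝ) ≤ ∑ q ∈ Ioc N (4 * N) with q.Prime, log q := by
  obtain ⟨v₀, hv₀⟩ := exists_pow_mul_exp_neg_le (K := 505) (show (0 : ℝ) < 1 / 10 by norm_num)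
  refine ⟨max v₀ 5, fun v hv N h1 h2 => ?_⟩
  have hv5 : 5 ≤ v := (le_max_right _ _).trans hv
  obtain ⟨e1, e2, e3, e4, e5⟩ := block_estimates hv5 h1 h2
  have hN1 : (1 : ℝ) ≤ N := (one_le_exp (by positivity)).trans h1
  have hsplit : Chebyshev.theta ((4 * N : ℕ) : ℝ) = Chebyshev.theta (N : ℝ) +
      ∑ q ∈ Ioc N (4 * N) with q.Prime, log q := by
    rw [Chebyshev.theta, Chebyshev.theta, Nat.floor_natCast, Nat.floor_natCast, sum_filter,
      sum_filter, sum_filter, sum_Ioc_consecutive _ (Nat.zero_le _) (by omega)]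
  have h3 := Chebyshev.theta_ge (4 * N)
  have h4 := Chebyshev.theta_le_log4_mul_x (x := (N : ℝ)) (by linarith)
  push_cast at h3 hsplit
  have hlog4 : log 4 = 2 * log 2 := by
    rw [show (4 : ℝ) = 2 ^ 2 by norm_num, log_pow]; norm_num
  have hs4 : √(4 * (N : ℝ)) = 2 * √N := by
    rw [sqrt_mul (by norm_num), show √(4 : ℝ) = 2 by
      rw [show (4 : ℝ) = 2 ^ 2 by norm_num]; exact sqrt_sq (by norm_num)]
  have hlog1 : log (4 * (N : ℝ) + 1) ≤ 1 + log (4 * N) := by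
    have h5 : log (4 * (N : ℝ) + 1) ≤ log (exp 1 * (4 * N)) := by
      apply log_le_log (by linarith)
      nlinarith [add_one_le_exp (1 : ℝ)]
    rw [log_mul (exp_pos _).ne' (by linarith), log_exp] at h5
    exact h5
  have hsm : √(N : ℝ) * (101 * v ^ 4) * 5 ≤ 1 / 10 * N := by
    calc √(N : ℝ) * (101 * v ^ 4) * 5 ≤ N * exp (-(v ^ 4 / 2)) * (101 * v ^ 4) * 5 := by gcongr
      _ ≤ N * exp (-(v / 2)) * (101 * v ^ 20) * 5 := by
          gcongr
          · nlinarith [sq_nonneg v]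
          · linarith
          · norm_num
      _ = (505 * v ^ 20 * exp (-(v / 2))) * N := by ring
      _ ≤ _ := by gcongr; exact hv₀ v ((le_max_left _ _).trans hv)
  have hv4 : 0 ≤ 101 * v ^ 4 := by positivity
  have hb1 : log (4 * (N : ℝ) + 1) ≤ √(N : ℝ) * (101 * v ^ 4) := by nlinarith
  have hb2 : √(N : ℝ) * log (4 * N) ≤ √(N : ℝ) * (101 * v ^ 4) := by gcongr; linarith
  rw [hs4] at h3
  have := log_two_gt_d9
  nlinarith

lemma exists_subset_sum_le_half {ι : Type*} [DecidableEq ι] (R : Finset ι) {f : ι → ℝ}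
    (hf0 : ∀ i ∈ R, 0 ≤ f i) (hf : ∀ i ∈ R, f i ≤ 1 / 4) :
    ∃ T ⊆ R, ∑ i ∈ T, f i ≤ 1 / 2 ∧ min (∑ i ∈ R, f i) (1 / 4) ≤ ∑ i ∈ T, f i := by
  induction R using Finset.induction_on with
  | empty => exact ⟨∅, Subset.rfl, by simp, by simp⟩
  | insert a R ha ih =>
    obtain ⟨T, hT, h1, h2⟩ := ih (fun i hi => hf0 i (mem_insert_of_mem hi))
      fun i hi => hf i (mem_insert_of_mem hi)
    by_cases h : 1 / 4 ≤ ∑ i ∈ T, f i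
    · exact ⟨T, hT.trans (subset_insert _ _), h1, (min_le_right _ _).trans h⟩
    · push Not at h
      have haT : a ∉ T := fun e => ha (hT e)
      refine ⟨insert a T, insert_subset_insert _ hT, ?_, ?_⟩
      · rw [sum_insert haT]
        linarith [hf a (mem_insert_self _ _)]
      · rw [sum_insert haT, sum_insert ha]
        refine (min_le_left _ _).trans ?_
        rcases min_le_iff.1 h2 with h3 | h3 <;> linarith

lemma sum_range_sum_Ioc {a : ℕ → ℕ} (ha : Monotone a) (f : ℕ → ℝ) (m : ℕ) :
    ∑ i ∈ range m, ∑ n ∈ Ioc (a i) (a (i + 1)), f n = ∑ n ∈ Ioc (a 0) (a m), f n := by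
  induction m with
  | zero => simp
  | succ m ih =>
    rw [sum_range_succ, ih, sum_Ioc_consecutive _ (ha (Nat.zero_le _)) (ha (Nat.le_succ _))]

lemma sum_chainWindow_eq (p j : ℕ) {v : ℝ} (hv : 0 ≤ v) (m : ℕ) :
    ∑ i ∈ range m, chainWindow p j (100 ^ i * v) =
      open scoped Classical in
      ∑ q ∈ Ioc ⌊exp v⌋₊ ⌊exp (100 ^ m * v)⌋₊ with q ∈ chainSet p j, 1 / (q : ℝ) := by
  classical
  have hmono : Monotone fun i : ℕ => ⌊exp (100 ^ i * v)⌋₊ := fun i k h => by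
    refine Nat.floor_mono (exp_le_exp.2 ?_)
    gcongr
    norm_num
  have h := sum_range_sum_Ioc hmono (fun q => if q ∈ chainSet p j then 1 / (q : ℝ) else 0) m
  simp only [pow_zero, one_mul] at h
  rw [sum_filter, ← h]
  refine sum_congr rfl fun i _ => ?_
  rw [chainWindow, sum_filter, ← mul_assoc, ← pow_succ']

/-- Summing the lower bounds over the windows between `exp v` and `exp (v ^ 2)`. -/
lemma log_mul_le_sum_chainSet {p j : ℕ} {v c : ℝ} (hv : exp 10 ≤ v) (hc : 0 ≤ c)
    (h : ∀ l, v ≤ l → c * min 1 (log l ^ j / p) ≤ chainWindow p (j + 1) l) :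
    log v / 10 * (c * min 1 (log v ^ j / p)) ≤
      open scoped Classical in
      ∑ q ∈ Ioc ⌊exp v⌋₊ ⌊exp (v ^ 2)⌋₊ with q ∈ chainSet p (j + 1), 1 / (q : ℝ) := by
  classical
  have hv1 : 1 ≤ v := (one_le_exp (by norm_num)).trans hv
  have hv0 : 0 < v := by linarith
  have hlv : 10 ≤ log v := by rwa [le_log_iff_exp_le hv0]
  have hl100 : log 100 ≤ 5 := by
    rw [log_le_iff_le_exp (by norm_num)]
    have h1 := exp_one_gt_d9
    calc (100 : ℝ) ≤ 2.7 ^ 5 := by norm_num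
      _ ≤ exp 1 ^ 5 := by gcongr; linarith
      _ = exp 5 := by rw [← exp_nat_mul]; norm_num
  have hl100' : 0 < log (100 : ℝ) := log_pos (by norm_num)
  set m := ⌊log v / log 100⌋₊ with hm
  have hm1 : log v / 10 ≤ m := by
    have h1 := Nat.lt_floor_add_one (log v / log 100)
    have h2 : log v / 5 ≤ log v / log 100 := by gcongr
    rw [← hm] at h1
    linarith
  have hm2 : 100 ^ m * v ≤ v ^ 2 := by
    rw [sq]
    gcongr
    have h1 : (m : ℝ) ≤ log v / log 100 := Nat.floor_le (by positivity)
    rw [le_div_iff₀ hl100'] at h1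
    calc (100 : ℝ) ^ m = exp (m * log 100) := by rw [exp_nat_mul, exp_log (by norm_num)]
      _ ≤ exp (log v) := by gcongr
      _ = v := exp_log hv0
  calc log v / 10 * (c * min 1 (log v ^ j / p))
      ≤ m * (c * min 1 (log v ^ j / p)) := by gcongr
    _ = ∑ i ∈ range m, c * min 1 (log v ^ j / p) := by simp
    _ ≤ ∑ i ∈ range m, chainWindow p (j + 1) (100 ^ i * v) := by
        refine sum_le_sum fun i _ => ?_
        have h1 : v ≤ 100 ^ i * v := le_mul_of_one_le_left hv0.le (one_le_pow₀ (by norm_num))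
        refine le_trans ?_ (h _ h1)
        gcongr
    _ = _ := sum_chainWindow_eq p (j + 1) hv0.le m
    _ ≤ _ := by
        refine sum_le_sum_of_subset_of_nonneg (filter_subset_filter _ (Ioc_subset_Ioc_right ?_))
          fun q _ _ => by positivity
        exact Nat.floor_mono (exp_le_exp.2 hm2)

lemma le_sum_chainSet {p j : ℕ} {v c : ℝ} (hv : exp 10 ≤ v) (hc : 0 ≤ c)
    (h : ∀ l, v ≤ l → c * min 1 (log l ^ j / p) ≤ chainWindow p (j + 1) l) :
    c / 10 * min 1 (log v ^ (j + 1) / p) ≤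
      open scoped Classical in
      ∑ q ∈ Ioc ⌊exp v⌋₊ ⌊exp (v ^ 2)⌋₊ with q ∈ chainSet p (j + 1), 1 / (q : ℝ) := by
  refine le_trans ?_ (log_mul_le_sum_chainSet hv hc h)
  have hlv : 10 ≤ log v := by rwa [le_log_iff_exp_le ((exp_pos _).trans_le hv)]
  have h1 : min 1 (log v ^ (j + 1) / p) ≤ log v * min 1 (log v ^ j / p) := by
    rw [mul_min_of_nonneg _ _ (by linarith), pow_succ']
    exact min_le_min (by linarith) (le_of_eq (mul_div_assoc _ _ _))
  calc _ ≤ c / 10 * (log v * min 1 (log v ^ j / p)) := by gcongr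
    _ = _ := by ring

lemma sum_inv_block_ge {p j N : ℕ} {R : Finset ℕ} (hR : ∀ r ∈ R, r ∈ chainSet p j)
    {l s : ℝ} (hN : 1 ≤ N) (hl : 0 < l) (hNl : 4 * (N : ℝ) ≤ exp (100 * l))
    (h : s / 4 * N ≤ ∑ q ∈ Ioc N (4 * N) with q.Prime ∧ ∃ r ∈ R, r ∣ q - 1, log q) :
    s / (1600 * l) ≤ open scoped Classical in
      ∑ q ∈ Ioc N (4 * N), if q ∈ chainSet p (j + 1) then 1 / (q : ℝ) else 0 := by
  classical
  have hN1 : (1 : ℝ) ≤ N := by exact_mod_cast hN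
  have hlog : log (4 * (N : ℝ)) ≤ 100 * l := by
    rwa [log_le_iff_le_exp (by linarith)]
  have h1 : ∑ q ∈ Ioc N (4 * N) with q.Prime ∧ ∃ r ∈ R, r ∣ q - 1, log (q : ℝ) ≤
      (4 * N * (100 * l)) *
        ∑ q ∈ Ioc N (4 * N), if q ∈ chainSet p (j + 1) then 1 / (q : ℝ) else 0 := by
    rw [sum_filter, mul_sum]
    refine sum_le_sum fun q hq => ?_
    obtain ⟨hq1, hq2⟩ := mem_Ioc.1 hq
    have hq0 : (0 : ℝ) < q := by exact_mod_cast (Nat.zero_le _).trans_lt hq1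
    have hq4 : (q : ℝ) ≤ 4 * N := by exact_mod_cast hq2
    split_ifs with hc hd
    · rw [mul_one_div, le_div_iff₀ hq0, mul_comm]
      have hlq : log (q : ℝ) ≤ 100 * l := (log_le_log hq0 hq4).trans hlog
      have : 0 ≤ log (q : ℝ) := log_natCast_nonneg q
      gcongr
    · obtain ⟨hqp, r, hr, hrq⟩ := hc
      exact absurd ⟨hqp, r, hR r hr, hrq⟩ hd
    · positivity
    · simp
  have h2 := h.trans h1
  rw [div_le_iff₀ (by positivity)]
  have h3 : N * (s / 4) ≤ N * (400 * l *
      ∑ q ∈ Ioc N (4 * N), if q ∈ chainSet p (j + 1) then 1 / (q : ℝ) else 0) := by linarith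
  have h4 := le_of_mul_le_mul_left h3 (by linarith)
  linarith

/-- A set of reachable primes below `exp (v ^ 2)` produces a proportional set of primes reachable
in one more step inside the window attached to `v ^ 4`. -/
lemma exists_chainWindow_succ_ge {c : ℝ} (hc : 0 < c) : ∃ v₀ : ℝ, ∀ v : ℝ, v₀ ≤ v →
    ∀ (p j : ℕ) (R : Finset ℕ), (∀ r ∈ R, r.Prime ∧ r ∈ chainSet p j ∧
      ⌊exp v⌋₊ < r ∧ r ≤ ⌊exp (v ^ 2)⌋₊) → ∑ r ∈ R, 1 / (r : ℝ) ≤ 1 / 2 →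
      c / v ^ 4 ≤ ∑ r ∈ R, 1 / (r : ℝ) →
      (∑ r ∈ R, 1 / (r : ℝ)) / 3200 ≤ chainWindow p (j + 1) (v ^ 4) := by
  classical
  obtain ⟨v₁, h₁⟩ := exists_blockError_le (show 0 < c / 4 by positivity)
  obtain ⟨v₂, h₂⟩ := exists_le_sum_log_primes
  refine ⟨max (max v₁ v₂) 5, fun v hv p j R hR hs1 hs2 => ?_⟩
  have hv5 : 5 ≤ v := (le_max_right _ _).trans hv
  have hv1 : v₁ ≤ v := (le_max_left _ _).trans ((le_max_left _ _).trans hv)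
  have hv2 : v₂ ≤ v := (le_max_right _ _).trans ((le_max_left _ _).trans hv)
  set s := ∑ r ∈ R, 1 / (r : ℝ) with hs
  have hs0 : 0 ≤ s := sum_nonneg fun r _ => by positivity
  have hv25 : 25 ≤ v ^ 2 := by nlinarith
  have hv4 : 25 * v ^ 2 ≤ v ^ 4 := by
    calc 25 * v ^ 2 ≤ v ^ 2 * v ^ 2 := by gcongr
      _ = v ^ 4 := by ring
  have hl0 : 0 < v ^ 4 := by positivity
  have hblock : ∀ N : ℕ, exp (v ^ 4) ≤ N → 4 * (N : ℝ) ≤ exp (100 * v ^ 4) →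
      s / (1600 * v ^ 4) ≤
        ∑ q ∈ Ioc N (4 * N), if q ∈ chainSet p (j + 1) then 1 / (q : ℝ) else 0 := by
    intro N hN1 hN2
    have hN : (1 : ℝ) ≤ N := (one_le_exp hl0.le).trans hN1
    refine sum_inv_block_ge (fun r hr => (hR r hr).2.1) (by exact_mod_cast hN) hl0 hN2 ?_
    have hb : ⌊exp (v ^ 2)⌋₊ ^ 2 ≤ ⌊exp (v ^ 4 / 4)⌋₊ := by
      apply Nat.le_floor
      push_cast
      calc (⌊exp (v ^ 2)⌋₊ : ℝ) ^ 2 ≤ exp (v ^ 2) ^ 2 := by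
            gcongr; exact Nat.floor_le (exp_pos _).le
        _ = exp (2 * v ^ 2) := by rw [← exp_nat_mul]; norm_num
        _ ≤ exp (v ^ 4 / 4) := by gcongr; linarith
    have hUN : ⌊exp (v ^ 4 / 4)⌋₊ ≤ N := by
      have : (⌊exp (v ^ 4 / 4)⌋₊ : ℝ) ≤ N := by
        calc _ ≤ exp (v ^ 4 / 4) := Nat.floor_le (exp_pos _).le
          _ ≤ exp (v ^ 4) := by gcongr; linarith
          _ ≤ N := hN1
      exact_mod_cast this
    have hmain := sum_log_primes_ge (Nat.one_le_floor_iff _ |>.2 (one_le_exp (by linarith)))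
      (fun r hr => ⟨(hR r hr).1, (hR r hr).2.2⟩) hb
      (Nat.one_le_floor_iff _ |>.2 (one_le_exp (by positivity))) hUN hs1
    refine le_trans ?_ hmain
    have h3 := h₁ v hv1 N hN1 hN2
    have h4 := h₂ v hv2 N hN1 hN2
    have h5 : c / 4 * N / v ^ 4 ≤ s / 4 * N := by
      calc c / 4 * N / v ^ 4 = (c / v ^ 4) / 4 * N := by ring
        _ ≤ s / 4 * N := by gcongr
    have h6 : s / 2 * N ≤ s / 2 * ∑ q ∈ Ioc N (4 * N) with q.Prime, log (q : ℝ) := by gcongr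
    rw [← hs]
    linarith
  set N₀ := ⌈exp (v ^ 4)⌉₊ with hN₀
  have hN₀1 : exp (v ^ 4) ≤ N₀ := Nat.le_ceil _
  have hN₀2 : (N₀ : ℝ) ≤ exp (v ^ 4 + 1) := by
    have h1 := (Nat.ceil_lt_add_one (exp_pos (v ^ 4)).le).le
    have h2 : (1 : ℝ) ≤ exp (v ^ 4) := one_le_exp hl0.le
    rw [exp_add]
    nlinarith [add_one_le_exp (1 : ℝ)]
  set m := ⌊v ^ 4⌋₊ with hm
  have hm1 : v ^ 4 / 2 ≤ m := by
    have := Nat.lt_floor_add_one (v ^ 4)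
    rw [← hm] at this
    linarith
  have hm2 : (m : ℝ) ≤ v ^ 4 := Nat.floor_le hl0.le
  have h4e : ∀ i ≤ m, (4 : ℝ) ^ i * N₀ ≤ exp (3 * v ^ 4 + 1) := by
    intro i hi
    have h1 := exp_one_gt_d9
    have hi' : (i : ℝ) ≤ v ^ 4 := le_trans (by exact_mod_cast hi) hm2
    calc (4 : ℝ) ^ i * N₀ ≤ exp 2 ^ i * exp (v ^ 4 + 1) := by
          gcongr
          calc (4 : ℝ) ≤ 2.7 ^ 2 := by norm_num
            _ ≤ exp 1 ^ 2 := by gcongr; linarith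
            _ = exp 2 := by rw [← exp_nat_mul]; norm_num
      _ = exp (i * 2 + (v ^ 4 + 1)) := by
          rw [exp_add (i * 2 : ℝ), exp_nat_mul]
      _ ≤ _ := by rw [exp_le_exp]; linarith
  have hmono : Monotone fun i : ℕ => 4 ^ i * N₀ := fun i k h => by
    simp only
    gcongr
    norm_num
  rw [chainWindow, sum_filter]
  calc s / 3200 ≤ m * (s / (1600 * v ^ 4)) := by
        calc s / 3200 = v ^ 4 / 2 * (s / (1600 * v ^ 4)) := by field_simp; ring
          _ ≤ _ := by gcongr
    _ = ∑ i ∈ range m, s / (1600 * v ^ 4) := by simp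
    _ ≤ ∑ i ∈ range m, ∑ q ∈ Ioc (4 ^ i * N₀) (4 ^ (i + 1) * N₀),
          if q ∈ chainSet p (j + 1) then 1 / (q : ℝ) else 0 := by
        refine sum_le_sum fun i hi => ?_
        rw [show 4 ^ (i + 1) * N₀ = 4 * (4 ^ i * N₀) by ring]
        apply hblock
        · push_cast
          exact hN₀1.trans (le_mul_of_one_le_left (Nat.cast_nonneg _) (one_le_pow₀ (by norm_num)))
        · push_cast
          rw [← mul_assoc, ← pow_succ']
          refine (h4e (i + 1) (mem_range.1 hi)).trans (exp_le_exp.2 ?_)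
          linarith
    _ = ∑ q ∈ Ioc N₀ (4 ^ m * N₀), if q ∈ chainSet p (j + 1) then 1 / (q : ℝ) else 0 := by
        rw [sum_range_sum_Ioc hmono]
        simp
    _ ≤ _ := by
        refine sum_le_sum_of_subset_of_nonneg (Ioc_subset_Ioc ?_ ?_) fun q _ _ => by positivity
        · exact Nat.floor_le_ceil _
        · apply Nat.le_floor
          push_cast
          refine (h4e m le_rfl).trans (exp_le_exp.2 ?_)
          linarith

theorem chainBound_succ {j : ℕ} (h : ChainBound j) : ChainBound (j + 1) := by
  classical
  obtain ⟨c, hc, A, l₀, H⟩ := h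
  set c₁ := c / 10 / 4 ^ (j + 1) with hc₁
  have hc₁0 : 0 < c₁ := by positivity
  set c₂ := min c₁ (1 / 4) with hc₂
  have hc₂0 : 0 < c₂ := by rw [hc₂]; positivity
  obtain ⟨v₀, hv₀⟩ := exists_chainWindow_succ_ge hc₂0
  set V := max (max v₀ l₀) (exp 10) with hV
  have hV0 : 0 < V := (exp_pos _).trans_le (le_max_right _ _)
  refine ⟨c₂ / 3200, by positivity, 4 * (A + 1), V ^ 4, fun p hp l hl hpl => ?_⟩
  have hl0 : 0 < l := (by positivity : 0 < V ^ 4).trans_le hl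
  obtain ⟨v, hvpos, rfl⟩ : ∃ v : ℝ, 0 < v ∧ v ^ 4 = l := by
    refine ⟨√(√l), by positivity, ?_⟩
    rw [show 4 = 2 * 2 by norm_num, pow_mul, sq_sqrt (by positivity), sq_sqrt hl0.le]
  have hVv : V ≤ v := le_of_pow_le_pow_left₀ (by norm_num) hvpos.le hl
  have hv10 : exp 10 ≤ v := (le_max_right _ _).trans hVv
  have hvv₀ : v₀ ≤ v := (le_max_left _ _).trans ((le_max_left _ _).trans hVv)
  have hvl₀ : l₀ ≤ v := (le_max_right _ _).trans ((le_max_left _ _).trans hVv)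
  have hv11 : 11 ≤ v := by linarith [add_one_le_exp (10 : ℝ)]
  have hp1 : (1 : ℝ) ≤ p := by exact_mod_cast hp.one_le
  have hpA : (p : ℝ) ^ (A + 1) ≤ v := by
    rw [mul_comm, pow_mul] at hpl
    exact le_of_pow_le_pow_left₀ (by norm_num) hvpos.le hpl
  have hpv : (p : ℝ) ≤ v := (le_self_pow₀ hp1 (by omega)).trans hpA
  have hpA' : (p : ℝ) ^ A ≤ v := (pow_le_pow_right₀ hp1 (Nat.le_succ A)).trans hpA
  have hsum := le_sum_chainSet hv10 hc.le fun l hl => H p hp l (hvl₀.trans hl) (hpA'.trans hl)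
  set R₀ := {q ∈ Ioc ⌊exp v⌋₊ ⌊exp (v ^ 2)⌋₊ | q ∈ chainSet p (j + 1)} with hR₀
  have h4 : 4 ≤ ⌊exp v⌋₊ := by
    apply Nat.le_floor
    push_cast
    linarith [add_one_le_exp v]
  obtain ⟨R, hRR₀, hR1, hR2⟩ := exists_subset_sum_le_half R₀ (f := fun q => 1 / (q : ℝ))
    (fun q _ => by positivity) fun q hq => by
      have h1 := (mem_Ioc.1 (mem_filter.1 hq).1).1
      exact one_div_le_one_div_of_le (by norm_num) (by exact_mod_cast (h4.trans h1.le))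
  set t := min 1 (log (v ^ 4) ^ (j + 1) / p) with ht
  have hlv : 10 ≤ log v := by rwa [le_log_iff_exp_le hvpos]
  have ht1 : t ≤ 1 := min_le_left _ _
  have hlog4 : log (v ^ 4) = 4 * log v := by rw [log_pow]; norm_num
  have ht0 : 1 / v ^ 4 ≤ t := by
    refine le_min ?_ ?_
    · rw [div_le_one (by positivity)]; exact one_le_pow₀ (by linarith)
    · have h5 : (p : ℝ) ≤ v ^ 4 := hpv.trans (le_self_pow₀ (by linarith) (by norm_num))
      have h6 : 1 ≤ log (v ^ 4) ^ (j + 1) := one_le_pow₀ (by rw [hlog4]; linarith)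
      gcongr
  have htpos : 0 < t := lt_of_lt_of_le (by positivity) ht0
  have hs : c₂ * t ≤ ∑ r ∈ R, 1 / (r : ℝ) := by
    refine le_trans (le_min ?_ ?_) hR2
    · refine le_trans ?_ hsum
      calc c₂ * t ≤ c₁ * t := by gcongr; exact min_le_left _ _
        _ = c / 10 * (t / 4 ^ (j + 1)) := by rw [hc₁]; ring
        _ ≤ c / 10 * min 1 (log v ^ (j + 1) / p) := by
            gcongr
            refine le_min ?_ ?_
            · rw [div_le_one (by positivity)]
              exact ht1.trans (one_le_pow₀ (by norm_num))
            · rw [div_le_iff₀ (by positivity)]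
              refine (min_le_right _ _).trans (le_of_eq ?_)
              rw [hlog4, mul_pow]; ring
    · calc c₂ * t ≤ 1 / 4 * 1 := by gcongr; exact min_le_right _ _
        _ = 1 / 4 := by norm_num
  have hs' : c₂ / v ^ 4 ≤ ∑ r ∈ R, 1 / (r : ℝ) := by
    refine le_trans ?_ hs
    rw [div_eq_mul_one_div]
    gcongr
  have := hv₀ v hvv₀ p (j + 1) R (fun r hr => by
    have h1 := hRR₀ hr
    rw [hR₀, mem_filter, mem_Ioc] at h1
    exact ⟨prime_of_mem_chainSet hp h1.2, h1.2, h1.1⟩) hR1 hs'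
  linarith

theorem chainBound (j : ℕ) : ChainBound j := by
  induction j with
  | zero => exact chainBound_zero
  | succ j ih => exact chainBound_succ ih

open Filter in
lemma eventually_card_not_dvd_le (j : ℕ) {ε : ℝ} (hε : ε ≤ 1) :
    ∃ c > 0, ∀ᶠ y : ℝ in atTop, ∀ p : ℕ, p.Prime → (p : ℝ) ≤ y ^ ((j : ℝ) + 1 - ε) →
      (#{n ∈ Icc 1 ⌊exp (exp y)⌋₊ | ¬ p ∣ Nat.totient^[j + 1] n} : ℝ) ≤
        c * ⌊exp (exp y)⌋₊ / y ^ ε := by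
  classical
  obtain ⟨c, hc, A, l₀, H⟩ := chainBound j
  refine ⟨3 / (c / 20 / 2 ^ j), by positivity, ?_⟩
  have hhalf : Tendsto (fun y : ℝ => y / 2) atTop atTop :=
    tendsto_id.atTop_div_const (by norm_num)
  have hpow := ((tendsto_exp_div_pow_atTop (Nat.ceil ((j : ℝ) + 1 - ε) * A)).comp
    hhalf).eventually_ge_atTop (2 ^ (Nat.ceil ((j : ℝ) + 1 - ε) * A))
  filter_upwards [eventually_ge_atTop 20, hpow,
    (tendsto_exp_atTop.comp hhalf).eventually_ge_atTop l₀] with y hy hyA hyl p hp hpy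
  simp only [Function.comp] at hyA hyl
  have hy0 : 0 < y := by linarith
  have hp0 : (0 : ℝ) < p := by exact_mod_cast hp.pos
  set v := exp (y / 2) with hv
  have hvv : v ^ 2 = exp y := by rw [hv, ← exp_nat_mul]; congr 1; push_cast; ring
  have hlv : log v = y / 2 := log_exp _
  have hpA : (p : ℝ) ^ A ≤ v := by
    rw [le_div_iff₀ (by positivity), ← mul_pow, mul_div_cancel₀ _ (by norm_num)] at hyA
    refine le_trans ?_ hyA
    rw [pow_mul]
    gcongr
    rw [← rpow_natCast]
    exact hpy.trans (rpow_le_rpow_of_exponent_le (by linarith) (Nat.le_ceil _))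
  have hsum := log_mul_le_sum_chainSet (p := p) (j := j) (v := v) (c := c)
    (exp_le_exp.2 (by linarith)) hc.le
    fun l hl => H p hp l (hyl.trans hl) (hpA.trans hl)
  rw [hvv, hlv] at hsum
  set Q := {q ∈ Ioc ⌊exp v⌋₊ ⌊exp (exp y)⌋₊ | q ∈ chainSet p (j + 1)} with hQ
  have hcard := card_forall_not_dvd_mul_le ⌊exp (exp y)⌋₊ Q fun q hq => by
    have h1 := mem_filter.1 hq
    exact ⟨prime_of_mem_chainSet hp h1.2, (mem_Ioc.1 h1.1).2⟩
  have hS : c / 20 / 2 ^ j * y ^ ε ≤ ∑ q ∈ Q, 1 / (q : ℝ) := by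
    refine le_trans ?_ hsum
    have h1 : y ^ ε / 2 ^ j ≤ y * min 1 ((y / 2) ^ j / p) := by
      rw [mul_min_of_nonneg _ _ hy0.le]
      refine le_min ?_ ?_
      · rw [mul_one]
        calc y ^ ε / 2 ^ j ≤ y ^ ε := div_le_self (by positivity) (one_le_pow₀ (by norm_num))
          _ ≤ y ^ (1 : ℝ) := rpow_le_rpow_of_exponent_le (by linarith) hε
          _ = y := rpow_one y
      · rw [← mul_div_assoc, le_div_iff₀ hp0]
        calc y ^ ε / 2 ^ j * p ≤ y ^ ε / 2 ^ j * y ^ ((j : ℝ) + 1 - ε) := by gcongr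
          _ = y ^ (ε + ((j : ℝ) + 1 - ε)) / 2 ^ j := by rw [rpow_add hy0]; ring
          _ = y * (y / 2) ^ j := by
              rw [show ε + ((j : ℝ) + 1 - ε) = ((j + 1 : ℕ) : ℝ) by push_cast; ring, rpow_natCast]
              rw [div_pow]; ring
    calc c / 20 / 2 ^ j * y ^ ε = c / 20 * (y ^ ε / 2 ^ j) := by ring
      _ ≤ c / 20 * (y * min 1 ((y / 2) ^ j / p)) := by gcongr
      _ = _ := by ring
  have hsub : {n ∈ Icc 1 ⌊exp (exp y)⌋₊ | ¬ p ∣ Nat.totient^[j + 1] n} ⊆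
      {n ∈ Icc 1 ⌊exp (exp y)⌋₊ | ∀ q ∈ Q, ¬ q ∣ n} := by
    refine monotone_filter_right _ fun n _ hn q hq hqn => hn ?_
    exact dvd_iterate_totient (mem_filter.1 hq).2 hqn
  have h2 : (#{n ∈ Icc 1 ⌊exp (exp y)⌋₊ | ¬ p ∣ Nat.totient^[j + 1] n} : ℝ) *
      (c / 20 / 2 ^ j * y ^ ε) ≤ 3 * ⌊exp (exp y)⌋₊ := by
    refine le_trans ?_ hcard
    have h3 : (#{n ∈ Icc 1 ⌊exp (exp y)⌋₊ | ¬ p ∣ Nat.totient^[j + 1] n} : ℝ) ≤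
      #{n ∈ Icc 1 ⌊exp (exp y)⌋₊ | ∀ q ∈ Q, ¬ q ∣ n} := by exact_mod_cast card_le_card hsub
    gcongr
  rw [div_mul_eq_mul_div, div_div, le_div_iff₀ (by positivity)]
  exact h2

lemma exp_neg_le_one_sub {x : ℝ} (h0 : 0 ≤ x) (h : x ≤ 1 / 2) : exp (-(2 * x)) ≤ 1 - x := by
  rw [exp_neg, inv_le_iff_one_le_mul₀ (exp_pos _)]
  have := add_one_le_exp (2 * x)
  nlinarith

/-- The loss in the totient ratio of `m` compared with a number divisible by every prime up to `Z`
is controlled by the primes up to `Z` missing from `m`. -/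
lemma totient_le_mul_prod (m Z : ℕ) :
    (m.totient : ℝ) ≤ m * ((∏ p ∈ Ioc 0 Z with p.Prime, (1 - 1 / (p : ℝ))) *
      exp (2 * ∑ p ∈ Ioc 0 Z with p.Prime ∧ ¬ p ∣ m, 1 / (p : ℝ))) := by
  rcases Nat.eq_zero_or_pos m with rfl | hm
  · simp
  set P := {p ∈ Ioc 0 Z | p.Prime} with hP
  have hp2 : ∀ p : ℕ, p.Prime → 1 / (p : ℝ) ≤ 1 / 2 := fun p hp =>
    one_div_le_one_div_of_le (by norm_num) (by exact_mod_cast hp.two_le)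
  have hpos : ∀ p : ℕ, p.Prime → (0 : ℝ) ≤ 1 - 1 / p ∧ (1 : ℝ) - 1 / p ≤ 1 := fun p hp => by
    have := hp2 p hp
    have h0 : (0 : ℝ) ≤ 1 / p := by positivity
    constructor <;> linarith
  have h1 : (m.totient : ℝ) = m * ∏ p ∈ m.primeFactors, (1 - 1 / (p : ℝ)) := by
    have h := Nat.totient_eq_mul_prod_factors m
    have h' : ((m.totient : ℚ) : ℝ) = ((m * ∏ p ∈ m.primeFactors, (1 - (p : ℚ)⁻¹) : ℚ) : ℝ) := by
      rw [h]
    push_cast at h'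
    simpa only [one_div] using h'
  have h2 : ∏ p ∈ m.primeFactors, (1 - 1 / (p : ℝ)) ≤ ∏ p ∈ P with p ∣ m, (1 - 1 / (p : ℝ)) := by
    refine Finset.prod_le_prod_of_subset_of_le_one (fun p hp => ?_)
      (fun p hp => (hpos p (Nat.prime_of_mem_primeFactors hp)).1)
      (fun p hp _ => (hpos p (Nat.prime_of_mem_primeFactors hp)).2)
    have h := mem_filter.1 hp
    exact Nat.mem_primeFactors.2 ⟨(mem_filter.1 h.1).2, h.2, hm.ne'⟩
  have h3 : ∏ p ∈ P, (1 - 1 / (p : ℝ)) = (∏ p ∈ P with p ∣ m, (1 - 1 / (p : ℝ))) *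
      ∏ p ∈ P with ¬ p ∣ m, (1 - 1 / (p : ℝ)) := (prod_filter_mul_prod_filter_not P _ _).symm
  have h4 : exp (-(2 * ∑ p ∈ P with ¬ p ∣ m, 1 / (p : ℝ))) ≤
      ∏ p ∈ P with ¬ p ∣ m, (1 - 1 / (p : ℝ)) := by
    rw [mul_sum, ← sum_neg_distrib, exp_sum]
    refine prod_le_prod (fun _ _ => (exp_pos _).le) fun p hp => ?_
    exact exp_neg_le_one_sub (by positivity)
      (hp2 p (mem_filter.1 (mem_filter.1 hp).1).2)
  have hA0 : 0 ≤ ∏ p ∈ P with p ∣ m, (1 - 1 / (p : ℝ)) :=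
    prod_nonneg fun p hp => (hpos p (mem_filter.1 (mem_filter.1 hp).1).2).1
  rw [h1]
  refine mul_le_mul_of_nonneg_left (h2.trans ?_) (Nat.cast_nonneg m)
  rw [← filter_filter, ← hP, h3]
  have h5 : exp (-(2 * ∑ p ∈ P with ¬ p ∣ m, 1 / (p : ℝ))) *
      exp (2 * ∑ p ∈ P with ¬ p ∣ m, 1 / (p : ℝ)) = 1 := by rw [← exp_add]; simp
  calc _ = (∏ p ∈ P with p ∣ m, (1 - 1 / (p : ℝ))) *
        (exp (-(2 * ∑ p ∈ P with ¬ p ∣ m, 1 / (p : ℝ))) *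
          exp (2 * ∑ p ∈ P with ¬ p ∣ m, 1 / (p : ℝ))) := by rw [h5, mul_one]
    _ ≤ _ := by
      rw [← mul_assoc]
      gcongr

open Filter in
/-- Outside a negligible set, one application of `φ` to the `(j+1)`-st iterate divides it by
essentially at least `e^γ (j+1) log log log x`. -/
lemma eventually_card_lt_iterate_succ_le (j : ℕ) {κ : ℝ} (hκ : 1 < κ) (B : ℕ) {τ : ℝ}
    (hτ : 0 < τ) :
    ∀ᶠ y : ℝ in atTop,
      (#{n ∈ Icc 1 ⌊exp (exp y)⌋₊ |
          κ * (exp (-eulerMascheroniConstant) / ((j + 1) * log y)) * (Nat.totient^[j + 1] n : ℝ) <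
            (Nat.totient^[j + 2] n : ℝ)} : ℝ) ≤ τ * ⌊exp (exp y)⌋₊ / log y ^ B := by
  classical
  set a := log κ / 3 with ha
  have ha0 : 0 < a := div_pos (log_pos hκ) (by norm_num)
  have hκa : κ = exp a * exp a * exp a := by
    rw [← exp_add, ← exp_add, show a + a + a = log κ by rw [ha]; ring, exp_log (by linarith)]
  set ε := (1 - exp (-a)) / 2 with hε
  have hεa : exp (-a) = 1 - 2 * ε := by rw [hε]; ring
  have hε0 : 0 < ε := by
    have : exp (-a) < 1 := exp_zero ▸ exp_lt_exp.2 (neg_lt_zero.2 ha0)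
    rw [hε]; linarith
  have hε1 : ε < 1 / 2 := by
    have := exp_pos (-a)
    rw [hε]; linarith
  clear_value ε a
  set s : ℝ := (j : ℝ) + 1 - ε with hs
  have hs0 : 0 < s := by have : (0 : ℝ) ≤ j := Nat.cast_nonneg j; linarith
  clear_value s
  obtain ⟨c, hc, Hc⟩ := eventually_card_not_dvd_le j (ε := ε) (by linarith)
  have hZ : Tendsto (fun y : ℝ => ⌊y ^ s⌋₊) atTop atTop :=
    tendsto_nat_floor_atTop.comp (tendsto_rpow_atTop hs0)
  have hM := hZ.eventually (eventually_prod_one_sub_inv_le (one_lt_exp_iff.2 ha0))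
  have hgrow := ((tendsto_exp_mul_div_rpow_atTop ((B + 1 : ℕ) : ℝ) ε hε0).comp
    tendsto_log_atTop).eventually_ge_atTop (c * (s + 1) / (τ * (a / 2)))
  filter_upwards [Hc, hM, hgrow, tendsto_log_atTop.eventually_ge_atTop 1,
    tendsto_log_atTop.eventually_ge_atTop (log 2 / ε), eventually_ge_atTop 2]
    with y Hc hM hgrow hL1 hL2 hy2
  simp only [Function.comp] at hgrow
  have hy0 : 0 < y := by linarith
  set N := ⌊exp (exp y)⌋₊
  set Z := ⌊y ^ s⌋₊ with hZdef
  have hys : y ^ s = exp (s * log y) := by rw [rpow_def_of_pos hy0, mul_comm]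
  have hyε : y ^ ε = exp (ε * log y) := by rw [rpow_def_of_pos hy0, mul_comm]
  have hw1 : 1 ≤ y ^ s := one_le_rpow (by linarith) hs0.le
  have hZle : (Z : ℝ) ≤ y ^ s := Nat.floor_le (by positivity)
  have hZ1 : 1 ≤ Z := Nat.le_floor (by simpa using hw1)
  have hZge : y ^ s / 2 ≤ Z := by
    have h1 := Nat.lt_floor_add_one (y ^ s)
    have h2 : (1 : ℝ) ≤ Z := by exact_mod_cast hZ1
    rw [← hZdef] at h1
    linarith
  have hZ0 : (0 : ℝ) < Z := by exact_mod_cast hZ1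
  have hlogZ_le : log Z ≤ s * log y := by
    rw [← log_rpow hy0]; exact log_le_log hZ0 hZle
  have hlogZ_ge : (j + 1) * exp (-a) * log y ≤ log Z := by
    have h1 : s * log y - log 2 ≤ log Z := by
      rw [← log_rpow hy0, ← log_div (by positivity) (by norm_num)]
      exact log_le_log (by positivity) hZge
    have h2 : log 2 ≤ ε * log y := by rwa [div_le_iff₀' hε0] at hL2
    have hj : (0 : ℝ) ≤ j := Nat.cast_nonneg j
    have h3 : (j + 1) * exp (-a) * log y ≤ (s - ε) * log y := by
      gcongr
      rw [hεa, hs]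
      nlinarith
    linarith
  set D : ℕ → ℝ := fun n =>
    ∑ p ∈ Ioc 0 Z with p.Prime ∧ ¬ p ∣ Nat.totient^[j + 1] n, 1 / (p : ℝ) with hD
  have hD0 : ∀ n, 0 ≤ D n := fun n => sum_nonneg fun p _ => by positivity
  have hDsum : ∑ n ∈ Icc 1 N, D n ≤ c * N / y ^ ε * ((s + 1) * log y) := by
    have h1 : ∑ n ∈ Icc 1 N, D n = ∑ p ∈ Ioc 0 Z with p.Prime,
        1 / (p : ℝ) * #{n ∈ Icc 1 N | ¬ p ∣ Nat.totient^[j + 1] n} := by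
      simp only [hD, ← filter_filter]
      simp_rw [sum_filter (fun p => ¬ p ∣ _)]
      rw [sum_comm]
      refine sum_congr rfl fun p _ => ?_
      rw [← sum_filter, sum_const, nsmul_eq_mul, mul_comm]
    rw [h1]
    calc _ ≤ ∑ p ∈ Ioc 0 Z with p.Prime, 1 / (p : ℝ) * (c * N / y ^ ε) := by
          refine sum_le_sum fun p hp => ?_
          have hp' := mem_filter.1 hp
          refine mul_le_mul_of_nonneg_left (Hc p hp'.2 ?_) (by positivity)
          refine le_trans ?_ (hs ▸ hZle)
          exact_mod_cast (mem_Ioc.1 hp'.1).2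
      _ ≤ ∑ p ∈ Ioc 0 Z, 1 / (p : ℝ) * (c * N / y ^ ε) :=
          sum_le_sum_of_subset_of_nonneg (filter_subset _ _) fun p _ _ => by positivity
      _ = c * N / y ^ ε * ∑ p ∈ Ioc 0 Z, 1 / (p : ℝ) := by rw [← sum_mul, mul_comm]
      _ ≤ _ := by
          refine mul_le_mul_of_nonneg_left ((sum_inv_le_one_add_log Z).trans ?_) (by positivity)
          nlinarith
  have hexc : {n ∈ Icc 1 N | κ * (exp (-eulerMascheroniConstant) / ((j + 1) * log y)) *
      (Nat.totient^[j + 1] n : ℝ) < (Nat.totient^[j + 2] n : ℝ)} ⊆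
      {n ∈ Icc 1 N | a / 2 ≤ D n} := by
    refine monotone_filter_right _ fun n _ hn => ?_
    by_contra hlt
    rw [not_le] at hlt
    refine absurd hn (not_lt.2 ?_)
    rw [show j + 2 = (j + 1) + 1 from rfl, Function.iterate_succ_apply']
    refine (totient_le_mul_prod _ Z).trans ?_
    rw [mul_comm]
    refine mul_le_mul_of_nonneg_right ?_ (Nat.cast_nonneg _)
    have h1 : exp (2 * D n) ≤ exp a := exp_le_exp.2 (by linarith)
    have h2 : exp a * exp (-eulerMascheroniConstant) / log Z ≤
        exp a * exp (-eulerMascheroniConstant) / ((j + 1) * exp (-a) * log y) := by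
      gcongr
    calc _ ≤ exp a * exp (-eulerMascheroniConstant) / ((j + 1) * exp (-a) * log y) * exp a :=
          mul_le_mul (hM.trans h2) h1 (exp_pos _).le (by positivity)
      _ = _ := by
          rw [hκa, exp_neg a]
          field_simp
  have hmarkov : (#{n ∈ Icc 1 N | a / 2 ≤ D n} : ℝ) * (a / 2) ≤ ∑ n ∈ Icc 1 N, D n := by
    rw [← nsmul_eq_mul]
    exact (card_nsmul_le_sum _ _ _ fun n hn => (mem_filter.1 hn).2).trans
      (sum_le_sum_of_subset_of_nonneg (filter_subset _ _) fun n _ _ => hD0 n)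
  rw [rpow_natCast, ← hyε, div_le_div_iff₀ (by positivity) (by positivity)] at hgrow
  have hcard : (#{n ∈ Icc 1 N | κ * (exp (-eulerMascheroniConstant) / ((j + 1) * log y)) *
      (Nat.totient^[j + 1] n : ℝ) < (Nat.totient^[j + 2] n : ℝ)} : ℝ) ≤
      #{n ∈ Icc 1 N | a / 2 ≤ D n} := by exact_mod_cast card_le_card hexc
  refine hcard.trans ?_
  have hyε0 : 0 < y ^ ε := by positivity
  refine le_of_mul_le_mul_right ((hmarkov.trans hDsum).trans ?_) (half_pos ha0)
  rw [div_mul_eq_mul_div, div_mul_eq_mul_div, div_le_div_iff₀ hyε0 (by positivity)]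
  calc c * N * ((s + 1) * log y) * log y ^ B = N * (c * (s + 1) * log y ^ (B + 1)) := by ring
    _ ≤ N * (y ^ ε * (τ * (a / 2))) := by gcongr
    _ = _ := by ring

lemma iterate_totient_le (k n : ℕ) : Nat.totient^[k] n ≤ n := by
  induction k with
  | zero => rfl
  | succ k ih => rw [Function.iterate_succ_apply']; exact (Nat.totient_le _).trans ih

open Filter in
/-- Outside a negligible set, `φ_{m+1}(n)` is at most about `φ(n) / (m! (e^γ log log log x)^m)`. -/
lemma eventually_card_lt_iterate_le (m : ℕ) {κ : ℝ} (hκ : 1 < κ) (B : ℕ) {τ : ℝ} (hτ : 0 < τ) :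
    ∀ᶠ y : ℝ in atTop,
      (#{n ∈ Icc 1 ⌊exp (exp y)⌋₊ |
          κ ^ m * ((exp (-eulerMascheroniConstant) / log y) ^ m / m.factorial) *
            (Nat.totient n : ℝ) < (Nat.totient^[m + 1] n : ℝ)} : ℝ) ≤
        τ * ⌊exp (exp y)⌋₊ / log y ^ B := by
  classical
  induction m generalizing τ with
  | zero =>
    filter_upwards [tendsto_log_atTop.eventually_ge_atTop 1] with y hy
    simp only [pow_zero, Nat.factorial_zero, Nat.cast_one, div_one, one_mul, zero_add,
      Function.iterate_one, lt_irrefl, filter_false, card_empty, Nat.cast_zero]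
    positivity
  | succ m ih =>
    filter_upwards [ih (half_pos hτ), eventually_card_lt_iterate_succ_le m hκ B (half_pos hτ),
      tendsto_log_atTop.eventually_ge_atTop 1] with y h1 h2 hy
    set N := ⌊exp (exp y)⌋₊
    have hsub : {n ∈ Icc 1 N |
        κ ^ (m + 1) * ((exp (-eulerMascheroniConstant) / log y) ^ (m + 1) / (m + 1).factorial) *
            (Nat.totient n : ℝ) < (Nat.totient^[m + 1 + 1] n : ℝ)} ⊆
        {n ∈ Icc 1 N | κ ^ m * ((exp (-eulerMascheroniConstant) / log y) ^ m / m.factorial) *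
            (Nat.totient n : ℝ) < (Nat.totient^[m + 1] n : ℝ)} ∪
        {n ∈ Icc 1 N | κ * (exp (-eulerMascheroniConstant) / ((m + 1) * log y)) *
            (Nat.totient^[m + 1] n : ℝ) < (Nat.totient^[m + 2] n : ℝ)} := by
      rw [← filter_or]
      refine monotone_filter_right _ fun n _ hn => ?_
      by_contra! h
      refine absurd hn (not_lt.2 (h.2.trans ?_))
      refine (mul_le_mul_of_nonneg_left h.1 (by positivity)).trans_eq ?_
      rw [Nat.factorial_succ, pow_succ κ, pow_succ (_ / _)]
      push_cast
      field_simp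
    have h3 := (Nat.cast_le (α := ℝ)).2 ((card_le_card hsub).trans (card_union_le _ _))
    push_cast at h3
    refine (h3.trans (add_le_add h1 h2)).trans_eq ?_
    ring

lemma totient_two_mul_le (m : ℕ) : Nat.totient (2 * m) ≤ m := by
  induction m using Nat.strong_induction_on with
  | _ m ih =>
    rcases Nat.even_or_odd m with h | h
    · rcases Nat.eq_zero_or_pos m with rfl | hm
      · simp
      obtain ⟨l, rfl⟩ := h.two_dvd
      rw [Nat.totient_mul_of_prime_of_dvd Nat.prime_two (dvd_mul_right 2 l)]
      have := ih l (by omega)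
      omega
    · rw [Nat.totient_mul_of_prime_of_not_dvd Nat.prime_two h.not_two_dvd_nat]
      simpa using Nat.totient_le m

lemma card_half_lt_totient_le (N : ℕ) :
    (#{n ∈ Icc 1 N | ((n : ℕ) : ℝ) / 2 < Nat.totient n} : ℝ) ≤ (N + 1) / 2 := by
  have h1 : {n ∈ Icc 1 N | ((n : ℕ) : ℝ) / 2 < Nat.totient n} ⊆ {n ∈ Icc 1 N | ¬ 2 ∣ n} := by
    refine monotone_filter_right _ fun n _ hn hdvd => ?_
    obtain ⟨l, rfl⟩ := hdvd
    have := (Nat.cast_le (α := ℝ)).2 (totient_two_mul_le l)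
    push_cast at hn
    linarith
  have h2 := card_filter_add_card_filter_not (s := Icc 1 N) (fun n => 2 ∣ n)
  rw [card_filter_dvd, Nat.card_Icc] at h2
  have h3 : 2 * #{n ∈ Icc 1 N | ((n : ℕ) : ℝ) / 2 < Nat.totient n} ≤ N + 1 := by
    have := card_le_card h1
    omega
  have := (Nat.cast_le (α := ℝ)).2 h3
  push_cast at this
  linarith

open Filter in
lemma eventually_card_le (m : ℕ) :
    ∀ᶠ y : ℝ in atTop, ∀ δ : ℝ, 0 < δ →
      (#{n ∈ Icc 1 ⌊exp (exp y)⌋₊ | δ * ((n : ℕ) : ℝ) ≤ (Nat.totient^[m + 1] n : ℝ)} : ℝ) ≤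
        6 / π ^ 2 * ((exp (-eulerMascheroniConstant) / log y) ^ m / m.factorial) *
          (exp (exp y) / δ) := by
  set κ := exp (log (6 / 5) / (m + 1)) with hκ
  have hlog : 0 < log (6 / 5 : ℝ) := log_pos (by norm_num)
  have hκ1 : 1 < κ := one_lt_exp_iff.2 (by positivity)
  have hκm : κ ^ m ≤ 6 / 5 := by
    rw [hκ, ← exp_nat_mul]
    calc _ ≤ exp (log (6 / 5)) := by
          refine exp_le_exp.2 ?_
          rw [← mul_div_assoc, div_le_iff₀ (by positivity)]
          nlinarith
      _ = _ := exp_log (by norm_num)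
  set e := exp (-eulerMascheroniConstant) with he
  have he0 : 0 < e := exp_pos _
  have he1 : e ≤ 1 := by
    have := one_half_lt_eulerMascheroniConstant
    exact exp_le_one_iff.2 (by linarith)
  have hπ : 0.6 < 6 / π ^ 2 := by
    rw [lt_div_iff₀ (by positivity)]
    nlinarith [pi_lt_d2, pi_pos]
  have hexp : Tendsto (fun y : ℝ => exp (exp y)) atTop atTop :=
    tendsto_exp_atTop.comp tendsto_exp_atTop
  filter_upwards [eventually_card_lt_iterate_le m hκ1 m
      (τ := e ^ m / m.factorial / 1000) (by positivity),
    tendsto_log_atTop.eventually_ge_atTop 1, hexp.eventually_ge_atTop 1000]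
    with y hE hL hx δ hδ
  set x := exp (exp y)
  set N := ⌊x⌋₊
  set F := (e / log y) ^ m / m.factorial with hF
  have hF0 : 0 < F := by positivity
  have hF1 : F ≤ 1 := by
    refine (div_le_self (by positivity) (by exact_mod_cast m.factorial_pos)).trans ?_
    exact pow_le_one₀ (by positivity) ((div_le_one (by positivity)).2 (he1.trans hL))
  have hNx : (N : ℝ) ≤ x := Nat.floor_le (by positivity)
  set E := {n ∈ Icc 1 N | κ ^ m * F * (Nat.totient n : ℝ) < (Nat.totient^[m + 1] n : ℝ)}
  have hE' : (#E : ℝ) ≤ F * x / 1000 := by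
    refine hE.trans ?_
    rw [show e ^ m / m.factorial / 1000 * N / log y ^ m = F * N / 1000 by
      rw [hF, div_pow]; ring]
    gcongr
  set S := {n ∈ Icc 1 N | δ * ((n : ℕ) : ℝ) ≤ (Nat.totient^[m + 1] n : ℝ)} with hS
  have hgood : ∀ n ∈ S, n ∉ E → δ * n ≤ 6 / 5 * F * Nat.totient n := fun n hn hnE => by
    have h1 := mem_filter.1 hn
    have h2 : ¬ κ ^ m * F * (Nat.totient n : ℝ) < (Nat.totient^[m + 1] n : ℝ) :=
      fun h => hnE (mem_filter.2 ⟨h1.1, h⟩)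
    refine (h1.2.trans (not_lt.1 h2)).trans ?_
    gcongr
  rw [mul_div_assoc', le_div_iff₀ hδ]
  have hSN : (#S : ℝ) ≤ x := by
    refine le_trans ?_ hNx
    exact_mod_cast (card_filter_le _ _).trans (by simp)
  rcases le_or_gt δ (6 / π ^ 2 * F) with h1 | h1
  · rw [mul_comm]
    gcongr
  rcases le_or_gt δ (6 / 5 * F) with h2 | h2
  · have hsub : S ⊆ {n ∈ Icc 1 N | ((n : ℕ) : ℝ) / 2 < Nat.totient n} ∪ E := fun n hn => by
      rw [mem_union, or_iff_not_imp_right]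
      intro hnE
      have h3 := hgood n hn hnE
      have h4 := (mem_filter.1 hn).1
      have hn0 : (0 : ℝ) < n := by exact_mod_cast (mem_Icc.1 h4).1
      refine mem_filter.2 ⟨h4, ?_⟩
      have h5 : F * (0.6 * n) < F * (1.2 * Nat.totient n) := by
        calc F * (0.6 * n) ≤ 6 / π ^ 2 * F * n := by
              rw [← mul_assoc, mul_comm F]; gcongr
          _ < δ * n := by gcongr
          _ ≤ _ := h3.trans_eq (by ring)
      have := lt_of_mul_lt_mul_left h5 hF0.le
      linarith
    have h3 := (Nat.cast_le (α := ℝ)).2 ((card_le_card hsub).trans (card_union_le _ _))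
    push_cast at h3
    have h4 := card_half_lt_totient_le N
    have h5 : (#S : ℝ) ≤ 0.502 * x := by nlinarith
    have h6 : 0.6024 ≤ 6 / π ^ 2 := by
      rw [le_div_iff₀ (by positivity)]
      nlinarith [pi_lt_d2, pi_pos]
    calc (#S : ℝ) * δ ≤ 0.502 * x * (6 / 5 * F) := by gcongr
      _ = 0.6024 * F * x := by ring
      _ ≤ _ := by gcongr
  · have hSE : S ⊆ E := fun n hn => by
      by_contra hnE
      have h3 := hgood n hn hnE
      have hn0 : (0 : ℝ) < n := by exact_mod_cast (mem_Icc.1 (mem_filter.1 hn).1).1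
      have h4 : (Nat.totient n : ℝ) ≤ n := by exact_mod_cast Nat.totient_le n
      nlinarith
    rcases le_or_gt δ 1 with h3 | h3
    · have h4 : (#S : ℝ) ≤ #E := by exact_mod_cast card_le_card hSE
      calc (#S : ℝ) * δ ≤ #S * 1 := by gcongr
        _ ≤ F * x / 1000 := by linarith
        _ = 0.001 * F * x := by ring
        _ ≤ _ := by gcongr; linarith
    · have : S = ∅ := filter_eq_empty_iff.2 fun n hn h => by
        have hn0 : (0 : ℝ) < n := by exact_mod_cast (mem_Icc.1 hn).1
        have h4 : (Nat.totient^[m + 1] n : ℝ) ≤ n := by exact_mod_cast iterate_totient_le _ _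
        nlinarith
      rw [this]
      simp only [card_empty, Nat.cast_zero, zero_mul]
      positivity

end IterTotient

/-- Fix an integer `k ≥ 1`. There exists `C > 0` such that for all sufficiently large real
`x` and every real `δ > 0`, the number of positive `n ≤ x` with `φ_k(n) ≥ δ·n` is at most
`(6/((k-1)!·e^{(k-1)γ}·π²)) · x/(δ·(log log log x)^{k-1})
  + C · x/(δ·(log log log x)^k·(log log x)·(log x))`. -/
theorem count_phi_k_ge_delta (k : ℕ) (hk : 1 ≤ k) :
    ∃ C : ℝ, 0 < C ∧ ∃ x₀ : ℝ, ∀ x : ℝ, x₀ ≤ x → ∀ δ : ℝ, 0 < δ →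
      (((Finset.Icc 1 ⌊x⌋₊).filter
          (fun n : ℕ => δ * (n : ℝ) ≤ (Nat.totient^[k] n : ℝ))).card : ℝ) ≤
        6 / ((Nat.factorial (k - 1) : ℝ) *
              Real.exp (((k : ℝ) - 1) * Real.eulerMascheroniConstant) * π ^ 2) *
            (x / (δ * Real.log (Real.log (Real.log x)) ^ (k - 1))) +
          C * (x / (δ * Real.log (Real.log (Real.log x)) ^ k *
            Real.log (Real.log x) * Real.log x)) := by
  obtain ⟨m, rfl⟩ : ∃ m, k = m + 1 := ⟨k - 1, by omega⟩
  have hloglog : Filter.Tendsto (fun x : ℝ => log (log x)) Filter.atTop Filter.atTop :=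
    tendsto_log_atTop.comp tendsto_log_atTop
  obtain ⟨x₀, hx₀⟩ := Filter.eventually_atTop.1
    ((hloglog.eventually (IterTotient.eventually_card_le m)).and
      ((Filter.eventually_gt_atTop 0).and ((tendsto_log_atTop.eventually_gt_atTop 0).and
        ((hloglog.eventually_gt_atTop 0).and
          ((tendsto_log_atTop.comp hloglog).eventually_gt_atTop 0)))))
  refine ⟨1, one_pos, x₀, fun x hx δ hδ => ?_⟩
  obtain ⟨h, h0, h1, h2, h3⟩ := hx₀ x hx
  simp only [Function.comp] at h3
  have h := h δ hδ
  rw [exp_log h1, exp_log h0] at h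
  refine (h.trans_eq ?_).trans (le_add_of_nonneg_right (by positivity))
  rw [Nat.add_sub_cancel, Nat.cast_add_one, add_sub_cancel_right, div_pow, ← exp_nat_mul,
    mul_neg, exp_neg]
  field_simp
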